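/- arXiv:1209.4122 — 5 statements merged into one kernel-verified Lean document; each statement's English description precedes it below -/
import Mathlib

section
/- Let (X, H, Y) be an sl₂-triple of n×n real matrices, and let ν be an n×n real matrix which is diagonalizable over ℂ (i.e., semisimple). Assume that the set O_ν ∩ (X + Z(Y)) = {g ν g⁻¹ : g ∈ GL(n,ℝ)} ∩ {X + C : CY = YC} is nonempty. Then this set is finite if and only if the ℝ-dimension of the centralizer {A ∈ Matrix (Fin n) (Fin n) ℝ : Aν = νA} equals the ℝ-dimension of the centralizer {A ∈ Matrix (Fin n) (Fin n) ℝ : AX = XA} (equivalently, if and only if the conjugation orbits of ν and of X have the same dimension). -/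
namespace SlodowyAux
open Polynomial

section Alg
variable {V : Type*} [AddCommGroup V] [Module ℝ V]

/-- the product of `T - j` for `j < m` -/
noncomputable def fallPoly (m : ℕ) : ℝ[X] := ∏ j ∈ Finset.range m, (X - C (j : ℝ))

lemma fallPoly_succ (m : ℕ) : fallPoly m * (X - C (m : ℝ)) = fallPoly (m + 1) := by
  simp [fallPoly, Finset.prod_range_succ]

/-- commutation relations of an `sl₂`-triple in a ring -/
structure Tri {A : Type*} [Ring A] [Algebra ℝ A] (x h y : A) : Prop where
  hx : h * x - x * h = (2 : ℝ) • x
  hy : h * y - y * h = (-2 : ℝ) • y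
  xy : x * y - y * x = h

lemma Tri.swap {A : Type*} [Ring A] [Algebra ℝ A] {x h y : A} (t : Tri x h y) :
    Tri y (-h) x := by
  refine ⟨?_, ?_, ?_⟩
  · have := t.hy
    rw [show -h * y - y * -h = -(h * y - y * h) by noncomm_ring, this]; simp
  · have := t.hx
    rw [show -h * x - x * -h = -(h * x - x * h) by noncomm_ring, this]; simp
  · have := t.xy
    rw [← this]; noncomm_ring

lemma Tri.x_mul_y_pow {A : Type*} [Ring A] [Algebra ℝ A] {x h y : A} (t : Tri x h y) (j : ℕ) :
    x * y ^ (j + 1) = y ^ (j + 1) * x + ((j : ℝ) + 1) • (y ^ j * (h - (j : ℝ) • 1)) := by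
  have e1 : x * y = y * x + h := by rw [← t.xy]; noncomm_ring
  have e2 : h * y = y * h - (2 : ℝ) • y := by
    have := t.hy
    rw [sub_eq_iff_eq_add] at this
    rw [this]; module
  induction j with
  | zero => simp [e1]
  | succ j ih =>
    rw [pow_succ y (j + 1), ← mul_assoc, ih, add_mul, mul_assoc, e1, smul_mul_assoc, mul_assoc,
      sub_mul, e2]
    push_cast
    simp only [mul_add, mul_sub, smul_sub, mul_smul_comm, smul_mul_assoc, mul_one, one_mul,
      ← mul_assoc, ← pow_succ]
    module

lemma Tri.key {x h y : Module.End ℝ V} (t : Tri x h y) (m : ℕ) :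
    ∃ c : ℝ, c ≠ 0 ∧ ∀ u : V, y (x u) = 0 → (x ^ m) ((y ^ m) u) = c • aeval h (fallPoly m) u := by
  induction m with
  | zero => exact ⟨1, one_ne_zero, fun u _ => by simp [fallPoly]⟩
  | succ m ih =>
    obtain ⟨c, hc, ih⟩ := ih
    refine ⟨((m : ℝ) + 1) * c, by positivity, fun u hu => ?_⟩
    have h1 := congrArg (fun f : Module.End ℝ V => f u) (t.x_mul_y_pow m)
    simp only [Module.End.mul_apply, LinearMap.add_apply, LinearMap.smul_apply] at h1
    have hz : (y ^ (m + 1)) (x u) = 0 := by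
      rw [pow_succ, Module.End.mul_apply, hu, map_zero]
    rw [hz, zero_add] at h1
    have hcomm : y * x * h = h * (y * x) := by
      have e1 : h * x = x * h + (2 : ℝ) • x := by rw [← t.hx]; noncomm_ring
      have e2 : h * y = y * h + (-2 : ℝ) • y := by rw [← t.hy]; noncomm_ring
      rw [← mul_assoc, e2, add_mul, mul_assoc y h x, e1, mul_add]
      simp only [mul_smul_comm, smul_mul_assoc, mul_assoc]
      module
    have hu' : y (x ((h - (m : ℝ) • 1 : Module.End ℝ V) u)) = 0 := by
      have h2 := congrArg (fun f : Module.End ℝ V => f u) hcomm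
      simp only [Module.End.mul_apply] at h2
      simp [hu, h2]
    rw [pow_succ x m, Module.End.mul_apply, h1, map_smul, ih _ hu', ← fallPoly_succ, map_mul,
      Module.End.mul_apply, smul_smul]
    congr 2
    simp [Nat.cast_smul_eq_nsmul]

lemma Tri.nilp [FiniteDimensional ℝ V] {x h y : Module.End ℝ V} (t : Tri x h y) :
    ∃ m, x ^ m = 0 := by
  by_contra hcon
  push Not at hcon
  have hp : ∀ k : ℕ, h * x ^ k - x ^ k * h = ((2 : ℝ) * k) • x ^ k := by
    intro k
    induction k with
    | zero => simp
    | succ k ih =>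
      have : h * x ^ (k + 1) - x ^ (k + 1) * h
        = (h * x ^ k - x ^ k * h) * x + x ^ k * (h * x - x * h) := by
        rw [pow_succ]; noncomm_ring
      rw [this, ih, t.hx, smul_mul_assoc, mul_smul_comm, ← pow_succ]
      push_cast; module
  let T : Module.End ℝ (Module.End ℝ V) := LinearMap.mulLeft ℝ h - LinearMap.mulRight ℝ h
  have hev : ∀ k : ℕ, T.HasEigenvalue ((2 : ℝ) * k) := fun k =>
    Module.End.hasEigenvalue_of_hasEigenvector (x := x ^ k)
      ⟨Module.End.mem_eigenspace_iff.mpr (hp k), hcon k⟩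
  have hfin : (Set.range fun k : ℕ => (2 : ℝ) * k).Finite :=
    (Module.End.finite_hasEigenvalue T).subset (by rintro _ ⟨k, rfl⟩; exact hev k)
  refine Set.infinite_range_of_injective ?_ hfin
  intro a b hab
  simpa using hab

lemma Tri.kill [FiniteDimensional ℝ V] {x h y : Module.End ℝ V} (t : Tri x h y) :
    ∃ m, ∀ u : V, y (x u) = 0 → aeval h (fallPoly m) u = 0 := by
  obtain ⟨m, hm⟩ := t.swap.nilp
  obtain ⟨c, hc, h1⟩ := t.key m
  refine ⟨m, fun u hu => ?_⟩
  have := h1 u hu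
  rw [hm] at this
  simpa [hc] using this.symm

/-- `range x ∩ ker y = 0` -/
lemma Tri.inter [FiniteDimensional ℝ V] {x h y : Module.End ℝ V} (t : Tri x h y) (u : V)
    (hu : y (x u) = 0) : x u = 0 := by
  obtain ⟨m, hm⟩ := t.kill
  obtain ⟨k, hk⟩ := t.swap.kill
  have h1 := hm u hu
  have h2 := hk (x u) (by rw [hu, map_zero])
  -- transfer
  have e1 : ∀ p : ℝ[X], x * aeval h p = aeval (h - (2 : ℝ) • 1) p * x := by
    have e0 : x * h = (h - (2 : ℝ) • 1) * x := by
      have := t.hx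
      rw [sub_mul, smul_mul_assoc, one_mul, ← this]; noncomm_ring
    intro p
    induction p using Polynomial.induction_on' with
    | add p q hp hq => simp [mul_add, add_mul, hp, hq]
    | monomial n a =>
      have : x * h ^ n = (h - (2 : ℝ) • 1) ^ n * x := by
        induction n with
        | zero => simp
        | succ n ih => rw [pow_succ, ← mul_assoc, ih, mul_assoc, e0, ← mul_assoc, ← pow_succ]
      simp [aeval_monomial, Algebra.algebraMap_eq_smul_one, this]
  have h3 : aeval (h - (2 : ℝ) • 1) (fallPoly m) (x u) = 0 := by
    have := congrArg (fun f : Module.End ℝ V => f u) (e1 (fallPoly m))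
    simp only [Module.End.mul_apply, h1, map_zero] at this
    exact this.symm
  have h4 : aeval h ((fallPoly m).comp (X - C 2)) (x u) = 0 := by
    rw [aeval_comp]
    simpa [Algebra.algebraMap_eq_smul_one] using h3
  have h5 : aeval h ((fallPoly k).comp (-X)) (x u) = 0 := by
    rw [aeval_comp]
    simpa using h2
  have hcop : IsCoprime ((fallPoly m).comp (X - C 2)) ((fallPoly k).comp (-X)) := by
    simp only [fallPoly, Polynomial.prod_comp]
    refine IsCoprime.prod_left fun i _ => IsCoprime.prod_right fun j _ => ?_
    refine ⟨C ((2 + i + j : ℝ)⁻¹ * (-1)), C ((2 + i + j : ℝ)⁻¹ * (-1)), ?_⟩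
    have : (2 + i + j : ℝ) ≠ 0 := by positivity
    rw [← mul_add]
    have e : ((X - C (i : ℝ)).comp (X - C 2) + (X - C (j : ℝ)).comp (-X) : ℝ[X])
      = C (-(2 + i + j : ℝ)) := by
      simp only [sub_comp, X_comp, C_comp, map_neg, map_add]; ring
    rw [e, ← C_mul, ← C_1]
    congr 1
    field_simp
  obtain ⟨a, b, hab⟩ := hcop
  have := congrArg (fun p => aeval h p (x u)) hab
  simpa [h4, h5] using this.symm

open Module in
lemma Tri.finrank_le [FiniteDimensional ℝ V] {x h y : Module.End ℝ V} (t : Tri x h y) :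
    finrank ℝ (LinearMap.ker y) ≤ finrank ℝ (LinearMap.ker x) := by
  have hd : Disjoint (LinearMap.range x) (LinearMap.ker y) := by
    rw [Submodule.disjoint_def]
    rintro _ ⟨u, rfl⟩ hu
    exact t.inter u hu
  have h1 := Submodule.finrank_add_finrank_le_of_disjoint hd
  have h2 := LinearMap.finrank_range_add_finrank_ker x
  omega

open Module in
lemma Tri.finrank_eq [FiniteDimensional ℝ V] {x h y : Module.End ℝ V} (t : Tri x h y) :
    finrank ℝ (LinearMap.ker y) = finrank ℝ (LinearMap.ker x) :=
  le_antisymm t.finrank_le t.swap.finrank_le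

open Module in
lemma Tri.sup [FiniteDimensional ℝ V] {x h y : Module.End ℝ V} (t : Tri x h y) :
    LinearMap.range x ⊔ LinearMap.ker y = ⊤ := by
  have hd : LinearMap.range x ⊓ LinearMap.ker y = ⊥ := by
    rw [← disjoint_iff, Submodule.disjoint_def]
    rintro _ ⟨u, rfl⟩ hu
    exact t.inter u hu
  apply Submodule.eq_top_of_finrank_eq
  have h1 := Submodule.finrank_sup_add_finrank_inf_eq (LinearMap.range x) (LinearMap.ker y)
  rw [hd, finrank_bot] at h1
  have h2 := LinearMap.finrank_range_add_finrank_ker x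
  have h3 := t.finrank_eq
  omega

/-- decomposition into eigenvectors -/
lemma decomp (T : Module.End ℝ V) (W : Submodule ℝ V) (m : ℕ)
    (hW : ∀ (j : ℕ) (v : V), T v = (j : ℝ) • v → v ∈ W) :
    ∀ v : V, aeval T (fallPoly m) v = 0 → v ∈ W := by
  have hev : ∀ (p : ℝ[X]) (a : ℝ) (w : V), T w = a • w → aeval T p w = p.eval a • w := by
    intro p a w hw
    by_cases h0 : w = 0
    · simp [h0]
    · exact Module.End.aeval_apply_of_hasEigenvector ⟨Module.End.mem_eigenspace_iff.mpr hw, h0⟩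
  induction m with
  | zero => intro v hv; simp [fallPoly] at hv; simp [hv]
  | succ m ih =>
    intro v hv
    set w := aeval T (fallPoly m) v with hw
    have hTw : T w = (m : ℝ) • w := by
      rw [← fallPoly_succ, mul_comm, map_mul, Module.End.mul_apply, ← hw] at hv
      simp [sub_eq_zero] at hv
      simpa [Nat.cast_smul_eq_nsmul] using hv
    have hne : (fallPoly m).eval (m : ℝ) ≠ 0 := by
      simp only [fallPoly, eval_prod, eval_sub, eval_X, eval_C]
      refine Finset.prod_ne_zero_iff.mpr fun i hi => ?_
      rw [sub_ne_zero]
      have := Finset.mem_range.mp hi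
      exact_mod_cast this.ne'
    have hv' : v - ((fallPoly m).eval (m : ℝ))⁻¹ • w ∈ W := by
      apply ih
      rw [map_sub, map_smul, ← hw, hev _ _ _ hTw, smul_smul, inv_mul_cancel₀ hne, one_smul, sub_self]
    have := W.add_mem hv' (W.smul_mem ((fallPoly m).eval (m : ℝ))⁻¹ (hW m w hTw))
    simpa using this
end Alg

section Ana
open Filter Topology Module
variable {R : Type*} [NormedRing R] [NormedAlgebra ℝ R]

/-- the adjoint action -/
noncomputable def ad : R →L[ℝ] R →L[ℝ] R :=
  ContinuousLinearMap.mul ℝ R - (ContinuousLinearMap.mul ℝ R).flip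

lemma ad_apply (A B : R) : ad A B = A * B - B * A := by simp [ad]

/-- the adjoint action as an endomorphism -/
noncomputable def adl (A : R) : Module.End ℝ R := (ad A).toLinearMap

lemma adl_apply (A B : R) : adl A B = A * B - B * A := ad_apply A B

lemma Tri.adl {X H Y : R} (t : Tri X H Y) : Tri (adl X) (adl H) (adl Y) := by
  have hb : ∀ A B : R, SlodowyAux.adl A * SlodowyAux.adl B - SlodowyAux.adl B * SlodowyAux.adl A
      = SlodowyAux.adl (A * B - B * A) := by
    intro A B
    ext M
    simp only [LinearMap.sub_apply, Module.End.mul_apply, adl_apply]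
    noncomm_ring
  have hs : ∀ (r : ℝ) (A : R), SlodowyAux.adl (r • A) = r • SlodowyAux.adl A := by
    intro r A
    ext M
    simp [adl_apply, smul_sub]
  exact ⟨by rw [hb, t.hx, hs], by rw [hb, t.hy, hs], by rw [hb, t.xy]⟩

lemma Tri.kill_low [FiniteDimensional ℝ R] {X H Y : R} (t : Tri X H Y) :
    ∃ m, ∀ C : R, SlodowyAux.adl Y C = 0 → aeval (-(SlodowyAux.adl H)) (fallPoly m) C = 0 := by
  obtain ⟨m, hm⟩ := t.adl.swap.kill
  exact ⟨m, fun C hC => hm C (by rw [hC, map_zero])⟩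

set_option linter.unusedSectionVars false
section Exp
variable [NormedAlgebra ℚ R] [CompleteSpace R]

/-- the one-parameter group generated by `H` -/
noncomputable def ee (H : R) (u : ℝ) : R := NormedSpace.exp (u • H)

lemma ee_zero (H : R) : ee H 0 = 1 := by simp [ee]

lemma ee_mul_neg (H : R) (u : ℝ) : ee H u * ee H (-u) = 1 := by
  have : Commute (u • H) ((-u) • H) := ((Commute.refl H).smul_left u).smul_right (-u)
  rw [ee, ee, ← NormedSpace.exp_add_of_commute this]
  simp

lemma ee_neg_mul (H : R) (u : ℝ) : ee H (-u) * ee H u = 1 := by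
  simpa using ee_mul_neg H (-u)

lemma ee_continuous (H : R) : Continuous (ee H) :=
  NormedSpace.exp_continuous.comp (continuous_id.smul continuous_const)

lemma ee_conj {H C : R} {a : ℝ} (h : H * C - C * H = a • C) (u : ℝ) :
    ee H u * C * ee H (-u) = Real.exp (u * a) • C := by
  have hs : SemiconjBy C (u • H + algebraMap ℝ R (u * a)) (u • H) := by
    have h' : H * C = C * H + a • C := by rw [← h]; abel
    rw [SemiconjBy, mul_add, smul_mul_assoc, h', Algebra.algebraMap_eq_smul_one]
    simp [smul_smul]
  have h2 := hs.exp_right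
  rw [SemiconjBy, NormedSpace.exp_add_of_commute ((Algebra.commutes _ _).symm),
    ← NormedSpace.algebraMap_exp_comm, ← Real.exp_eq_exp_ℝ] at h2
  change C * (ee H u * _) = ee H u * C at h2
  rw [← h2, ← Algebra.commutes, mul_assoc, mul_assoc, ee_mul_neg, mul_one, ← Algebra.commutes,
    Algebra.smul_def]

/-- the contracting action -/
noncomputable def Phi (H : R) (u : ℝ) (C : R) : R :=
  Real.exp (-2 * u) • (ee H u * C * ee H (-u))

lemma Phi_zero (H C : R) : Phi H 0 C = C := by simp [Phi, ee_zero]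

lemma Phi_add (H : R) (u : ℝ) (C D : R) : Phi H u (C + D) = Phi H u C + Phi H u D := by
  simp [Phi, mul_add, add_mul]

lemma Phi_smul (H : R) (u r : ℝ) (C : R) : Phi H u (r • C) = r • Phi H u C := by
  simp [Phi, smul_comm r]

lemma Phi_continuous (H C : R) : Continuous fun u => Phi H u C := by
  have h1 := ee_continuous H
  have h2 : Continuous fun u => ee H (-u) := h1.comp continuous_neg
  unfold Phi
  fun_prop

lemma Phi_eigen {H C : R} {a : ℝ} (h : H * C - C * H = a • C) (u : ℝ) :
    Phi H u C = Real.exp (u * (a - 2)) • C := by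
  rw [Phi, ee_conj h, smul_smul, ← Real.exp_add]
  congr 2; ring

lemma Phi_X {X H Y : R} (t : Tri X H Y) (u : ℝ) : Phi H u X = X := by
  rw [Phi_eigen t.hx]; simp

lemma conj_Y {X H Y : R} (t : Tri X H Y) (u : ℝ) :
    ee H u * Y * ee H (-u) = Real.exp (u * -2) • Y := ee_conj t.hy u

/-- conjugation preserves the centralizer of `Y` -/
lemma conj_comm {X H Y : R} (t : Tri X H Y) (u : ℝ) {C : R} (hC : ad Y C = 0) :
    ad Y (ee H u * C * ee H (-u)) = 0 := by
  have h0 : ee H (-u) * ee H u = 1 := ee_neg_mul H u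
  have hY : Y = Real.exp (u * 2) • (ee H u * Y * ee H (-u)) := by
    rw [conj_Y t, smul_smul, ← Real.exp_add]; simp
  have hC' : Y * C = C * Y := by rwa [ad_apply, sub_eq_zero] at hC
  rw [hY, map_smul, _root_.smul_apply, ad_apply]
  have e1 : ee H u * Y * ee H (-u) * (ee H u * C * ee H (-u)) = ee H u * (Y * C) * ee H (-u) := by
    calc _ = ee H u * Y * (ee H (-u) * ee H u) * C * ee H (-u) := by noncomm_ring
      _ = _ := by rw [h0]; noncomm_ring
  have e2 : ee H u * C * ee H (-u) * (ee H u * Y * ee H (-u)) = ee H u * (C * Y) * ee H (-u) := by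
    calc _ = ee H u * C * (ee H (-u) * ee H u) * Y * ee H (-u) := by noncomm_ring
      _ = _ := by rw [h0]; noncomm_ring
  rw [e1, e2, hC', sub_self, smul_zero]

lemma Phi_comm {X H Y : R} (t : Tri X H Y) (u : ℝ) {C : R} (hC : ad Y C = 0) :
    ad Y (Phi H u C) = 0 := by
  rw [Phi, map_smul, conj_comm t u hC, smul_zero]

lemma Phi_tendsto [FiniteDimensional ℝ R] {X H Y : R} (t : Tri X H Y) {C : R} (hC : ad Y C = 0) :
    Tendsto (fun u => Phi H u C) atTop (𝓝 0) := by
  obtain ⟨m, hm⟩ := t.kill_low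
  let W : Submodule ℝ R :=
    { carrier := {C | Tendsto (fun u => Phi H u C) atTop (𝓝 0)}
      zero_mem' := by simp [Phi]
      add_mem' := by
        intro a b ha hb
        simpa [Phi_add] using Tendsto.add ha hb
      smul_mem' := by
        intro r a ha
        simpa [Phi_smul] using Tendsto.const_smul ha r }
  refine decomp (-(adl H)) W m ?_ C (hm C hC)
  intro j v hv
  change Tendsto (fun u => Phi H u v) atTop (𝓝 0)
  have hv' : H * v - v * H = (-(j : ℝ)) • v := by
    rw [neg_smul, ← hv, LinearMap.neg_apply, neg_neg, adl_apply]
  simp_rw [Phi_eigen hv']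
  have : Tendsto (fun u : ℝ => Real.exp (u * (-(j : ℝ) - 2))) atTop (𝓝 0) := by
    refine Real.tendsto_exp_atBot.comp ?_
    refine Tendsto.atTop_mul_const_of_neg ?_ tendsto_id
    have : (0 : ℝ) ≤ j := Nat.cast_nonneg j
    linarith
  simpa using this.smul_const v

lemma norm_le_Phi (H : R) (u : ℝ) (C : R) :
    ‖C‖ ≤ Real.exp (2 * u) * (‖ee H (-u)‖ * ‖Phi H u C‖ * ‖ee H u‖) := by
  have : C = Real.exp (2 * u) • (ee H (-u) * Phi H u C * ee H u) := by
    rw [Phi, mul_smul_comm, smul_mul_assoc, smul_smul, ← Real.exp_add]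
    have h0 := ee_neg_mul H u
    have : ee H (-u) * (ee H u * C * ee H (-u)) * ee H u
      = (ee H (-u) * ee H u) * C * (ee H (-u) * ee H u) := by noncomm_ring
    rw [this, h0]; simp
  calc ‖C‖ = ‖Real.exp (2 * u) • (ee H (-u) * Phi H u C * ee H u)‖ := by rw [← this]
    _ = Real.exp (2 * u) * ‖ee H (-u) * Phi H u C * ee H u‖ := by
      rw [norm_smul, Real.norm_eq_abs, abs_of_pos (Real.exp_pos _)]
    _ ≤ _ := by
      gcongr
      exact (norm_mul_le _ _).trans (by gcongr; exact norm_mul_le _ _)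

end Exp

/-- dimension of the centralizer -/
noncomputable def zdim (A : R) : ℕ := finrank ℝ (LinearMap.ker (adl A))

lemma zdim_le_of_conj [FiniteDimensional ℝ R] {A B g g' : R} (τ : ℝ) (h2 : g' * g = 1) (hB : B = τ • (g * A * g')) : zdim A ≤ zdim B := by
  let L : R →ₗ[ℝ] R := (LinearMap.mulLeft ℝ g).comp (LinearMap.mulRight ℝ g')
  have hL : ∀ M, L M = g * (M * g') := fun M => rfl
  have hmaps : ∀ M ∈ LinearMap.ker (adl A), L M ∈ LinearMap.ker (adl B) := by
    intro M hM
    rw [LinearMap.mem_ker, adl_apply] at hM ⊢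
    have e1 : g * A * g' * (g * (M * g')) = g * (A * M) * g' := by
      calc _ = g * A * (g' * g) * M * g' := by noncomm_ring
        _ = _ := by rw [h2]; noncomm_ring
    have e2 : g * (M * g') * (g * A * g') = g * (M * A) * g' := by
      calc _ = g * M * (g' * g) * A * g' := by noncomm_ring
        _ = _ := by rw [h2]; noncomm_ring
    rw [hL, hB, smul_mul_assoc, mul_smul_comm, e1, e2, sub_eq_zero.mp hM, sub_self]
  refine LinearMap.finrank_le_finrank_of_injective (f := L.restrict hmaps) ?_
  intro M N hMN
  have h3 : L M = L N := congrArg Subtype.val hMN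
  apply Subtype.ext
  have h4 : g' * L M * g = g' * L N * g := by rw [h3]
  rw [hL, hL] at h4
  have e : ∀ M : R, g' * (g * (M * g')) * g = M := by
    intro M
    calc _ = (g' * g) * M * (g' * g) := by noncomm_ring
      _ = M := by rw [h2]; noncomm_ring
  rwa [e, e] at h4

lemma isClosed_zdim [FiniteDimensional ℝ R] (d : ℕ) : IsClosed {A : R | d ≤ zdim A} := by
  rw [← isOpen_compl_iff]
  have h1 := isOpen_setOfPred_nat_le_rank (𝕜 := ℝ) (E := R) (F := R) (finrank ℝ R + 1 - d)
  have h2 := h1.preimage (ad (R := R)).continuous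
  convert h2 using 1
  ext A
  have h3 := LinearMap.finrank_range_add_finrank_ker (adl A)
  have h4 : (adl A).rank = (finrank ℝ (LinearMap.range (adl A)) : Cardinal) := by
    rw [finrank_eq_rank]
  change ¬ (d ≤ finrank ℝ (LinearMap.ker (adl A))) ↔
    ((finrank ℝ R + 1 - d : ℕ) : Cardinal) ≤ (adl A).rank
  rw [h4, Nat.cast_le]
  omega

/-- transversality at `A` -/
def Trans (Y A : R) : Prop := ∀ M : R, ∃ E : R, ad Y (M - ad A E) = 0

lemma trans_iff [FiniteDimensional ℝ R] (Y A : R) :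
    Trans Y A ↔ finrank ℝ (LinearMap.range (adl Y)) ≤
      finrank ℝ (LinearMap.range (adl Y * adl A)) := by
  have hle : LinearMap.range (adl Y * adl A) ≤ LinearMap.range (adl Y) :=
    LinearMap.range_comp_le_range _ _
  constructor
  · intro h
    apply Submodule.finrank_mono
    rintro _ ⟨M, rfl⟩
    obtain ⟨E, hE⟩ := h M
    rw [map_sub, sub_eq_zero] at hE
    exact ⟨E, hE.symm⟩
  · intro h M
    have heq := Submodule.eq_of_le_of_finrank_le hle h
    have : adl Y M ∈ LinearMap.range (adl Y * adl A) := by rw [heq]; exact ⟨M, rfl⟩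
    obtain ⟨E, hE⟩ := this
    refine ⟨E, ?_⟩
    rw [map_sub, sub_eq_zero]
    exact hE.symm

lemma isOpen_trans [FiniteDimensional ℝ R] (Y : R) : IsOpen {A : R | Trans Y A} := by
  have h1 := isOpen_setOfPred_nat_le_rank (𝕜 := ℝ) (E := R) (F := R)
    (finrank ℝ (LinearMap.range (adl Y)))
  have hc : Continuous fun A : R => (ad Y).comp (ad A) :=
    continuous_const.clm_comp (ad (R := R)).continuous
  convert h1.preimage hc using 1
  ext A
  change Trans Y A ↔ ((finrank ℝ (LinearMap.range (adl Y)) : ℕ) : Cardinal) ≤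
    LinearMap.rank (adl Y * adl A)
  rw [trans_iff, ← Nat.cast_le (α := Cardinal), finrank_eq_rank ℝ (LinearMap.range (adl Y * adl A))]

section Exp2
variable [NormedAlgebra ℚ R] [FiniteDimensional ℝ R] [CompleteSpace R]

lemma trans_slice {X H Y : R} (t : Tri X H Y) {C : R} (hC : ad Y C = 0) : Trans Y (X + C) := by
  have hX : Trans Y X := by
    intro M
    have : M ∈ LinearMap.range (adl X) ⊔ LinearMap.ker (adl Y) := by rw [t.adl.sup]; trivial
    obtain ⟨_, ⟨E, rfl⟩, Z, hZ, rfl⟩ := Submodule.mem_sup.mp this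
    refine ⟨E, ?_⟩
    have : adl X E + Z - ad X E = Z := by change ad X E + Z - ad X E = Z; abel
    rw [this]; exact hZ
  have ht : Tendsto (fun u => X + Phi H u C) atTop (𝓝 X) := by
    simpa using (Phi_tendsto t hC).const_add X
  have hev := ht.eventually ((isOpen_trans Y).mem_nhds hX)
  obtain ⟨u, hu⟩ := hev.exists
  have hA : X + Phi H u C = Real.exp (-2 * u) • (ee H u * (X + C) * ee H (-u)) := by
    conv_lhs => rw [← Phi_X t u, ← Phi_add, Phi]
  intro M
  obtain ⟨F, hF⟩ := hu (ee H u * M * ee H (-u))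
  have h1 := ee_mul_neg H u
  have h2 := ee_neg_mul H u
  refine ⟨Real.exp (-2 * u) • (ee H (-u) * F * ee H u), ?_⟩
  have h3 := conj_comm t (-u) hF
  rw [neg_neg] at h3
  rw [← h3]
  congr 1
  rw [hA]
  simp only [map_smul, _root_.smul_apply]
  rw [mul_sub, sub_mul]
  generalize ee H u = g at *
  generalize ee H (-u) = g' at *
  have e1 : g' * (g * M * g') * g = M := by
    calc _ = (g' * g) * M * (g' * g) := by noncomm_ring
      _ = M := by rw [h2]; noncomm_ring
  have e2 : g' * ad (g * (X + C) * g') F * g = ad (X + C) (g' * F * g) := by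
    rw [ad_apply, ad_apply]
    generalize X + C = A
    calc _ = (g' * g) * A * g' * F * g - g' * F * g * A * (g' * g) := by noncomm_ring
      _ = _ := by rw [h2]; noncomm_ring
  rw [e1, mul_smul_comm, smul_mul_assoc, e2]

lemma zdim_Y {X H Y : R} (t : Tri X H Y) : zdim Y = zdim X := t.adl.finrank_eq

/-- at a slice point, with large centralizer, the intersection is trivial -/
lemma inter_slice {X H Y : R} (t : Tri X H Y) {A : R} (hA : ad Y (A - X) = 0)
    (hd : zdim X ≤ zdim A) (E : R) (hE : ad Y (ad A E) = 0) : ad A E = 0 := by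
  have htr : Trans Y A := by
    have := trans_slice t hA
    rwa [add_sub_cancel] at this
  have hsup : LinearMap.range (adl A) ⊔ LinearMap.ker (adl Y) = ⊤ := by
    rw [eq_top_iff]
    intro M _
    obtain ⟨E, hE⟩ := htr M
    refine Submodule.mem_sup.mpr ⟨adl A E, ⟨E, rfl⟩, M - ad A E, hE, ?_⟩
    change ad A E + (M - ad A E) = M
    abel
  have h1 := Submodule.finrank_sup_add_finrank_inf_eq (LinearMap.range (adl A))
    (LinearMap.ker (adl Y))
  rw [hsup, finrank_top] at h1
  have h2 := LinearMap.finrank_range_add_finrank_ker (adl A)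
  have h3 := zdim_Y t
  have h4 : finrank ℝ ↥(LinearMap.range (adl A) ⊓ LinearMap.ker (adl Y)) = 0 := by
    unfold zdim at *
    omega
  have h5 := Submodule.finrank_eq_zero.mp h4
  have h6 : ad A E ∈ LinearMap.range (adl A) ⊓ LinearMap.ker (adl Y) := ⟨⟨E, rfl⟩, hE⟩
  rw [h5] at h6
  simpa using h6

lemma zdim_slice_le {X H Y : R} (t : Tri X H Y) {A : R} (hA : ad Y (A - X) = 0) :
    zdim A ≤ zdim X := by
  have htr : Trans Y A := by
    have := trans_slice t hA
    rwa [add_sub_cancel] at this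
  have h1 := (trans_iff Y A).mp htr
  have h2 : finrank ℝ (LinearMap.range (adl Y * adl A)) ≤ finrank ℝ (LinearMap.range (adl A)) := by
    change finrank ℝ (LinearMap.range ((adl Y).comp (adl A))) ≤ _
    rw [LinearMap.range_comp]
    exact Submodule.finrank_map_le _ _
  have h3 := LinearMap.finrank_range_add_finrank_ker (adl A)
  have h4 := LinearMap.finrank_range_add_finrank_ker (adl Y)
  have h5 := zdim_Y t
  unfold zdim at *
  omega

lemma rigid {X H Y : R} (t : Tri X H Y) {A : R} (hA : ad Y (A - X) = 0)
    (hd : zdim X ≤ zdim A) (hN : ∃ E, ad A E = A) : A = X := by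
  obtain ⟨E, hE⟩ := hN
  obtain ⟨C, rfl⟩ : ∃ C, A = X + C := ⟨A - X, by abel⟩
  rw [add_sub_cancel_left] at hA
  have hHC : ad Y (ad H C) = 0 := by
    have e1 : Y * C = C * Y := by rwa [ad_apply, sub_eq_zero] at hA
    have e2 : H * Y = Y * H + (-2 : ℝ) • Y := by rw [← t.hy]; abel
    have e3 : Y * H = H * Y + (2 : ℝ) • Y := by rw [e2]; module
    rw [ad_apply, ad_apply]
    calc Y * (H * C - C * H) - (H * C - C * H) * Y
        = (Y * H) * C - (Y * C) * H - H * (C * Y) + C * (H * Y) := by noncomm_ring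
      _ = (H * Y + (2 : ℝ) • Y) * C - (C * Y) * H - H * (Y * C)
          + C * (Y * H + (-2 : ℝ) • Y) := by rw [← e1, ← e2, ← e3]
      _ = 0 := by
        rw [add_mul, mul_add, smul_mul_assoc, mul_smul_comm, e1, mul_assoc, e1]
        simp only [← mul_assoc]
        module
  have hX2 : ad H X = (2 : ℝ) • X := by rw [ad_apply]; exact t.hx
  have h1 : ad (X + C) ((2 : ℝ) • E + H) = (2 : ℝ) • C - ad H C := by
    rw [map_add, map_smul, hE]
    have : ad (X + C) H = - ad H (X + C) := by rw [ad_apply, ad_apply]; abel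
    rw [this, map_add, hX2]
    module
  have h2 := inter_slice t (A := X + C) (by rw [add_sub_cancel_left]; exact hA) hd
    ((2 : ℝ) • E + H) (by rw [h1, map_sub, map_smul, hA, hHC]; simp)
  rw [h1, sub_eq_zero] at h2
  have h3 : Phi H 1 C = C := by
    rw [Phi_eigen (a := 2) (by rw [← ad_apply]; exact h2.symm)]; simp
  have h4 : ∀ u, Phi H u C = C := by
    intro u
    rw [Phi_eigen (a := 2) (by rw [← ad_apply]; exact h2.symm)]; simp
  have h5 := Phi_tendsto t hA
  simp_rw [h4] at h5
  rw [tendsto_nhds_unique tendsto_const_nhds h5, add_zero]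

end Exp2

lemma conj_pow_aux {A g g' : R} (h1 : g * g' = 1) (h2 : g' * g = 1) (i : ℕ) :
    (g * A * g') ^ i = g * A ^ i * g' := by
  induction i with
  | zero => simp [h1]
  | succ i ih =>
    rw [pow_succ, ih]
    calc _ = g * A ^ i * (g' * g) * A * g' := by noncomm_ring
      _ = _ := by rw [h2, mul_one, pow_succ]; noncomm_ring

lemma aeval_conj {A g g' : R} (h1 : g * g' = 1) (h2 : g' * g = 1) (p : ℝ[X]) :
    aeval (g * A * g') p = g * aeval A p * g' := by
  rw [aeval_eq_sum_range, aeval_eq_sum_range, Finset.mul_sum, Finset.sum_mul]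
  refine Finset.sum_congr rfl fun i _ => ?_
  rw [conj_pow_aux h1 h2]; simp

/-- homogenization of a polynomial -/
noncomputable def hom (p : ℝ[X]) (τ : ℝ) (B : R) : R :=
  ∑ i ∈ Finset.range (p.natDegree + 1), (p.coeff i * τ ^ (p.natDegree - i)) • B ^ i

lemma hom_smul (p : ℝ[X]) (τ : ℝ) (B : R) : hom p τ (τ • B) = τ ^ p.natDegree • aeval B p := by
  rw [aeval_eq_sum_range, hom, Finset.smul_sum]
  refine Finset.sum_congr rfl fun i hi => ?_
  have hi' : i ≤ p.natDegree := by have := Finset.mem_range.mp hi; omega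
  rw [_root_.smul_pow, smul_smul, smul_smul]
  congr 1
  rw [mul_assoc, ← pow_add, Nat.sub_add_cancel hi', mul_comm]

lemma hom_zero {p : ℝ[X]} (hp : p.Monic) (B : R) : hom p 0 B = B ^ p.natDegree := by
  rw [hom, Finset.sum_eq_single p.natDegree]
  · simp [hp.coeff_natDegree]
  · intro i hi hne
    have := Finset.mem_range.mp hi
    have h : p.natDegree - i ≠ 0 := by omega
    simp [h]
  · simp

lemma hom_continuous (p : ℝ[X]) : Continuous fun q : ℝ × R => hom p q.1 q.2 := by
  unfold hom
  fun_prop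

section Exp3
variable [NormedAlgebra ℚ R] [FiniteDimensional ℝ R] [CompleteSpace R]

lemma bounded_slice {X H Y : R} (t : Tri X H Y)
    (hnil : ∀ N : R, IsNilpotent N → ∃ E, ad N E = N) {p : ℝ[X]} (hp : p.Monic) :
    ∃ K : ℝ, ∀ C : R, ad Y C = 0 → aeval (X + C) p = 0 → zdim X ≤ zdim (X + C) → ‖C‖ ≤ K := by
  by_contra hcon
  push Not at hcon
  choose c hc1 hc2 hc3 hc4 using fun k : ℕ => hcon (k + 1)
  have hu : ∀ k, ∃ u : ℝ, 0 ≤ u ∧ ‖Phi H u (c k)‖ = 1 := by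
    intro k
    have h1 := (Phi_tendsto t (hc1 k)).norm
    rw [norm_zero] at h1
    have h2 := (h1.eventually (gt_mem_nhds one_pos)).and (eventually_ge_atTop 0)
    obtain ⟨b, hb1, hb0⟩ := h2.exists
    have hcont : ContinuousOn (fun u => ‖Phi H u (c k)‖) (Set.Icc 0 b) :=
      (Phi_continuous H (c k)).norm.continuousOn
    have h3 := intermediate_value_Icc' hb0 hcont
    have h4 : (1 : ℝ) ∈ Set.Icc ‖Phi H b (c k)‖ ‖Phi H 0 (c k)‖ := by
      refine ⟨hb1.le, ?_⟩
      rw [Phi_zero]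
      have := hc4 k
      have : (0 : ℝ) ≤ k := Nat.cast_nonneg k
      linarith [hc4 k]
    obtain ⟨u, hu, hu1⟩ := h3 h4
    exact ⟨u, hu.1, hu1⟩
  choose u hu0 hu1 using hu
  have hut : Tendsto u atTop atTop := by
    rw [tendsto_atTop]
    intro b
    have hcont : Continuous fun u : ℝ => Real.exp (2 * u) * (‖ee H (-u)‖ * 1 * ‖ee H u‖) := by
      have h1 := ee_continuous H
      have h2 : Continuous fun u => ee H (-u) := h1.comp continuous_neg
      fun_prop
    obtain ⟨K, hK⟩ := (isCompact_Icc (a := (0 : ℝ)) (b := b)).bddAbove_image hcont.continuousOn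
    obtain ⟨k0, hk0⟩ := exists_nat_ge K
    filter_upwards [eventually_ge_atTop k0] with k hk
    by_contra hlt
    push Not at hlt
    have h1 := hK (Set.mem_image_of_mem _ (⟨hu0 k, hlt.le⟩ : u k ∈ Set.Icc 0 b))
    have h2 := norm_le_Phi H (u k) (c k)
    rw [hu1 k] at h2
    have h3 := hc4 k
    have h4 : (k0 : ℝ) ≤ k := by exact_mod_cast hk
    linarith
  have : ProperSpace R := FiniteDimensional.proper ℝ R
  obtain ⟨D, hD, φ, hφ, hlim⟩ := (isCompact_sphere (0 : R) 1).tendsto_subseq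
    (x := fun k => Phi H (u k) (c k)) (fun k => by simp [hu1 k])
  have hD1 : ‖D‖ = 1 := by simpa using hD
  have hDY : ad Y D = 0 := by
    have h1 := ((ad Y).continuous.tendsto D).comp hlim
    have h2 : (ad Y) ∘ ((fun k => Phi H (u k) (c k)) ∘ φ) = fun _ => 0 := by
      ext k
      exact Phi_comm t _ (hc1 _)
    rw [h2] at h1
    exact tendsto_nhds_unique h1 tendsto_const_nhds
  have hlim' : Tendsto (fun k => X + Phi H (u (φ k)) (c (φ k))) atTop (𝓝 (X + D)) :=
    hlim.const_add X
  have hA : ∀ k, X + Phi H (u k) (c k)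
      = Real.exp (-2 * u k) • (ee H (u k) * (X + c k) * ee H (-u k)) := by
    intro k
    conv_lhs => rw [← Phi_X t (u k), ← Phi_add, Phi]
  have hz : zdim X ≤ zdim (X + D) := by
    refine (isClosed_zdim (zdim X)).mem_of_tendsto hlim' (Eventually.of_forall fun k => ?_)
    exact (hc3 (φ k)).trans (zdim_le_of_conj _ (ee_neg_mul H _) (hA (φ k)))
  have hτ : Tendsto (fun k => Real.exp (-2 * u (φ k))) atTop (𝓝 0) := by
    refine Real.tendsto_exp_atBot.comp ?_
    exact (hut.comp hφ.tendsto_atTop).const_mul_atTop_of_neg (by norm_num)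
  have hN : (X + D) ^ p.natDegree = 0 := by
    have h1 := ((hom_continuous p).tendsto ((0 : ℝ), X + D)).comp (hτ.prodMk_nhds hlim')
    rw [hom_zero hp] at h1
    refine tendsto_nhds_unique h1 ?_
    refine tendsto_const_nhds.congr fun k => ?_
    change 0 = hom p (Real.exp (-2 * u (φ k))) (X + Phi H (u (φ k)) (c (φ k)))
    rw [hA, hom_smul, aeval_conj (ee_mul_neg H _) (ee_neg_mul H _), hc2]
    simp
  have := rigid t (A := X + D) (by rw [add_sub_cancel_left]; exact hDY) hz (hnil _ ⟨_, hN⟩)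
  have hD0 : D = 0 := by simpa using this
  rw [hD0, norm_zero] at hD1
  exact zero_ne_one hD1

lemma hasFDerivAt_aeval (A : R) (p : ℝ[X]) :
    ∃ h : R →L[ℝ] R, HasFDerivAt (fun B : R => aeval B p)
      (ContinuousLinearMap.mul ℝ R (aeval A (derivative p)) + (ad A).comp h) A := by
  induction p using Polynomial.induction_on with
  | C a =>
    refine ⟨0, ?_⟩
    simpa using hasFDerivAt_const (algebraMap ℝ R a) A
  | add p q hp hq =>
    obtain ⟨h1, hp⟩ := hp
    obtain ⟨h2, hq⟩ := hq
    refine ⟨h1 + h2, ?_⟩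
    simp only [map_add]
    refine (hp.add hq).congr_fderiv ?_
    ext D
    simp
    abel
  | monomial n a ih =>
    obtain ⟨h, hp⟩ := ih
    set p : ℝ[X] := C a * X ^ n with hpdef
    have e : C a * X ^ (n + 1) = p * X := by rw [hpdef, pow_succ, mul_assoc]
    refine ⟨(ContinuousLinearMap.mul ℝ R).flip A ∘L h
      - ContinuousLinearMap.mul ℝ R (aeval A (derivative p)), ?_⟩
    have h2 := hp.mul' (hasFDerivAt_id A)
    rw [e]
    simp only [map_mul, aeval_X]
    refine h2.congr_fderiv ?_
    ext D
    have hc : aeval A (derivative p) * A = A * aeval A (derivative p) := by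
      have := (Polynomial.commute_X (derivative p)).map (aeval A)
      simpa using this.eq.symm
    simp only [derivative_mul, derivative_X, mul_one, map_add, map_mul, aeval_X]
    simp [ad_apply]
    generalize aeval A (derivative p) = Q at *
    rw [hc]
    noncomm_ring

lemma finite_slice {X H Y : R} (t : Tri X H Y)
    (hnil : ∀ N : R, IsNilpotent N → ∃ E, ad N E = N) {p : ℝ[X]} (hp : p.Monic)
    (hsep : p.Separable) :
    {A : R | ad Y (A - X) = 0 ∧ aeval A p = 0 ∧ zdim X ≤ zdim A}.Finite := by
  by_contra hinf
  obtain ⟨K, hK⟩ := bounded_slice t hnil hp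
  have : ProperSpace R := FiniteDimensional.proper ℝ R
  obtain ⟨A, -, hacc⟩ := Set.Infinite.exists_accPt_of_subset_isCompact hinf
    (isCompact_closedBall X K) (by
      rintro A ⟨h1, h2, h3⟩
      rw [mem_closedBall_iff_norm]
      exact hK (A - X) h1 (by rwa [add_sub_cancel]) (by rwa [add_sub_cancel]))
  have hcl : IsClosed {A : R | ad Y (A - X) = 0 ∧ aeval A p = 0 ∧ zdim X ≤ zdim A} := by
    refine IsClosed.inter ?_ (IsClosed.inter ?_ (isClosed_zdim _))
    · exact isClosed_eq (by fun_prop) continuous_const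
    · exact isClosed_eq (by fun_prop) continuous_const
  obtain ⟨hA1, hA2, hA3⟩ : A ∈ {A : R | ad Y (A - X) = 0 ∧ aeval A p = 0 ∧ zdim X ≤ zdim A} :=
    isClosed_iff_clusterPt.mp hcl A hacc.clusterPt
  obtain ⟨h, hder⟩ := hasFDerivAt_aeval A p
  have hder2 : HasFDerivAt (fun B : R => ad Y (B - X)) (ad Y) A := by
    have := (ad Y).hasFDerivAt.comp A ((hasFDerivAt_id A).sub_const X)
    rwa [ContinuousLinearMap.comp_id] at this
  have hder3 := hder.prodMk hder2
  have hinj : LinearMap.ker ((ContinuousLinearMap.mul ℝ R (aeval A (derivative p))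
      + (ad A).comp h).prod (ad Y)).toLinearMap = ⊥ := by
    rw [LinearMap.ker_eq_bot']
    intro D hD
    have hD1 : aeval A (derivative p) * D + ad A (h D) = 0 := congrArg Prod.fst hD
    have hD2 : ad Y D = 0 := congrArg Prod.snd hD
    obtain ⟨a, b, hab⟩ := hsep
    have h1 : aeval A b * aeval A (derivative p) = 1 := by
      have := congrArg (aeval A) hab
      simpa [hA2] using this
    have hcomm : A * aeval A b = aeval A b * A := by
      have := (Polynomial.commute_X b).map (aeval A)
      simpa using this.eq
    have h2 : ad A (-(aeval A b * h D)) = D := by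
      have h3 : aeval A b * (aeval A (derivative p) * D + ad A (h D)) = 0 := by rw [hD1, mul_zero]
      rw [mul_add, ← mul_assoc, h1, one_mul] at h3
      have h4 : ad A (aeval A b * h D) = aeval A b * ad A (h D) := by
        rw [ad_apply, ad_apply, ← mul_assoc, hcomm]
        noncomm_ring
      rw [map_neg, h4]
      exact (eq_neg_of_add_eq_zero_left h3).symm
    rw [← h2]
    exact inter_slice t hA1 hA3 _ (by rw [h2]; exact hD2)
  obtain ⟨k, -, hk⟩ := LinearMap.exists_antilipschitzWith _ hinj
  have hev := hder3.eventually_ne (c := (0, 0)) ⟨k, hk⟩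
  rw [accPt_iff_frequently_nhdsNE] at hacc
  refine hacc (hev.mono fun B hB hBT => hB ?_)
  simp only [hBT.1, hBT.2.1]

lemma converse_slice {X H Y : R} (t : Tri X H Y) {A : R} (hA : ad Y (A - X) = 0) (S : Set R)
    (hS : S.Finite) (hmem : ∀ g : Rˣ, ad Y (g * A * ↑g⁻¹ - X) = 0 → g * A * ↑g⁻¹ ∈ S) :
    zdim X ≤ zdim A := by
  let W := LinearMap.range (adl Y)
  let π : R →L[ℝ] W := LinearMap.toContinuousLinearMap (adl Y).rangeRestrict
  have hπ : ∀ M, π M = 0 ↔ ad Y M = 0 := fun M => by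
    rw [← Subtype.coe_inj]; rfl
  let ψ : R → R := fun B => B * A * Ring.inverse B
  have hψ : HasStrictFDerivAt ψ (-(ad A)) 1 := by
    have h1 := hasStrictFDerivAt_ringInverse (𝕜 := ℝ) (1 : Rˣ)
    have h2 : HasStrictFDerivAt (fun B : R => B * A) ((ContinuousLinearMap.mul ℝ R).flip A) 1 :=
      ((ContinuousLinearMap.mul ℝ R).flip A).hasStrictFDerivAt
    have h3 := h2.mul' h1
    refine h3.congr_fderiv ?_
    ext D
    simp [ad_apply]
    abel
  have htr : Trans Y A := by
    have := trans_slice t hA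
    rwa [add_sub_cancel] at this
  have hf : HasStrictFDerivAt (fun B => π (ψ B - X)) (π.comp (-(ad A))) 1 :=
    π.hasStrictFDerivAt.comp 1 (hψ.sub_const X)
  have hsurj : (π.comp (-(ad A))).range = ⊤ := by
    rw [eq_top_iff]
    rintro ⟨_, M, rfl⟩ -
    obtain ⟨E, hE⟩ := htr M
    refine ⟨-E, ?_⟩
    apply Subtype.ext
    change ad Y (-(ad A (-E))) = ad Y M
    rw [map_neg (ad A), neg_neg]
    rw [map_sub, sub_eq_zero] at hE
    exact hE.symm
  have hψ1 : ψ 1 = A := by simp [ψ]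
  have hf1 : π (ψ 1 - X) = 0 := by rw [hψ1, hπ]; exact hA
  have himp := hf.to_implicitFunction hsurj
  have hmap := hf.map_implicitFunction_eq hsurj
  have hself := hf.implicitFunction_apply_image hsurj
  set γ := hf.implicitFunction _ _ hsurj (π (ψ 1 - X)) with hγ
  have hγc : Tendsto γ (𝓝 0) (𝓝 1) := by
    have := himp.continuousAt.tendsto
    rwa [hself] at this
  have hψγ : Tendsto (fun e => ψ (γ e)) (𝓝 0) (𝓝 A) := by
    have := hψ.continuousAt.tendsto.comp hγc
    rwa [hψ1] at this
  -- near `A`, the set `S` contains only `A`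
  have hiso : ∀ᶠ B in 𝓝 A, B ∈ S → B = A := by
    have h1 : IsClosed (S \ {A}) := (hS.subset Set.sdiff_subset).isClosed
    filter_upwards [h1.isOpen_compl.mem_nhds (by simp : A ∈ (S \ {A})ᶜ)] with B hB hBS
    by_contra hne
    exact hB ⟨hBS, hne⟩
  have hmap' : ∀ᶠ e in 𝓝 (0 : (π.comp (-(ad A))).ker), π (ψ (γ e) - X) = π (ψ 1 - X) := by
    have : Tendsto (fun e : (π.comp (-(ad A))).ker => (π (ψ 1 - X), e)) (𝓝 0)
        (𝓝 (π (ψ 1 - X), 0)) := tendsto_const_nhds.prodMk_nhds tendsto_id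
    exact this.eventually hmap
  have hunit : ∀ᶠ e in 𝓝 (0 : (π.comp (-(ad A))).ker), IsUnit (γ e) :=
    hγc.eventually (Units.isOpen.mem_nhds isUnit_one)
  have hcommute : ∀ᶠ e in 𝓝 (0 : (π.comp (-(ad A))).ker), ad A (γ e) = 0 := by
    filter_upwards [hψγ.eventually hiso, hmap', hunit] with e h1 h2 h3
    obtain ⟨g, hg⟩ := h3
    have h4 : ψ (γ e) = g * A * ↑g⁻¹ := by simp [ψ, ← hg]
    rw [h4] at h1 h2
    rw [hf1, hπ] at h2
    have h5 := h1 (hmem g h2)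
    rw [← hg, ad_apply, sub_eq_zero]
    conv_lhs => rw [← h5]
    simp
  have hd1 : HasFDerivAt (fun e => ad A (γ e)) ((ad A).comp (π.comp (-(ad A))).ker.subtypeL) 0 :=
    (ad A).hasFDerivAt.comp _ himp.hasFDerivAt
  have hd2 : HasFDerivAt (fun e => ad A (γ e)) (0 : (π.comp (-(ad A))).ker →L[ℝ] R) 0 :=
    (hasFDerivAt_const (0 : R) _).congr_of_eventuallyEq hcommute
  have heq := hd1.unique hd2
  have hle : LinearMap.ker (adl Y * adl A) ≤ LinearMap.ker (adl A) := by
    intro E hE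
    have hE' : E ∈ (π.comp (-(ad A))).ker := by
      rw [LinearMap.mem_ker]
      apply Subtype.ext
      change ad Y (-(ad A E)) = 0
      rw [map_neg, neg_eq_zero]; exact hE
    exact congrArg (fun f => f ⟨E, hE'⟩) heq
  have h1 := Submodule.finrank_mono hle
  have h2 := LinearMap.finrank_range_add_finrank_ker (adl Y * adl A)
  have h3 := LinearMap.finrank_range_add_finrank_ker (adl Y)
  have h4 : finrank ℝ (LinearMap.range (adl Y * adl A)) ≤ finrank ℝ (LinearMap.range (adl Y)) :=
    Submodule.finrank_mono (LinearMap.range_comp_le_range _ _)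
  have h5 := zdim_Y t
  unfold zdim at *
  omega

end Exp3
end Ana

section Final
open Module

lemma finrank_centralizer {R : Type*} [NormedRing R] [NormedAlgebra ℝ R] (A : R) :
    finrank ℝ (Subalgebra.centralizer ℝ ({A} : Set R)) = zdim A := by
  have : Subalgebra.toSubmodule (Subalgebra.centralizer ℝ ({A} : Set R))
      = LinearMap.ker (adl A) := by
    ext M
    rw [Subalgebra.mem_toSubmodule, Subalgebra.mem_centralizer_iff, LinearMap.mem_ker, adl_apply,
      sub_eq_zero]
    simp
  rw [← Subalgebra.finrank_toSubmodule, this]; rfl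

lemma main_abs {R : Type*} [NormedRing R] [NormedAlgebra ℝ R] [FiniteDimensional ℝ R]
    {X H Y ν : R} (hHX : H * X - X * H = (2 : ℝ) • X) (hHY : H * Y - Y * H = (-2 : ℝ) • Y)
    (hXY : X * Y - Y * X = H)
    (hnil : ∀ N : R, IsNilpotent N → ∃ E, N * E - E * N = N)
    (hp : ∃ p : ℝ[X], p.Monic ∧ p.Separable ∧ aeval ν p = 0)
    (hne : ({M | ∃ g : Rˣ, M = g * ν * ↑g⁻¹} ∩ {M | ∃ C, C * Y = Y * C ∧ M = X + C} :
      Set R).Nonempty) :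
    ({M | ∃ g : Rˣ, M = g * ν * ↑g⁻¹} ∩ {M | ∃ C, C * Y = Y * C ∧ M = X + C} : Set R).Finite ↔
      finrank ℝ (Subalgebra.centralizer ℝ ({ν} : Set R))
        = finrank ℝ (Subalgebra.centralizer ℝ ({X} : Set R)) := by
  letI : NormedAlgebra ℚ R := NormedAlgebra.restrictScalars ℚ ℝ R
  haveI : CompleteSpace R := FiniteDimensional.complete ℝ R
  have t : Tri X H Y := ⟨hHX, hHY, hXY⟩
  rw [finrank_centralizer, finrank_centralizer]
  have hz : ∀ g : Rˣ, zdim (g * ν * ↑g⁻¹ : R) = zdim ν := by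
    intro g
    apply le_antisymm
    · refine zdim_le_of_conj (g := (↑g⁻¹ : R)) (g' := g) 1 (by simp) ?_
      simp [mul_assoc]
    · exact zdim_le_of_conj (g := (g : R)) (g' := ↑g⁻¹) 1 (by simp) (by simp)
  have hmem : ∀ M : R, (∃ C, C * Y = Y * C ∧ M = X + C) ↔ ad Y (M - X) = 0 := by
    intro M
    constructor
    · rintro ⟨C, hC, rfl⟩
      rw [add_sub_cancel_left, ad_apply, hC, sub_self]
    · intro h
      rw [ad_apply, sub_eq_zero] at h
      exact ⟨M - X, h.symm, by abel⟩
  obtain ⟨A, ⟨g0, hg0⟩, hA⟩ := hne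
  replace hA := (hmem A).mp hA
  have hzA : zdim A = zdim ν := by rw [hg0, hz]
  constructor
  · intro hfin
    apply le_antisymm
    · rw [← hzA]; exact zdim_slice_le t hA
    · rw [← hzA]
      refine converse_slice t hA _ hfin fun g hg => ⟨⟨g * g0, ?_⟩, (hmem _).mpr hg⟩
      rw [hg0]; simp [mul_assoc]
  · intro heq
    obtain ⟨p, hp1, hp2, hp3⟩ := hp
    refine (finite_slice t (fun N hN => ?_) hp1 hp2).subset ?_
    · obtain ⟨E, hE⟩ := hnil N hN
      exact ⟨E, by rw [ad_apply, hE]⟩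
    · rintro M ⟨⟨g, rfl⟩, hM⟩
      refine ⟨(hmem _).mp hM, ?_, ?_⟩
      · rw [aeval_conj (by simp) (by simp), hp3]; simp
      · rw [hz, heq]

lemma matrix_nil {n : ℕ} (N : Matrix (Fin n) (Fin n) ℝ) (hN : IsNilpotent N) :
    ∃ E, N * E - E * N = N := by
  let L : Matrix (Fin n) (Fin n) ℝ →ₗ[ℝ] Matrix (Fin n) (Fin n) ℝ :=
    LinearMap.mulLeft ℝ N - LinearMap.mulRight ℝ N
  by_contra hcon
  have hnot : N ∉ LinearMap.range L := by
    rintro ⟨E, hE⟩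
    exact hcon ⟨E, hE⟩
  obtain ⟨f, hf, hle⟩ := Submodule.exists_le_ker_of_notMem hnot
  -- represent `f` by a matrix
  obtain ⟨B, hB⟩ : ∃ B : Matrix (Fin n) (Fin n) ℝ, ∀ M, f M = (B * M).trace := by
    refine ⟨Matrix.of fun i j => f (Matrix.single j i 1), fun M => ?_⟩
    conv_lhs => rw [Matrix.matrix_eq_sum_single M]
    simp only [map_sum, Matrix.trace, Matrix.diag, Matrix.mul_apply, Matrix.of_apply]
    rw [Finset.sum_comm]
    refine Finset.sum_congr rfl fun j _ => Finset.sum_congr rfl fun i _ => ?_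
    have : Matrix.single i j (M i j) = M i j • Matrix.single i j (1 : ℝ) := by
      simp [Matrix.smul_single]
    rw [this, map_smul, smul_eq_mul, mul_comm]
  have hcomm : B * N = N * B := by
    apply Matrix.ext_iff_trace_mul_right.mpr
    intro E
    have h1 : f (N * E - E * N) = 0 := hle ⟨E, rfl⟩
    rw [hB, mul_sub, Matrix.trace_sub, sub_eq_zero] at h1
    rw [mul_assoc, h1, ← mul_assoc, Matrix.trace_mul_comm, mul_assoc]
  apply hf
  rw [hB]
  exact (Matrix.isNilpotent_trace_of_isNilpotent
    (Commute.isNilpotent_mul_left (show Commute B N from hcomm) hN)).eq_zero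

lemma exists_sep_poly {n : ℕ} (ν : Matrix (Fin n) (Fin n) ℝ)
    (hν : ∃ (g : GL (Fin n) ℂ) (d : Fin n → ℂ),
        ν.map (algebraMap ℝ ℂ) =
          (g : Matrix (Fin n) (Fin n) ℂ) * Matrix.diagonal d *
            (↑g⁻¹ : Matrix (Fin n) (Fin n) ℂ)) :
    ∃ p : ℝ[X], p.Monic ∧ p.Separable ∧ aeval ν p = 0 := by
  classical
  obtain ⟨g, d, hd⟩ := hν
  have hint : ∀ i, IsIntegral ℝ (d i) := fun i => Algebra.IsIntegral.isIntegral _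
  let s : Finset ℝ[X] := Finset.univ.image fun i => minpoly ℝ (d i)
  have hs : ∀ q ∈ s, q.Monic ∧ Irreducible q := by
    intro q hq
    obtain ⟨i, -, rfl⟩ := Finset.mem_image.mp hq
    exact ⟨minpoly.monic (hint i), minpoly.irreducible (hint i)⟩
  refine ⟨∏ q ∈ s, q, monic_prod_of_monic _ _ fun q hq => (hs q hq).1, ?_, ?_⟩
  · refine separable_prod' (fun q hq r hr hne => ?_) fun q hq => (hs q hq).2.separable
    refine (hs q hq).2.coprime_iff_not_dvd.mpr fun hdvd => hne ?_
    exact eq_of_monic_of_associated (hs q hq).1 (hs r hr).1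
      ((hs q hq).2.associated_of_dvd (hs r hr).2 hdvd)
  · set p := ∏ q ∈ s, q
    have hroot : ∀ i, aeval (d i) p = 0 := by
      intro i
      have : minpoly ℝ (d i) ∣ p := Finset.dvd_prod_of_mem _ (Finset.mem_image_of_mem _ (by simp))
      exact aeval_eq_zero_of_dvd_aeval_eq_zero this (minpoly.aeval ℝ (d i))
    have hdiag : aeval (Matrix.diagonal d) p = 0 := by
      have h1 := Polynomial.aeval_algHom_apply (Matrix.diagonalAlgHom (n := Fin n) (α := ℂ) ℝ) d p
      change aeval (Matrix.diagonal d) p = _ at h1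
      have h2 : aeval d p = 0 := by
        ext i
        have := Polynomial.aeval_algHom_apply (Pi.evalAlgHom ℝ (fun _ : Fin n => ℂ) i) d p
        exact this.symm.trans (hroot i)
      rw [h1, h2, map_zero]
    have hconj : aeval (ν.map (algebraMap ℝ ℂ)) p = 0 := by
      rw [hd, aeval_eq_sum_range]
      have hpow : ∀ k : ℕ, ((g : Matrix (Fin n) (Fin n) ℂ) * Matrix.diagonal d *
          (↑g⁻¹ : Matrix (Fin n) (Fin n) ℂ)) ^ k
          = g * Matrix.diagonal d ^ k * (↑g⁻¹ : Matrix (Fin n) (Fin n) ℂ) :=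
        fun k => Units.conj_pow g _ k
      simp_rw [hpow]
      have : ∑ k ∈ Finset.range (p.natDegree + 1), p.coeff k •
          ((g : Matrix (Fin n) (Fin n) ℂ) * Matrix.diagonal d ^ k *
            (↑g⁻¹ : Matrix (Fin n) (Fin n) ℂ))
          = g * aeval (Matrix.diagonal d) p * (↑g⁻¹ : Matrix (Fin n) (Fin n) ℂ) := by
        rw [aeval_eq_sum_range, Finset.mul_sum, Finset.sum_mul]
        simp
      rw [this, hdiag]; simp
    have hmap : (aeval ν p).map (algebraMap ℝ ℂ) = 0 := by
      have h1 := Polynomial.aeval_algHom_apply ((Algebra.ofId ℝ ℂ).mapMatrix (m := Fin n)) ν p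
      exact h1.symm.trans hconj
    ext i j
    have := congrFun (congrFun hmap i) j
    simpa using this
end Final
end SlodowyAux

/-- Transversality claim from the proof of Proposition 4.1 for `G = GL(n,ℝ)`: if `ν` is
semisimple and the orbit of `ν` meets the Slodowy slice `X + Z(Y)` of an `sl₂`-triple
`(X,H,Y)`, then the intersection is finite if and only if the centralizers of `ν` and
of `X` have the same dimension (equivalently, the orbits of `ν` and `X` have the same
dimension). -/
theorem orbit_inter_slice_finite_iff_centralizer_dim_eq
    {n : ℕ} (X H Y ν : Matrix (Fin n) (Fin n) ℝ)
    (hX0 : X ≠ 0)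
    (hHX : H * X - X * H = (2 : ℝ) • X)
    (hHY : H * Y - Y * H = (-2 : ℝ) • Y)
    (hXY : X * Y - Y * X = H)
    -- `ν` is diagonalizable over `ℂ` (i.e. semisimple):
    (hν : ∃ (g : GL (Fin n) ℂ) (d : Fin n → ℂ),
        ν.map (algebraMap ℝ ℂ) =
          (g : Matrix (Fin n) (Fin n) ℂ) * Matrix.diagonal d * (↑g⁻¹ : Matrix (Fin n) (Fin n) ℂ))
    (hne : ({M | ∃ g : GL (Fin n) ℝ,
              M = (g : Matrix (Fin n) (Fin n) ℝ) * ν * (↑g⁻¹ : Matrix (Fin n) (Fin n) ℝ)} ∩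
            {M | ∃ C, C * Y = Y * C ∧ M = X + C} : Set (Matrix (Fin n) (Fin n) ℝ)).Nonempty) :
    ({M | ∃ g : GL (Fin n) ℝ,
        M = (g : Matrix (Fin n) (Fin n) ℝ) * ν * (↑g⁻¹ : Matrix (Fin n) (Fin n) ℝ)} ∩
      {M | ∃ C, C * Y = Y * C ∧ M = X + C} : Set (Matrix (Fin n) (Fin n) ℝ)).Finite
      ↔ Module.finrank ℝ (Subalgebra.centralizer ℝ ({ν} : Set (Matrix (Fin n) (Fin n) ℝ)))
          = Module.finrank ℝ (Subalgebra.centralizer ℝ ({X} : Set (Matrix (Fin n) (Fin n) ℝ))) := by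
  letI : NormedRing (Matrix (Fin n) (Fin n) ℝ) := Matrix.linftyOpNormedRing
  letI : NormedAlgebra ℝ (Matrix (Fin n) (Fin n) ℝ) := Matrix.linftyOpNormedAlgebra
  exact SlodowyAux.main_abs hHX hHY hXY SlodowyAux.matrix_nil (SlodowyAux.exists_sep_poly ν hν) hne
end

section
/- Let (X, H, Y) be an sl₂-triple of n×n real matrices and let ξ ∈ X + Z(Y), i.e., ξ − X commutes with Y. Then every n×n real matrix M can be written as M = [A, ξ] + B where A is an n×n real matrix and B ∈ Z(Y); that is, the ℝ-linear subspace {[A, ξ] : A ∈ Matrix (Fin n) (Fin n) ℝ} together with the centralizer Z(Y) spans all of Matrix (Fin n) (Fin n) ℝ. -/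
/-- An element lowering weights in a finite-dimensional algebra is nilpotent. -/
lemma slodowy_nilp {E : Type*} [Ring E] [Algebra ℝ E] [FiniteDimensional ℝ E]
    (h y : E) (hy : h * y - y * h = (-2 : ℝ) • y) : ∃ N : ℕ, y ^ N = 0 := by
  by_contra! hne
  have key : ∀ m : ℕ, h * y ^ m - y ^ m * h = (-2 * (m : ℝ)) • y ^ m := by
    intro m
    induction m with
    | zero => simp
    | succ k ih =>
      have e : h * y ^ (k + 1) - y ^ (k + 1) * h
          = (h * y ^ k - y ^ k * h) * y + y ^ k * (h * y - y * h) := by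
        rw [pow_succ]; noncomm_ring
      rw [e, ih, hy, pow_succ, smul_mul_assoc, mul_smul_comm, ← add_smul]
      congr 1; push_cast; ring
  let D : Module.End ℝ E := LinearMap.mulLeft ℝ h - LinearMap.mulRight ℝ h
  have hinj : Function.Injective (fun m : ℕ => (-2 * (m : ℝ))) := by
    intro a b hab
    simpa using hab
  have li := Module.End.eigenvectors_linearIndependent' D (fun m : ℕ => (-2 * (m : ℝ))) hinj
    (fun m => y ^ m) (fun m => by
      rw [Module.End.hasEigenvector_iff, Module.End.mem_eigenspace_iff]
      exact ⟨by simpa [D] using key m, hne m⟩)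
  exact absurd li.finite (by simp [not_finite_iff_infinite]; infer_instance)

/-- Commutation of a power of `y` past `x`. -/
lemma slodowy_comm {E : Type*} [Ring E] [Algebra ℝ E] (x h y : E)
    (hy : h * y - y * h = (-2 : ℝ) • y) (hxy : x * y - y * x = h) (k : ℕ) :
    y ^ (k + 1) * x = x * y ^ (k + 1) - ((k : ℝ) + 1) • ((h + (k : ℝ) • 1) * y ^ k) := by
  have yx : y * x = x * y - h := by rw [← hxy]; abel
  have yh : y * h = h * y + (2 : ℝ) • y := by
    have : y * h = h * y - (-2 : ℝ) • y := by rw [← hy]; abel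
    rw [this]; module
  induction k with
  | zero => simp [yx]
  | succ k ih =>
    rw [pow_succ' y (k + 1), mul_assoc, ih, mul_sub, ← mul_assoc y x, yx, mul_smul_comm,
      ← mul_assoc y (h + _), mul_add, yh, mul_smul_comm, mul_one, sub_mul]
    simp only [add_mul, smul_mul_assoc, one_mul, mul_assoc, ← pow_succ']
    push_cast
    module

/-- The transversality statement, in injective form. -/
lemma slodowy_inj {V : Type*} [AddCommGroup V] [Module ℝ V] [FiniteDimensional ℝ V]
    (x h y z : Module.End ℝ V)
    (hy : h * y - y * h = (-2 : ℝ) • y) (hxy : x * y - y * x = h)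
    (hz : z * y = y * z) (u : V) (hu : (x + z) (y u) = 0) : y u = 0 := by
  obtain ⟨N, hN⟩ := slodowy_nilp h y hy
  have comm : ∀ (k : ℕ) (w : V), (y ^ (k + 1)) (x w)
      = x ((y ^ (k + 1)) w) - ((k : ℝ) + 1) • (h ((y ^ k) w) + (k : ℝ) • (y ^ k) w) := by
    intro k w
    have := congrArg (fun T : Module.End ℝ V => T w) (slodowy_comm x h y hy hxy k)
    simpa using this
  have ps : ∀ (k : ℕ) (w : V), (y ^ k) (y w) = (y ^ (k + 1)) w := by
    intro k w; rw [pow_succ]; rfl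
  have ps' : ∀ (k : ℕ) (w : V), y ((y ^ k) w) = (y ^ (k + 1)) w := by
    intro k w; rw [pow_succ']; rfl
  -- a lowest weight vector in the image of `y ^ m` of weight greater than `-m` vanishes
  have low : ∀ (c : ℝ) (v : V), y v = 0 → h v = c • v →
      ∀ (d m : ℕ), N ≤ m + d → 0 < c + m → (∃ w, (y ^ m) w = v) → v = 0 := by
    intro c v hv hc d
    induction d with
    | zero =>
      rintro m hm - ⟨w, rfl⟩
      rw [pow_eq_zero_of_le (by simpa using hm) hN]; rfl
    | succ d ih =>
      rintro m hm hpos ⟨w, hw⟩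
      refine ih (m + 1) (by omega) (by push_cast; linarith) ?_
      have e := comm m w
      rw [← ps' m w, hw, hv, hc, map_zero, zero_sub, ← add_smul, smul_smul] at e
      have hne : -(((m : ℝ) + 1) * (c + m)) ≠ 0 := by
        have : 0 < ((m : ℝ) + 1) * (c + m) := by positivity
        exact neg_ne_zero.mpr this.ne'
      refine ⟨(-(((m : ℝ) + 1) * (c + m)))⁻¹ • x w, ?_⟩
      rw [map_smul, e, ← neg_smul, smul_smul, inv_mul_cancel₀ hne, one_smul]
  -- descend along the kernels of the powers of `y`
  have zc : ∀ k : ℕ, ∀ w, (y ^ k) (z w) = z ((y ^ k) w) := by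
    intro k w
    have : Commute z (y ^ k) := (show Commute z y from hz).pow_right k
    exact (congrArg (fun T : Module.End ℝ V => T w) this.eq).symm
  have desc : ∀ k : ℕ, (y ^ (k + 2)) u = 0 → (y ^ (k + 1)) u = 0 := by
    intro k hk
    have e : (y ^ (k + 1)) ((x + z) (y u)) = 0 := by rw [hu, map_zero]
    rw [LinearMap.add_apply, map_add, zc, comm, ps, ps, hk] at e
    simp only [map_zero, zero_sub, add_zero, neg_eq_zero] at e
    have hk1 : ((k : ℝ) + 1) ≠ 0 := by positivity
    have e2 := (smul_eq_zero.mp e).resolve_left hk1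
    refine low (-(k : ℝ)) _ (by rw [ps', hk]) ?_ N (k + 1) (by omega) (by push_cast; linarith)
      ⟨u, rfl⟩
    rw [neg_smul]
    exact eq_neg_of_add_eq_zero_left e2
  have fin : ∀ k : ℕ, (y ^ (k + 1)) u = 0 → y u = 0 := by
    intro k
    induction k with
    | zero => intro hk; simpa using hk
    | succ k ih => intro hk; exact ih (desc k hk)
  exact fin N (by rw [pow_succ', hN, mul_zero]; rfl)

/-- The transversality statement, in surjective form. -/
lemma slodowy_surj {V : Type*} [AddCommGroup V] [Module ℝ V] [FiniteDimensional ℝ V]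
    (x h y z : Module.End ℝ V)
    (hy : h * y - y * h = (-2 : ℝ) • y) (hxy : x * y - y * x = h)
    (hz : z * y = y * z) (v : V) : ∃ a, y ((x + z) a) = y v := by
  by_contra hcon
  have hnot : y v ∉ LinearMap.range (y * (x + z)) := by
    rintro ⟨a, ha⟩; exact hcon ⟨a, ha⟩
  obtain ⟨f, hf, hf0⟩ := Submodule.exists_dual_map_eq_bot_of_notMem hnot inferInstance
  have hfa : ∀ a, f (y ((x + z) a)) = 0 := by
    intro a
    have : f (y ((x + z) a)) ∈ (LinearMap.range (y * (x + z))).map f :=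
      ⟨_, ⟨a, rfl⟩, rfl⟩
    rw [hf0] at this
    simpa using this
  have := slodowy_inj (V := Module.Dual ℝ V) (x.dualMap) (-h.dualMap) (y.dualMap) (z.dualMap)
    (by
      ext g w
      have := congrArg g (congrArg (fun T : Module.End ℝ V => T w) hy)
      simp at this ⊢
      linarith)
    (by
      ext g w
      have := congrArg g (congrArg (fun T : Module.End ℝ V => T w) hxy)
      simp at this ⊢
      linarith)
    (by
      ext g w
      have := congrArg g (congrArg (fun T : Module.End ℝ V => T w) hz)
      simp at this ⊢
      linarith) f
    (by
      ext w
      have := hfa w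
      simpa using this)
  exact hf (by simpa using congrArg (fun g : Module.Dual ℝ V => g v) this)

/-- Infinitesimal form of the submersion claim of Section 4: for `ξ` in the Slodowy slice
`X + Z(Y)` of an `sl₂`-triple `(X,H,Y)` of `n×n` real matrices, every matrix `M` can be
written as `M = [A, ξ] + B` with `B` in the centralizer of `Y`. -/
theorem bracket_range_add_centralizer_eq_top
    {n : ℕ} (X H Y : Matrix (Fin n) (Fin n) ℝ)
    (hX0 : X ≠ 0)
    (hHX : H * X - X * H = (2 : ℝ) • X)
    (hHY : H * Y - Y * H = (-2 : ℝ) • Y)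
    (hXY : X * Y - Y * X = H)
    (ξ : Matrix (Fin n) (Fin n) ℝ)
    (hξ : (ξ - X) * Y = Y * (ξ - X)) :
    ∀ M : Matrix (Fin n) (Fin n) ℝ,
      ∃ A B : Matrix (Fin n) (Fin n) ℝ,
        B * Y = Y * B ∧ M = (A * ξ - ξ * A) + B := by
  intro M
  let L (P : Matrix (Fin n) (Fin n) ℝ) : Module.End ℝ (Matrix (Fin n) (Fin n) ℝ) :=
    LinearMap.mulLeft ℝ P - LinearMap.mulRight ℝ P
  have hL : ∀ P Q, L P Q = P * Q - Q * P := fun P Q => rfl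
  obtain ⟨a, ha⟩ := slodowy_surj (L X) (L H) (L Y) (L (ξ - X))
    (by
      refine LinearMap.ext fun Q => ?_
      have e : (L H * L Y - L Y * L H) Q = (H * Y - Y * H) * Q - Q * (H * Y - Y * H) := by
        simp only [LinearMap.sub_apply, Module.End.mul_apply, hL]; noncomm_ring
      rw [e, hHY, LinearMap.smul_apply, hL, smul_sub, smul_mul_assoc, mul_smul_comm])
    (by
      refine LinearMap.ext fun Q => ?_
      have e : (L X * L Y - L Y * L X) Q = (X * Y - Y * X) * Q - Q * (X * Y - Y * X) := by
        simp only [LinearMap.sub_apply, Module.End.mul_apply, hL]; noncomm_ring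
      rw [e, hXY, hL])
    (by
      refine LinearMap.ext fun Q => ?_
      rw [← sub_eq_zero]
      have e : (L (ξ - X) * L Y) Q - (L Y * L (ξ - X)) Q
          = ((ξ - X) * Y - Y * (ξ - X)) * Q - Q * ((ξ - X) * Y - Y * (ξ - X)) := by
        simp only [Module.End.mul_apply, hL]; noncomm_ring
      rw [e, hξ]; simp) M
  have hs : (L X + L (ξ - X)) a = ξ * a - a * ξ := by
    simp only [LinearMap.add_apply, hL]; noncomm_ring
  rw [hs] at ha
  refine ⟨-a, M - (ξ * a - a * ξ), ?_, by noncomm_ring⟩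
  have h0 : L Y (M - (ξ * a - a * ξ)) = 0 := by rw [map_sub, ha, sub_self]
  rw [hL] at h0
  exact (sub_eq_zero.mp h0).symm
end

section
/- Let (X, H, Y) be an sl₂-triple of n×n real matrices. Then the set {g (X + C) g⁻¹ : g ∈ GL(n,ℝ), C ∈ Z(Y)} is an open subset of the space Matrix (Fin n) (Fin n) ℝ of all n×n real matrices (with its Euclidean topology). -/
open Polynomial Module

section SlodowyAlgebra

variable {V : Type*} [AddCommGroup V] [Module ℝ V]

/-- A triple of operators satisfying the `sl₂` relations. -/
structure SlodowyTriple (P h Q : V →ₗ[ℝ] V) : Prop where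
  hP : ∀ u, h (P u) = P (h u) + (2 : ℝ) • P u
  hQ : ∀ u, h (Q u) = Q (h u) - (2 : ℝ) • Q u
  PQ : ∀ u, P (Q u) = Q (P u) + h u

theorem SlodowyTriple.swap {P h Q : V →ₗ[ℝ] V} (t : SlodowyTriple P h Q) :
    SlodowyTriple Q (-h) P where
  hP u := by simp [t.hQ]; abel
  hQ u := by simp [t.hP]; abel
  PQ u := by simp [t.PQ]

theorem SlodowyTriple.h_pow {P h Q : V →ₗ[ℝ] V} (t : SlodowyTriple P h Q) (k : ℕ) (u : V) :
    h ((P ^ k) u) = (P ^ k) (h u) + (2 * k : ℝ) • (P ^ k) u := by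
  induction k generalizing u with
  | zero => simp
  | succ k ih =>
    simp only [pow_succ, Module.End.mul_apply, ih, t.hP, map_add, map_smul]
    push_cast
    module

theorem SlodowyTriple.nilp [FiniteDimensional ℝ V] {P h Q : V →ₗ[ℝ] V}
    (t : SlodowyTriple P h Q) : ∃ N : ℕ, P ^ N = 0 := by
  by_contra! hne
  let A : Module.End ℝ (Module.End ℝ V) := LinearMap.mulLeft ℝ h - LinearMap.mulRight ℝ h
  have hfin := Module.End.finite_hasEigenvalue A
  have hsub : Set.range (fun k : ℕ => (2 * k : ℝ)) ⊆ {μ | A.HasEigenvalue μ} := by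
    rintro _ ⟨k, rfl⟩
    refine Module.End.hasEigenvalue_of_hasEigenvector (x := P ^ k) ⟨?_, hne k⟩
    rw [Module.End.mem_eigenspace_iff]
    ext u
    simp [A, t.h_pow]
  refine Set.infinite_range_of_injective ?_ (hfin.subset hsub)
  intro a b hab
  simpa using hab

theorem SlodowyTriple.Q_pow {P h Q : V →ₗ[ℝ] V} (t : SlodowyTriple P h Q) (k : ℕ) (u : V) :
    Q ((P ^ (k + 1)) u) =
      (P ^ (k + 1)) (Q u) - (k + 1 : ℝ) • (P ^ k) (h u + (k : ℝ) • u) := by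
  induction k generalizing u with
  | zero => simp [t.PQ]
  | succ k ih =>
    have e : Q (P u) = P (Q u) - h u := by rw [t.PQ]; abel
    have e1 : (P ^ (k + 1 + 1)) u = (P ^ (k + 1)) (P u) := by rw [pow_succ]; rfl
    rw [e1, ih, e]
    simp only [pow_succ, Module.End.mul_apply, t.hP, map_add, map_smul, map_sub]
    push_cast
    module

/-- The polynomial `x (x + 1) ⋯ (x + N - 1)`. -/
noncomputable def slodowyPoly (N : ℕ) : ℝ[X] := ∏ i ∈ Finset.range N, (X + C (i : ℝ))

theorem SlodowyTriple.poly_kill {P h Q : V →ₗ[ℝ] V} (t : SlodowyTriple P h Q) (k : ℕ) (u : V)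
    (hu : P (Q u) = 0) (hk : (P ^ k) u = 0) : aeval h (slodowyPoly k) u = 0 := by
  induction k generalizing u with
  | zero => simpa [slodowyPoly] using hk
  | succ k ih =>
    have h1 := t.Q_pow k u
    have h2 : (P ^ (k + 1)) (Q u) = 0 := by rw [pow_succ, Module.End.mul_apply, hu, map_zero]
    rw [hk, h2, map_zero, zero_sub, eq_comm, neg_eq_zero, smul_eq_zero] at h1
    have h3 := h1.resolve_left (by positivity)
    have h4 : P (Q (h u)) = 0 := by
      have : h (P (Q u)) = P (Q (h u)) := by
        rw [t.hP, t.hQ]; simp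
      rw [← this, hu, map_zero]
    have h5 := ih (h u + (k : ℝ) • u) (by simp [h4, hu]) h3
    rw [slodowyPoly, Finset.prod_range_succ, map_mul, Module.End.mul_apply]
    simpa [slodowyPoly, Nat.cast_smul_eq_nsmul] using h5

theorem SlodowyTriple.disjoint [FiniteDimensional ℝ V] {P h Q : V →ₗ[ℝ] V}
    (t : SlodowyTriple P h Q) : Disjoint (LinearMap.ker P) (LinearMap.range Q) := by
  rw [Submodule.disjoint_def]
  rintro v hv ⟨u, rfl⟩
  obtain ⟨N, hN⟩ := t.nilp
  obtain ⟨N', hN'⟩ := t.swap.nilp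
  have hv : P (Q u) = 0 := hv
  have h1 := t.poly_kill N u hv (by rw [hN]; rfl)
  have h2 := t.swap.poly_kill N' (Q u) (by rw [hv, map_zero]) (by rw [hN']; rfl)
  have hpow : ∀ (n : ℕ) (w : V), ((h + (2 : ℝ) • 1) ^ n) (Q w) = Q ((h ^ n) w) := by
    intro n
    induction n with
    | zero => intro w; simp
    | succ n ih =>
      intro w
      rw [pow_succ, pow_succ, Module.End.mul_apply, Module.End.mul_apply, ← ih]
      congr 1
      simp [t.hQ]
  have h3 : ∀ p : ℝ[X], aeval h (p.comp (X + C 2)) (Q u) = Q (aeval h p u) := by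
    intro p
    rw [aeval_comp, show aeval h (X + C (2 : ℝ)) = h + (2 : ℝ) • 1 by
      rw [map_add, aeval_X, aeval_C, Algebra.algebraMap_eq_smul_one]]
    induction p using Polynomial.induction_on' with
    | add p q hp hq => simp only [map_add, LinearMap.add_apply, hp, hq]
    | monomial n a =>
      simp only [aeval_monomial, Module.End.mul_apply, hpow, Module.algebraMap_end_apply, map_smul]
  have h4 : ∀ p : ℝ[X], aeval (-h) p = aeval h (p.comp (-X)) := by
    intro p
    rw [aeval_comp]; simp
  have hcop : IsCoprime ((slodowyPoly N).comp (X + C 2)) ((slodowyPoly N').comp (-X)) := by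
    simp only [slodowyPoly, prod_comp]
    refine IsCoprime.prod_left fun i _ => IsCoprime.prod_right fun j _ => ?_
    have hne : (2 + i + j : ℝ) ≠ 0 := by positivity
    refine ⟨C (2 + i + j : ℝ)⁻¹, C (2 + i + j : ℝ)⁻¹, ?_⟩
    simp only [add_comp, X_comp, C_comp]
    rw [← mul_add, show (X + C (2:ℝ) + C (i:ℝ) + (-X + C (j:ℝ)) : ℝ[X]) = C (2 + i + j : ℝ) by
      simp only [map_add]; ring, ← C_mul, inv_mul_cancel₀ hne, C_1]
  have hd := Polynomial.disjoint_ker_aeval_of_isCoprime h hcop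
  rw [Submodule.disjoint_def] at hd
  refine hd _ ?_ ?_
  · rw [LinearMap.mem_ker, h3, h1, map_zero]
  · rw [LinearMap.mem_ker, ← h4, h2]

theorem SlodowyTriple.sup_eq_top [FiniteDimensional ℝ V] {P h Q : V →ₗ[ℝ] V}
    (t : SlodowyTriple P h Q) : LinearMap.ker Q ⊔ LinearMap.range P = ⊤ := by
  refine Submodule.eq_top_of_disjoint _ _ ?_ t.swap.disjoint
  have h1 := Submodule.finrank_add_finrank_le_of_disjoint t.disjoint
  have h2 := LinearMap.finrank_range_add_finrank_ker P
  have h3 := LinearMap.finrank_range_add_finrank_ker Q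
  omega

theorem slodowy_induction (h : V →ₗ[ℝ] V) (p : V → Prop) (h0 : p 0)
    (hadd : ∀ u v, p u → p v → p (u + v))
    (heig : ∀ (j : ℕ) (u : V), h u = (-j : ℝ) • u → p u) (N : ℕ) (u : V)
    (hu : aeval h (slodowyPoly N) u = 0) : p u := by
  induction N generalizing u with
  | zero =>
    have : u = 0 := by simpa [slodowyPoly] using hu
    rwa [this]
  | succ N ih =>
    have hcop : IsCoprime (slodowyPoly N) (X + C (N : ℝ)) := by
      refine IsCoprime.prod_left fun i hi => ?_
      have hne : (i - N : ℝ) ≠ 0 := by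
        rw [sub_ne_zero]
        exact_mod_cast (Finset.mem_range.1 hi).ne
      refine ⟨C (i - N : ℝ)⁻¹, -C (i - N : ℝ)⁻¹, ?_⟩
      rw [neg_mul, ← sub_eq_add_neg, ← mul_sub,
        show (X + C (i:ℝ) - (X + C (N:ℝ)) : ℝ[X]) = C (i - N : ℝ) by
        simp only [map_sub]; ring, ← C_mul, inv_mul_cancel₀ hne, C_1]
    have hs := Polynomial.sup_ker_aeval_eq_ker_aeval_mul_of_coprime h hcop
    have hm : u ∈ LinearMap.ker (aeval h (slodowyPoly N * (X + C (N : ℝ)))) := by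
      rw [LinearMap.mem_ker, ← hu, slodowyPoly, slodowyPoly, Finset.prod_range_succ]
    rw [← hs, Submodule.mem_sup] at hm
    obtain ⟨a, ha, b, hb, rfl⟩ := hm
    refine hadd _ _ (ih a ha) (heig N b ?_)
    have hb : h b + (N : ℝ) • b = 0 := by
      simpa [Nat.cast_smul_eq_nsmul] using hb
    rw [neg_smul]
    exact eq_neg_of_add_eq_zero_left hb

end SlodowyAlgebra

section SlodowyAnalysis

open Filter Topology

variable {𝔸 : Type*} [NormedRing 𝔸] [NormedAlgebra ℝ 𝔸]

/-- The union of the conjugates of `x + Z(y)`. -/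
def slodowySat (x y : 𝔸) : Set 𝔸 :=
  {M | ∃ (g : 𝔸ˣ) (C : 𝔸), C * y = y * C ∧ M = (g : 𝔸) * (x + C) * (↑g⁻¹ : 𝔸)}

/-- The exponential as a unit. -/
theorem slodowy_exp_unit [CompleteSpace 𝔸] (a : 𝔸) :
    ∃ g : 𝔸ˣ, (g : 𝔸) = NormedSpace.exp a ∧ (↑g⁻¹ : 𝔸) = NormedSpace.exp (-a) := by
  let _ : NormedAlgebra ℚ 𝔸 := NormedAlgebra.restrictScalars ℚ ℝ 𝔸
  have h1 : NormedSpace.exp a * NormedSpace.exp (-a) = 1 := by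
    rw [← NormedSpace.exp_add_of_commute (Commute.refl a).neg_right, add_neg_cancel,
      NormedSpace.exp_zero]
  have h2 : NormedSpace.exp (-a) * NormedSpace.exp a = 1 := by
    rw [← NormedSpace.exp_add_of_commute (Commute.refl a).neg_left, neg_add_cancel,
      NormedSpace.exp_zero]
  exact ⟨⟨_, _, h1, h2⟩, rfl, rfl⟩

theorem slodowy_exp_eigen [CompleteSpace 𝔸] (H c : 𝔸) (r s : ℝ) (hc : H * c - c * H = r • c) :
    NormedSpace.exp (s • H) * c = Real.exp (s * r) • (c * NormedSpace.exp (s • H)) := by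
  let _ : NormedAlgebra ℚ 𝔸 := NormedAlgebra.restrictScalars ℚ ℝ 𝔸
  have hs : SemiconjBy c (s • H + algebraMap ℝ 𝔸 (s * r)) (s • H) := by
    rw [SemiconjBy, mul_add, ← Algebra.commutes, ← Algebra.smul_def, mul_smul_comm, smul_mul_assoc,
      mul_smul, ← hc, ← smul_add]
    congr 1
    abel
  have h1 := hs.exp_right
  rw [NormedSpace.exp_add_of_commute (Algebra.commutes _ _).symm,
    ← NormedSpace.algebraMap_exp_comm, ← Real.exp_eq_exp_ℝ] at h1
  rw [← h1.eq, ← Algebra.commutes, ← Algebra.smul_def, mul_smul_comm]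

/-- The operator `u ↦ [a, u]`. -/
noncomputable def slodowyAd (a : 𝔸) : 𝔸 →ₗ[ℝ] 𝔸 := LinearMap.mulLeft ℝ a - LinearMap.mulRight ℝ a

@[simp] theorem slodowyAd_apply (a u : 𝔸) : slodowyAd a u = a * u - u * a := rfl

theorem slodowyAd_triple {X H Y : 𝔸}
    (hHX : H * X - X * H = (2 : ℝ) • X)
    (hHY : H * Y - Y * H = (-2 : ℝ) • Y)
    (hXY : X * Y - Y * X = H) :
    SlodowyTriple (slodowyAd X) (slodowyAd H) (slodowyAd Y) where
  hP u := by
    simp only [slodowyAd_apply, smul_sub, ← smul_mul_assoc, ← mul_smul_comm _ u, ← hHX]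
    noncomm_ring
  hQ u := by
    have e : (2 : ℝ) • Y = -(H * Y - Y * H) := by rw [hHY, neg_smul, neg_neg]
    simp only [slodowyAd_apply, smul_sub, ← smul_mul_assoc, ← mul_smul_comm _ u, e]
    noncomm_ring
  PQ u := by
    simp only [slodowyAd_apply, ← hXY]
    noncomm_ring

theorem slodowySat_mem_nhds [FiniteDimensional ℝ 𝔸] {X H Y : 𝔸}
    (hHX : H * X - X * H = (2 : ℝ) • X)
    (hHY : H * Y - Y * H = (-2 : ℝ) • Y)
    (hXY : X * Y - Y * X = H) : slodowySat X Y ∈ 𝓝 X := by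
  have t := slodowyAd_triple hHX hHY hXY
  have : CompleteSpace 𝔸 := FiniteDimensional.complete ℝ 𝔸
  let K := LinearMap.ker (slodowyAd Y)
  have : CompleteSpace K := FiniteDimensional.complete ℝ K
  let f : 𝔸 × K → 𝔸 := fun p => NormedSpace.exp p.1 * (X + (p.2 : 𝔸)) * NormedSpace.exp (-p.1)
  have h1 : HasStrictFDerivAt (fun p : 𝔸 × K => NormedSpace.exp p.1)
      ((1 : 𝔸 →L[ℝ] 𝔸).comp (ContinuousLinearMap.fst ℝ 𝔸 K)) (0, 0) :=
    HasStrictFDerivAt.comp (x := ((0, 0) : 𝔸 × K)) (g := NormedSpace.exp)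
      (hasStrictFDerivAt_exp_zero (𝕂 := ℝ) (𝔸 := 𝔸)) hasStrictFDerivAt_fst
  have h2 : HasStrictFDerivAt (fun p : 𝔸 × K => NormedSpace.exp (-p.1))
      ((1 : 𝔸 →L[ℝ] 𝔸).comp (-(ContinuousLinearMap.fst ℝ 𝔸 K))) (0, 0) := by
    refine HasStrictFDerivAt.comp (x := ((0, 0) : 𝔸 × K)) (g := NormedSpace.exp)
      (f := fun p : 𝔸 × K => -p.1) ?_ hasStrictFDerivAt_fst.neg
    rw [neg_zero]
    exact hasStrictFDerivAt_exp_zero (𝕂 := ℝ) (𝔸 := 𝔸)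
  have h3 : HasStrictFDerivAt (fun p : 𝔸 × K => X + (p.2 : 𝔸))
      (K.subtypeL.comp (ContinuousLinearMap.snd ℝ 𝔸 K)) (0, 0) :=
    (K.subtypeL.comp (ContinuousLinearMap.snd ℝ 𝔸 K)).hasStrictFDerivAt.const_add X
  obtain ⟨D, hD, happ⟩ : ∃ D : 𝔸 × K →L[ℝ] 𝔸, HasStrictFDerivAt f D (0, 0) ∧
      ∀ p, D p = p.1 * X - X * p.1 + (p.2 : 𝔸) := by
    refine ⟨_, (h1.mul' h3).mul' h2, fun p => ?_⟩
    simp [NormedSpace.exp_zero]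
    abel
  have hsurj : LinearMap.range D.toLinearMap = ⊤ := by
    rw [eq_top_iff, ← t.sup_eq_top]
    refine sup_le ?_ ?_
    · intro c hc
      refine ⟨(0, ⟨c, hc⟩), ?_⟩
      simp [happ]
    · rintro _ ⟨a, rfl⟩
      refine ⟨(-a, 0), ?_⟩
      simp [happ]
      abel
  have h5 := hD.map_nhds_eq_of_surj hsurj
  simp only [f, NormedSpace.exp_zero, neg_zero, one_mul, mul_one, Submodule.coe_zero,
    add_zero] at h5
  rw [← h5, mem_map]
  refine univ_mem' fun p => ?_
  obtain ⟨g, hg, hg'⟩ := slodowy_exp_unit p.1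
  refine ⟨g, p.2, ?_, ?_⟩
  · have := p.2.2
    rw [LinearMap.mem_ker, slodowyAd_apply, sub_eq_zero] at this
    exact this.symm
  · rw [hg, hg']

theorem slodowy_contract [FiniteDimensional ℝ 𝔸] {X H Y : 𝔸}
    (hHX : H * X - X * H = (2 : ℝ) • X)
    (hHY : H * Y - Y * H = (-2 : ℝ) • Y)
    (hXY : X * Y - Y * X = H) {c : 𝔸} (hc : c * Y = Y * c) :
    Tendsto (fun s : ℝ => Real.exp (-2 * s) •
      (NormedSpace.exp (s • H) * c * NormedSpace.exp (-(s • H)))) atTop (𝓝 0) := by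
  have t := slodowyAd_triple hHX hHY hXY
  have : CompleteSpace 𝔸 := FiniteDimensional.complete ℝ 𝔸
  obtain ⟨N, hN⟩ := t.nilp
  have hk := t.poly_kill N c (by simp [hc]) (by rw [hN]; rfl)
  refine slodowy_induction (slodowyAd H) (fun c => Tendsto (fun s : ℝ => Real.exp (-2 * s) •
      (NormedSpace.exp (s • H) * c * NormedSpace.exp (-(s • H)))) atTop (𝓝 0)) ?_ ?_ ?_ N c hk
  · simp
  · intro u v hu hv
    simpa [mul_add, add_mul] using hu.add hv
  · intro j u hu
    have e : ∀ s : ℝ, Real.exp (-2 * s) •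
        (NormedSpace.exp (s • H) * u * NormedSpace.exp (-(s • H))) =
        Real.exp (-((j + 2) * s)) • u := by
      intro s
      obtain ⟨g, hg, hg'⟩ := slodowy_exp_unit (s • H)
      rw [slodowy_exp_eigen H u (-j) s hu, ← hg, ← hg', smul_mul_assoc, mul_assoc, Units.mul_inv,
        mul_one, smul_smul, ← Real.exp_add]
      congr 2
      ring
    simp only [e]
    have h1 : Tendsto (fun s : ℝ => Real.exp (-((j + 2) * s))) atTop (𝓝 0) :=
      Real.tendsto_exp_neg_atTop_nhds_zero.comp
        (tendsto_id.const_mul_atTop (by positivity))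
    simpa using h1.smul_const u

theorem slodowySat_isOpen [FiniteDimensional ℝ 𝔸] {X H Y : 𝔸}
    (hHX : H * X - X * H = (2 : ℝ) • X)
    (hHY : H * Y - Y * H = (-2 : ℝ) • Y)
    (hXY : X * Y - Y * X = H) : IsOpen (slodowySat X Y) := by
  have : CompleteSpace 𝔸 := FiniteDimensional.complete ℝ 𝔸
  rw [isOpen_iff_mem_nhds]
  rintro _ ⟨g, c, hc, rfl⟩
  have hS := slodowySat_mem_nhds hHX hHY hXY
  -- `e^{-2s} g_s X g_s⁻¹ = X`
  have hXs : ∀ s : ℝ, Real.exp (-2 * s) •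
      (NormedSpace.exp (s • H) * X * NormedSpace.exp (-(s • H))) = X := by
    intro s
    obtain ⟨k, hk, hk'⟩ := slodowy_exp_unit (s • H)
    rw [slodowy_exp_eigen H X 2 s hHX, ← hk, ← hk', smul_mul_assoc, mul_assoc, Units.mul_inv,
      mul_one, smul_smul, ← Real.exp_add, show -2 * s + s * 2 = 0 by ring, Real.exp_zero, one_smul]
  have hlim : Tendsto (fun s : ℝ => Real.exp (-2 * s) •
      (NormedSpace.exp (s • H) * (X + c) * NormedSpace.exp (-(s • H)))) atTop (𝓝 X) := by
    have := (slodowy_contract hHX hHY hXY hc).const_add X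
    rw [add_zero] at this
    refine this.congr fun s => ?_
    rw [mul_add, add_mul, smul_add, hXs]
  have hev := hlim.eventually (eventually_mem_nhds_iff.2 hS)
  obtain ⟨s, hs⟩ := hev.exists
  have hXs := hXs s
  have hYs := slodowy_exp_eigen H Y (-2) s hHY
  obtain ⟨k, hk, hk'⟩ := slodowy_exp_unit (s • H)
  rw [← hk, ← hk'] at hs hXs
  rw [← hk] at hYs
  set r := Real.exp (-2 * s) with hr
  have hr0 : r ≠ 0 := (Real.exp_pos _).ne'
  rw [show s * -2 = -2 * s by ring, ← hr] at hYs
  let φ : 𝔸 → 𝔸 := fun M => r • ((k : 𝔸) * ((↑g⁻¹ : 𝔸) * M * g) * (↑k⁻¹ : 𝔸))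
  have hφ : Continuous φ := by fun_prop
  have hφM : φ ((g : 𝔸) * (X + c) * (↑g⁻¹ : 𝔸)) =
      r • ((k : 𝔸) * (X + c) * (↑k⁻¹ : 𝔸)) := by
    simp [φ, mul_assoc]
  have hpre : φ ⁻¹' slodowySat X Y ∈ 𝓝 ((g : 𝔸) * (X + c) * (↑g⁻¹ : 𝔸)) :=
    hφ.continuousAt.preimage_mem_nhds (by rwa [hφM])
  refine mem_of_superset hpre ?_
  rintro M ⟨m, d, hd, hM⟩
  -- `M = r⁻¹ g k⁻¹ m (X + d) m⁻¹ k g⁻¹`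
  refine ⟨g * k⁻¹ * m * k, r⁻¹ • ((↑k⁻¹ : 𝔸) * d * k), ?_, ?_⟩
  · have e1 : Y * (↑k⁻¹ : 𝔸) = r • ((↑k⁻¹ : 𝔸) * Y) := by
      have := congrArg (fun z => (↑k⁻¹ : 𝔸) * z * (↑k⁻¹ : 𝔸)) hYs
      simpa [mul_assoc] using this
    rw [smul_mul_assoc, mul_smul_comm, mul_assoc, hYs, ← mul_assoc Y, ← mul_assoc Y, e1]
    congr 1
    simp only [mul_smul_comm, smul_mul_assoc]
    congr 1
    simp only [mul_assoc]
    rw [← mul_assoc d, hd, mul_assoc]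
  · have e2 : r⁻¹ • X = (k : 𝔸) * X * (↑k⁻¹ : 𝔸) := by
      rw [inv_smul_eq_iff₀ hr0, hXs]
    have e3 : (k : 𝔸) * (X + r⁻¹ • ((↑k⁻¹ : 𝔸) * d * k)) * (↑k⁻¹ : 𝔸) = r⁻¹ • (X + d) := by
      rw [mul_add, add_mul, ← e2, smul_add]
      simp [mul_assoc]
    have e4 : M = r⁻¹ • ((g : 𝔸) * ((↑k⁻¹ : 𝔸) * φ M * k) * (↑g⁻¹ : 𝔸)) := by
      simp [φ, mul_assoc, hr0]
    rw [e4, hM]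
    have e5 : ((g * k⁻¹ * m * k : 𝔸ˣ) : 𝔸) * (X + r⁻¹ • ((↑k⁻¹ : 𝔸) * d * k)) *
        (↑(g * k⁻¹ * m * k)⁻¹ : 𝔸) = (g : 𝔸) * (↑k⁻¹ : 𝔸) * m *
        ((k : 𝔸) * (X + r⁻¹ • ((↑k⁻¹ : 𝔸) * d * k)) * (↑k⁻¹ : 𝔸)) *
        (↑m⁻¹ : 𝔸) * k * (↑g⁻¹ : 𝔸) := by
      simp only [mul_inv_rev, Units.val_mul, inv_inv, mul_assoc]
    rw [e5, e3]
    simp only [mul_smul_comm, smul_mul_assoc, mul_assoc]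

end SlodowyAnalysis

section SlodowyMatrix

attribute [local instance] Matrix.linftyOpNormedRing Matrix.linftyOpNormedAlgebra

theorem slodowySat_matrix_isOpen {n : ℕ} {X H Y : Matrix (Fin n) (Fin n) ℝ}
    (hHX : H * X - X * H = (2 : ℝ) • X)
    (hHY : H * Y - Y * H = (-2 : ℝ) • Y)
    (hXY : X * Y - Y * X = H) : IsOpen (slodowySat X Y) :=
  slodowySat_isOpen hHX hHY hXY

end SlodowyMatrix


/-- The claim of Section 4 that `G · S_X` is open for `G = GL(n,ℝ)`: the union of the
conjugates of the Slodowy slice `X + Z(Y)` of an `sl₂`-triple `(X,H,Y)` is an open subset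
of the space of `n×n` real matrices. -/
theorem isOpen_saturation_of_slodowy_slice
    {n : ℕ} (X H Y : Matrix (Fin n) (Fin n) ℝ)
    (hX0 : X ≠ 0)
    (hHX : H * X - X * H = (2 : ℝ) • X)
    (hHY : H * Y - Y * H = (-2 : ℝ) • Y)
    (hXY : X * Y - Y * X = H) :
    IsOpen {M : Matrix (Fin n) (Fin n) ℝ |
      ∃ (g : GL (Fin n) ℝ) (C : Matrix (Fin n) (Fin n) ℝ),
        C * Y = Y * C ∧
        M = (g : Matrix (Fin n) (Fin n) ℝ) * (X + C) * (↑g⁻¹ : Matrix (Fin n) (Fin n) ℝ)} := by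
  exact slodowySat_matrix_isOpen hHX hHY hXY
end

section
/- Let (X, H, Y) be an sl₂-triple of n×n real matrices such that every complex eigenvalue of H is an even integer (the even orbit condition). Set Z = X − Y. If g ∈ GL(n,ℝ) satisfies g Z g⁻¹ ∈ X + Z(Y), i.e., g Z g⁻¹ − X commutes with Y, then g Z g⁻¹ = Z. Equivalently, the conjugation orbit of X − Y meets the Slodowy slice X + Z(Y) exactly in the single point X − Y. -/
namespace EvenOrbit

open Module

/-- An `sl₂`-triple of endomorphisms, in pointwise form. -/
structure SL {V : Type*} [AddCommGroup V] [Module ℂ V] (X H Y : End ℂ V) : Prop where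
  hx : ∀ v, H (X v) = X (H v) + (2 : ℂ) • X v
  hy : ∀ v, H (Y v) = Y (H v) - (2 : ℂ) • Y v
  xy : ∀ v, X (Y v) = Y (X v) + H v

section

variable {V : Type*} [AddCommGroup V] [Module ℂ V]
variable {X H Y : End ℂ V}

lemma SL.hx_pow (s : SL X H Y) (k : ℕ) (v : V) :
    H ((X ^ k) v) = (X ^ k) (H v) + (2 * k : ℂ) • (X ^ k) v := by
  induction k with
  | zero => simp
  | succ k ih =>
    rw [pow_succ', Module.End.mul_apply, s.hx, ih, Module.End.mul_apply, map_add, map_smul]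
    push_cast
    module

lemma SL.hy_pow (s : SL X H Y) (k : ℕ) (v : V) :
    H ((Y ^ k) v) = (Y ^ k) (H v) - (2 * k : ℂ) • (Y ^ k) v := by
  induction k with
  | zero => simp
  | succ k ih =>
    rw [pow_succ', Module.End.mul_apply, s.hy, ih, Module.End.mul_apply, map_sub, map_smul]
    push_cast
    module

lemma nilp_aux [FiniteDimensional ℂ V] (A H : End ℂ V) (c : ℂ) (hc : c ≠ 0)
    (h : ∀ (k : ℕ) (v : V), H ((A ^ k) v) = (A ^ k) (H v) + (c * k) • (A ^ k) v) :
    ∃ N, A ^ N = 0 := by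
  by_contra! hne
  have hfin := Module.End.finite_hasEigenvalue
    (LinearMap.mulLeft ℂ H - LinearMap.mulRight ℂ H : End ℂ (End ℂ V))
  have : Set.range (fun k : ℕ => c * (k : ℂ)) ⊆ {μ | Module.End.HasEigenvalue
      (LinearMap.mulLeft ℂ H - LinearMap.mulRight ℂ H : End ℂ (End ℂ V)) μ} := by
    rintro _ ⟨k, rfl⟩
    apply Module.End.hasEigenvalue_of_hasEigenvector (x := A ^ k)
    refine ⟨?_, hne k⟩
    rw [Module.End.mem_eigenspace_iff]
    ext v
    simp [h k v]
  refine Set.infinite_range_of_injective ?_ (hfin.subset this)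
  intro a b hab
  simpa [hc] using hab

lemma SL.nilX [FiniteDimensional ℂ V] (s : SL X H Y) : ∃ N, X ^ N = 0 :=
  nilp_aux X H 2 (by norm_num) s.hx_pow

lemma SL.nilY [FiniteDimensional ℂ V] (s : SL X H Y) : ∃ N, Y ^ N = 0 :=
  nilp_aux Y H (-2) (by norm_num) (fun k v => by rw [s.hy_pow]; module)

/-- `Y X^{b+1} v = -(b+1) X^b (H + b) v` on `ker Y`. -/
lemma SL.yx (s : SL X H Y) {v : V} (hv : Y v = 0) (b : ℕ) :
    Y ((X ^ (b + 1)) v) = -((b : ℂ) + 1) • (X ^ b) (H v + (b : ℂ) • v) := by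
  induction b with
  | zero =>
    have := s.xy v
    simp [hv] at this
    simp
    rw [eq_neg_iff_add_eq_zero, this]
  | succ b ih =>
    have h1 := s.xy ((X ^ (b + 1)) v)
    rw [ih, s.hx_pow] at h1
    rw [pow_succ', Module.End.mul_apply, eq_sub_of_add_eq h1.symm]
    simp only [map_smul, map_add, smul_add, pow_succ', Module.End.mul_apply]
    push_cast
    module

lemma SL.ker_h (s : SL X H Y) {v : V} (hv : Y v = 0) (c : ℂ) : Y (H v + c • v) = 0 := by
  have := s.hy v
  simp [hv] at this
  simp [hv, ← this]

/-- product `∏_{j<N} (H + j)` -/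
def hp (H : End ℂ V) : ℕ → End ℂ V
  | 0 => 1
  | N + 1 => hp H N * (H + (N : ℂ) • (1 : End ℂ V))

lemma SL.yxN (s : SL X H Y) (N : ℕ) : ∃ c : ℂ, c ≠ 0 ∧ ∀ v : V, Y v = 0 →
    (Y ^ N) ((X ^ N) v) = c • hp H N v := by
  induction N with
  | zero => exact ⟨1, one_ne_zero, by simp [hp]⟩
  | succ N ih =>
    obtain ⟨c, hc, h⟩ := ih
    refine ⟨-((N : ℂ) + 1) * c, mul_ne_zero (neg_ne_zero.2 (by exact_mod_cast N.succ_ne_zero)) hc, ?_⟩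
    intro v hv
    rw [pow_succ Y, Module.End.mul_apply, s.yx hv, map_smul, h _ (s.ker_h hv _)]
    simp [hp, smul_smul, mul_assoc]

lemma SL.ker_hp [FiniteDimensional ℂ V] (s : SL X H Y) :
    ∃ N, ∀ v : V, Y v = 0 → hp H N v = 0 := by
  obtain ⟨N, hN⟩ := s.nilX
  obtain ⟨c, hc, h⟩ := s.yxN N
  refine ⟨N, fun v hv => ?_⟩
  have := h v hv
  simp only [hN, LinearMap.zero_apply, map_zero] at this
  exact (smul_eq_zero.1 this.symm).resolve_left hc

lemma decomp_aux (H : End ℂ V) (S : Submodule ℂ V) (hS : ∀ v ∈ S, H v ∈ S) (N : ℕ) :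
    ∀ v ∈ S, hp H N v = 0 →
    ∃ f : ℕ → V, (∀ j, f j ∈ S ∧ H (f j) = -(j : ℂ) • f j) ∧ v = ∑ j ∈ Finset.range N, f j := by
  induction N with
  | zero =>
    intro v _ hv
    exact ⟨0, by simp, by simpa [hp] using hv⟩
  | succ N ih =>
    intro v hvS hv
    have h1 : hp H N (H v + (N : ℂ) • v) = 0 := by simpa [hp] using hv
    obtain ⟨f, hf, hs⟩ := ih _ (S.add_mem (hS _ hvS) (S.smul_mem _ hvS)) h1
    set f' : ℕ → V := fun j => ((N : ℂ) - j)⁻¹ • f j with hf'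
    have hne : ∀ j ∈ Finset.range N, ((N : ℂ) - j) ≠ 0 := by
      intro j hj
      rw [sub_ne_zero]
      exact_mod_cast (Finset.mem_range.1 hj).ne'
    set r := v - ∑ j ∈ Finset.range N, f' j with hr
    refine ⟨Function.update f' N r, ?_, ?_⟩
    · intro j
      by_cases hj : j = N
      · subst hj
        simp only [Function.update_self]
        refine ⟨S.sub_mem hvS (S.sum_mem fun i _ => S.smul_mem _ (hf i).1), ?_⟩
        have : H r + (j : ℂ) • r = 0 := by
          rw [hr, map_sub, smul_sub, map_sum, Finset.smul_sum]
          have : H v - ∑ x ∈ Finset.range j, H (f' x) +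
            ((j : ℂ) • v - ∑ x ∈ Finset.range j, (j : ℂ) • f' x) =
            (H v + (j : ℂ) • v) - ∑ x ∈ Finset.range j, (H (f' x) + (j : ℂ) • f' x) := by
            rw [Finset.sum_add_distrib]; abel
          rw [this, hs, ← Finset.sum_sub_distrib]
          apply Finset.sum_eq_zero
          intro i hi
          simp only [hf', map_smul, (hf i).2]
          have := hne i hi
          rw [sub_eq_zero, smul_smul, smul_smul, ← add_smul]
          nth_rw 1 [← one_smul ℂ (f i)]
          congr 1
          field_simp
          ring
        rw [neg_smul]; exact eq_neg_of_add_eq_zero_left this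
      · simp only [Function.update_of_ne hj]
        refine ⟨S.smul_mem _ (hf j).1, ?_⟩
        simp only [hf', map_smul, (hf j).2]
        rw [smul_comm]
    · rw [Finset.sum_range_succ, Function.update_self]
      have : ∑ x ∈ Finset.range N, Function.update f' N r x = ∑ x ∈ Finset.range N, f' x := by
        apply Finset.sum_congr rfl
        intro x hx
        rw [Function.update_of_ne (Finset.mem_range.1 hx).ne]
      rw [this, hr]; abel

/-- Vectors in `ker Y` decompose into `H`-eigenvectors with nonpositive integer weights. -/
lemma SL.decomp [FiniteDimensional ℂ V] (s : SL X H Y) : ∃ N : ℕ, ∀ v : V, Y v = 0 →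
    ∃ f : ℕ → V, (∀ j, Y (f j) = 0 ∧ H (f j) = -(j : ℂ) • f j) ∧
      v = ∑ j ∈ Finset.range N, f j := by
  obtain ⟨N, hN⟩ := s.ker_hp
  refine ⟨N, fun v hv => ?_⟩
  have := decomp_aux H (LinearMap.ker Y) (fun v hv => by
    have := s.ker_h (v := v) hv 0
    simpa using this) N v hv (hN v hv)
  simpa using this

lemma hp_eig (H : End ℂ V) {v : V} {c : ℂ} (h : H v = c • v) (N : ℕ) :
    hp H N v = (∏ j ∈ Finset.range N, (c + j)) • v := by
  induction N with
  | zero => simp [hp]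
  | succ N ih =>
    rw [hp, Finset.prod_range_succ, Module.End.mul_apply]
    simp only [LinearMap.add_apply, h, LinearMap.smul_apply, Module.End.one_apply, ← add_smul, map_smul, ih,
      smul_smul]
    rw [mul_comm]

/-- lowest weight vectors -/
def Low (H Y : End ℂ V) (m : ℕ) (u : V) : Prop := Y u = 0 ∧ H u = -(m : ℂ) • u

lemma SL.low_y (s : SL X H Y) {m : ℕ} {u : V} (hu : Low H Y m u) (b : ℕ) :
    Y ((X ^ (b + 1)) u) = (((b : ℂ) + 1) * (m - b)) • (X ^ b) u := by
  rw [s.yx hu.1, hu.2, ← add_smul, map_smul, smul_smul]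
  congr 1; ring

lemma SL.low_h (s : SL X H Y) {m : ℕ} {u : V} (hu : Low H Y m u) (b : ℕ) :
    H ((X ^ b) u) = (2 * b - m : ℂ) • (X ^ b) u := by
  rw [s.hx_pow, hu.2, map_smul]; module

lemma SL.low_top [FiniteDimensional ℂ V] (s : SL X H Y) {m : ℕ} {u : V} (hu : Low H Y m u) :
    (X ^ (m + 1)) u = 0 := by
  obtain ⟨N, hN⟩ := s.ker_hp
  have h1 : Y ((X ^ (m + 1)) u) = 0 := by rw [s.low_y hu]; simp
  have h2 := s.low_h hu (m + 1)
  have h3 := hN _ h1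
  rw [hp_eig H h2, smul_eq_zero] at h3
  refine h3.resolve_left ?_
  rw [← ne_eq, Finset.prod_ne_zero_iff]
  intro j _
  have : (2 * ((m + 1 : ℕ) : ℂ) - m + j) = ((m + 2 + j : ℕ) : ℂ) := by push_cast; ring
  rw [this]
  exact_mod_cast (by omega)

lemma SL.low_top' [FiniteDimensional ℂ V] (s : SL X H Y) {m : ℕ} {u : V} (hu : Low H Y m u)
    {b : ℕ} (hb : m < b) : (X ^ b) u = 0 := by
  obtain ⟨k, rfl⟩ := Nat.exists_eq_add_of_lt hb
  rw [show m + k + 1 = k + (m + 1) by omega, pow_add, Module.End.mul_apply, s.low_top hu, map_zero]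

/-- span of all strings -/
def strings (X H Y : End ℂ V) : Submodule ℂ V :=
  Submodule.span ℂ {v | ∃ m u b, Low H Y m u ∧ v = (X ^ b) u}

lemma strings_gen {m : ℕ} {u : V} (hu : Low H Y m u) (b : ℕ) : (X ^ b) u ∈ strings X H Y :=
  Submodule.subset_span ⟨m, u, b, hu, rfl⟩

lemma strings_X (v : V) (hv : v ∈ strings X H Y) : X v ∈ strings X H Y := by
  induction hv using Submodule.span_induction with
  | mem x h =>
    obtain ⟨m, u, b, hu, rfl⟩ := h
    rw [← Module.End.mul_apply, ← pow_succ']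
    exact strings_gen hu _
  | zero => simp
  | add x y _ _ hx hy => rw [map_add]; exact Submodule.add_mem _ hx hy
  | smul a x _ hx => rw [map_smul]; exact Submodule.smul_mem _ _ hx

lemma SL.strings_H (s : SL X H Y) (v : V) (hv : v ∈ strings X H Y) : H v ∈ strings X H Y := by
  induction hv using Submodule.span_induction with
  | mem x h =>
    obtain ⟨m, u, b, hu, rfl⟩ := h
    rw [s.low_h hu]
    exact Submodule.smul_mem _ _ (strings_gen hu _)
  | zero => simp
  | add x y _ _ hx hy => rw [map_add]; exact Submodule.add_mem _ hx hy
  | smul a x _ hx => rw [map_smul]; exact Submodule.smul_mem _ _ hx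

lemma SL.strings_Y (s : SL X H Y) (v : V) (hv : v ∈ strings X H Y) : Y v ∈ strings X H Y := by
  induction hv using Submodule.span_induction with
  | mem x h =>
    obtain ⟨m, u, b, hu, rfl⟩ := h
    cases b with
    | zero => simp [hu.1]
    | succ b =>
      rw [s.low_y hu]
      exact Submodule.smul_mem _ _ (strings_gen hu _)
  | zero => simp
  | add x y _ _ hx hy => rw [map_add]; exact Submodule.add_mem _ hx hy
  | smul a x _ hx => rw [map_smul]; exact Submodule.smul_mem _ _ hx

/-- product `∏_{j<N} (H - j)` -/
def hm (H : End ℂ V) : ℕ → End ℂ V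
  | 0 => 1
  | N + 1 => hm H N * (H - (N : ℂ) • (1 : End ℂ V))

lemma hm_eig (H : End ℂ V) {v : V} {c : ℂ} (h : H v = c • v) (N : ℕ) :
    hm H N v = (∏ j ∈ Finset.range N, (c - j)) • v := by
  induction N with
  | zero => simp [hm]
  | succ N ih =>
    rw [hm, Finset.prod_range_succ, Module.End.mul_apply]
    simp only [LinearMap.sub_apply, h, LinearMap.smul_apply, Module.End.one_apply, ← sub_smul, map_smul, ih,
      smul_smul]
    rw [mul_comm]

lemma bezout_aux (H : End ℂ V) (R : Submodule ℂ V) (hR : ∀ v ∈ R, H v ∈ R) (m : ℕ) (N : ℕ) :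
    ∀ y : V, H y + ((m : ℂ) + 2) • y ∈ R → hm H N y ∈ R → y ∈ R := by
  induction N with
  | zero => intro y _ h; simpa [hm] using h
  | succ N ih =>
    intro y h1 h2
    have h3 : H y - (N : ℂ) • y ∈ R := by
      apply ih
      · have : H (H y - (N : ℂ) • y) + ((m : ℂ) + 2) • (H y - (N : ℂ) • y) =
          H (H y + ((m : ℂ) + 2) • y) - (N : ℂ) • (H y + ((m : ℂ) + 2) • y) := by
          simp only [map_sub, map_add, map_smul]; module
        rw [this]
        exact R.sub_mem (hR _ h1) (R.smul_mem _ h1)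
      · simpa [hm] using h2
    have h4 := R.sub_mem h1 h3
    have : H y + ((m : ℂ) + 2) • y - (H y - (N : ℂ) • y) = ((m + 2 + N : ℕ) : ℂ) • y := by
      push_cast; module
    rw [this] at h4
    exact (R.smul_mem_iff (by exact_mod_cast (by omega))).1 h4

lemma exists_ker {A : End ℂ V} [Nontrivial V] (h : ∃ N, A ^ N = 0) : ∃ v, v ≠ 0 ∧ A v = 0 := by
  by_contra! hne
  obtain ⟨N, hN⟩ := h
  have hinj : ∀ k : ℕ, ∀ v : V, v ≠ 0 → (A ^ k) v ≠ 0 := by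
    intro k
    induction k with
    | zero => intro v hv; simpa using hv
    | succ k ih =>
      intro v hv
      rw [pow_succ, Module.End.mul_apply]
      exact ih _ (hne v hv)
  obtain ⟨v, hv⟩ := exists_ne (0 : V)
  exact hinj N v hv (by simp [hN])

lemma SL.exists_low [FiniteDimensional ℂ V] [Nontrivial V] (s : SL X H Y) :
    ∃ m u, u ≠ 0 ∧ Low H Y m u := by
  obtain ⟨v, hv0, hv⟩ := exists_ker s.nilY
  obtain ⟨N, hN⟩ := s.decomp
  obtain ⟨f, hf, hs⟩ := hN v hv
  have : ∃ j, f j ≠ 0 := by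
    by_contra! h
    apply hv0
    rw [hs]; simp [h]
  obtain ⟨j, hj⟩ := this
  exact ⟨j, f j, hj, hf j⟩

lemma SL.strings_top [FiniteDimensional ℂ V] (s : SL X H Y) : strings X H Y = ⊤ := by
  by_contra hne
  set N := strings X H Y with hN
  have sX : N ≤ N.comap X := fun v hv => strings_X v hv
  have sH : N ≤ N.comap H := fun v hv => s.strings_H v hv
  have sY : N ≤ N.comap Y := fun v hv => s.strings_Y v hv
  have s' : SL (N.mapQ N X sX) (N.mapQ N H sH) (N.mapQ N Y sY) := by
    constructor <;> intro v <;> obtain ⟨v, rfl⟩ := N.mkQ_surjective v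
    · simp [s.hx]
    · simp [s.hy]
    · simp [s.xy]
  have : Nontrivial (V ⧸ N) := Submodule.Quotient.nontrivial_iff.2 hne
  obtain ⟨m, u, hu0, hu⟩ := s'.exists_low
  obtain ⟨v, rfl⟩ := N.mkQ_surjective u
  have hY : Y v ∈ N := by
    have := hu.1
    simpa using this
  have hH : H v + (m : ℂ) • v ∈ N := by
    have := hu.2
    rw [neg_smul, ← add_eq_zero_iff_eq_neg] at this
    rw [← Submodule.Quotient.mk_eq_zero N]
    simpa using this
  -- the image of `N` under `Y`
  set R := N.map Y with hR
  have hRH : ∀ w ∈ R, H w ∈ R := by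
    rintro _ ⟨w, hw, rfl⟩
    refine ⟨H w - (2 : ℂ) • w, N.sub_mem (sH hw) (N.smul_mem _ hw), ?_⟩
    rw [s.hy, map_sub, map_smul]
  have hhm : ∀ k, ∀ w ∈ R, hm H k w ∈ R := by
    intro k
    induction k with
    | zero => intro w hw; simpa [hm] using hw
    | succ k ih =>
      intro w hw
      simp only [hm, Module.End.mul_apply]
      apply ih
      simp only [LinearMap.sub_apply, LinearMap.smul_apply, Module.End.one_apply]
      exact R.sub_mem (hRH w hw) (R.smul_mem _ hw)
  obtain ⟨K, hK⟩ := s.nilX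
  have key : ∀ y ∈ N, hm H (K + 1) y ∈ R := by
    intro y hy
    induction hy using Submodule.span_induction with
    | mem x h =>
      obtain ⟨m, u, b, hu, rfl⟩ := h
      rcases lt_trichotomy b m with hb | hb | hb
      · apply hhm
        have h1 := s.low_y hu b
        have hc : (((b : ℂ) + 1) * (m - b)) ≠ 0 := by
          apply mul_ne_zero
          · exact_mod_cast b.succ_ne_zero
          · rw [sub_ne_zero]; exact_mod_cast hb.ne'
        refine (R.smul_mem_iff hc).1 ?_
        rw [← h1]
        exact ⟨_, strings_gen hu _, rfl⟩
      · subst hb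
        by_cases hbK : b ≤ K
        · have h2 := s.low_h hu b
          rw [hm_eig H h2, Finset.prod_eq_zero (i := b)]
          · simp
          · simp; omega
          · ring
        · have : (X ^ b) u = 0 := by
            rw [pow_eq_zero_of_le (by omega) hK]; simp
          rw [this]; simp
      · rw [s.low_top' hu hb]; simp
    | zero => simp
    | add x y _ _ hx hy => rw [map_add]; exact Submodule.add_mem _ hx hy
    | smul a x _ hx => rw [map_smul]; exact Submodule.smul_mem _ _ hx
  have hYR : Y v ∈ R := by
    apply bezout_aux H R hRH m (K + 1) _ _ (key _ hY)
    refine ⟨_, hH, ?_⟩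
    rw [s.hy, map_add, map_smul]; module
  obtain ⟨w, hw, hwv⟩ := hYR
  apply hu0
  rw [Submodule.mkQ_apply, Submodule.Quotient.mk_eq_zero]
  have hk : v - w ∈ N := by
    obtain ⟨M, hM⟩ := s.decomp
    obtain ⟨f, hf, hs⟩ := hM (v - w) (by rw [map_sub, hwv, sub_self])
    rw [hs]
    refine N.sum_mem fun j _ => ?_
    have := strings_gen (X := X) (H := H) (Y := Y) (m := j) (u := f j) (hf j) 0
    simpa using this
  have := N.add_mem hk hw
  simpa using this

end

end EvenOrbit

namespace EvenOrbit

open Module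

universe u

section

variable {V : Type u} [AddCommGroup V] [Module ℂ V]
variable {X H Y : End ℂ V}

lemma SL.ypow (s : SL X H Y) {m : ℕ} {u : V} (hu : Low H Y m u) (a : ℕ) :
    ∀ b : ℕ, b + a ≤ m → ∃ γ : ℝ, 0 < γ ∧ (Y ^ a) ((X ^ (b + a)) u) = (γ : ℂ) • (X ^ b) u := by
  induction a with
  | zero => intro b _; exact ⟨1, one_pos, by simp⟩
  | succ a ih =>
    intro b hb
    obtain ⟨γ, hγ, h⟩ := ih b (by omega)
    refine ⟨(((b + a : ℕ) : ℝ) + 1) * ((m : ℝ) - (b + a : ℕ)) * γ, ?_, ?_⟩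
    · apply mul_pos (mul_pos (by positivity) _) hγ
      rw [sub_pos]
      exact_mod_cast hb
    · rw [pow_succ Y, Module.End.mul_apply, ← add_assoc, s.low_y hu, map_smul, h, smul_smul]
      push_cast
      rfl

lemma SL.ypow_zero (s : SL X H Y) {m : ℕ} {u : V} (hu : Low H Y m u) {a b : ℕ} (hb : b ≤ m)
    (hab : b < a) : (Y ^ a) ((X ^ b) u) = 0 := by
  obtain ⟨k, rfl⟩ := Nat.exists_eq_add_of_lt hab
  obtain ⟨γ, _, h⟩ := s.ypow hu b 0 (by omega)
  rw [show b + k + 1 = k + 1 + b by omega, pow_add, Module.End.mul_apply]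
  simp only [zero_add] at h
  rw [h, map_smul, pow_succ, Module.End.mul_apply]
  simp [hu.1]

lemma SL.basis [FiniteDimensional ℂ V] (s : SL X H Y) :
    ∃ (ι : Type u) (_ : Fintype ι) (m : ι → ℕ) (u : ι → V)
      (e : Basis (Σ i, Fin (m i + 1)) ℂ V),
      (∀ i, Low H Y (m i) (u i)) ∧ ∀ p, e p = (X ^ (p.2 : ℕ)) (u p.1) := by
  obtain ⟨B, hBs, hBspan, hBli⟩ := exists_linearIndependent ℂ {v : V | ∃ m, Low H Y m v}
  have hfin : Finite B := hBli.finite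
  have hft : Fintype B := Fintype.ofFinite B
  have hB : ∀ i : B, ∃ m, Low H Y m (i : V) := fun i => hBs i.2
  choose m hm using hB
  have hli : LinearIndependent ℂ
      (fun p : (Σ i : B, Fin (m i + 1)) => (X ^ (p.2 : ℕ)) (p.1 : V)) := by
    rw [Fintype.linearIndependent_iff]
    intro c hc
    by_contra! hne
    obtain ⟨p0, hp0⟩ := hne
    obtain ⟨p, hp, hmax⟩ := Finset.exists_max_image (Finset.univ.filter fun p => c p ≠ 0)
      (fun p => (p.2 : ℕ)) ⟨p0, by simp [hp0]⟩
    simp only [Finset.mem_filter, Finset.mem_univ, true_and] at hp hmax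
    obtain ⟨i, b⟩ := p
    have h1 := congrArg (Y ^ (b : ℕ)) hc
    rw [map_sum, map_zero, Fintype.sum_sigma] at h1
    have h2 : ∀ j : B, ∃ d : ℂ, (∑ y : Fin (m j + 1), (Y ^ (b : ℕ)) (c ⟨j, y⟩ • (X ^ (y : ℕ)) (j : V)))
        = d • (j : V) ∧ (j = i → d ≠ 0) := by
      intro j
      by_cases hbj : (b : ℕ) ≤ m j
      · obtain ⟨γ, hγ, h⟩ := s.ypow (hm j) b 0 (by omega)
        refine ⟨c ⟨j, ⟨b, by omega⟩⟩ * γ, ?_, ?_⟩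
        · rw [Finset.sum_eq_single ⟨(b : ℕ), by omega⟩]
          · rw [map_smul]
            simp only [zero_add] at h
            rw [h, smul_smul]; simp
          · intro y _ hy
            by_cases hyb : (y : ℕ) < b
            · rw [map_smul, s.ypow_zero (hm j) (by omega) hyb, smul_zero]
            · have : c ⟨j, y⟩ = 0 := by
                by_contra hcy
                have := hmax _ hcy
                apply hy
                ext
                simp at this ⊢
                omega
              simp [this]
          · simp
        · rintro rfl
          exact mul_ne_zero hp (by exact_mod_cast hγ.ne')
      · refine ⟨0, ?_, ?_⟩
        · rw [zero_smul]
          apply Finset.sum_eq_zero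
          intro y _
          rw [map_smul, s.ypow_zero (hm j) (by omega) (by omega), smul_zero]
        · rintro rfl
          omega
    choose d hd hd' using h2
    simp only [hd] at h1
    exact hd' i rfl (Fintype.linearIndependent_iff.1 hBli d h1 i)
  have hsp : ⊤ ≤ Submodule.span ℂ (Set.range
      (fun p : (Σ i : B, Fin (m i + 1)) => (X ^ (p.2 : ℕ)) (p.1 : V))) := by
    rw [← s.strings_top, strings, Submodule.span_le]
    rintro _ ⟨k, v, b, hv, rfl⟩
    have hvB : v ∈ Submodule.span ℂ B := by
      rw [hBspan]; exact Submodule.subset_span ⟨k, hv⟩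
    have h1 : (X ^ b) v ∈ (Submodule.span ℂ B).map (X ^ b) := ⟨v, hvB, rfl⟩
    rw [Submodule.map_span] at h1
    refine (Submodule.span_le.2 ?_) h1
    rintro _ ⟨w, hw, rfl⟩
    by_cases hb : b < m ⟨w, hw⟩ + 1
    · exact Submodule.subset_span ⟨⟨⟨w, hw⟩, ⟨b, hb⟩⟩, rfl⟩
    · have := s.low_top' (hm ⟨w, hw⟩) (b := b) (by omega)
      simp only at this
      simp [this]
  exact ⟨B, hft, m, fun i => i, Basis.mk hli hsp, hm, fun p => by simp⟩

/-- filtration by weights -/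
def F (H : End ℂ V) (w : ℤ) : Submodule ℂ V :=
  Submodule.span ℂ {v | ∃ k : ℤ, k ≤ w ∧ H v = (k : ℂ) • v}

lemma F_mem {v : V} {k w : ℤ} (h : H v = (k : ℂ) • v) (hk : k ≤ w) : v ∈ F H w :=
  Submodule.subset_span ⟨k, hk, h⟩

lemma F_mono {w w' : ℤ} (h : w ≤ w') : F H w ≤ F H w' := by
  apply Submodule.span_mono
  rintro v ⟨k, hk, hv⟩
  exact ⟨k, hk.trans h, hv⟩

lemma F_disj {v : V} {w w' : ℤ} (h : H v = (w : ℂ) • v) (hv : v ∈ F H w') (hw : w' < w) :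
    v = 0 := by
  have h1 := (Module.End.eigenspaces_iSupIndep H) (w : ℂ)
  rw [Submodule.disjoint_def] at h1
  apply h1 v (Module.End.mem_eigenspace_iff.2 h)
  have : F H w' ≤ ⨆ j, ⨆ (_ : j ≠ (w : ℂ)), Module.End.eigenspace H j := by
    rw [F, Submodule.span_le]
    rintro x ⟨k, hk, hx⟩
    have hne : (k : ℂ) ≠ w := by
      intro h
      have : k = w := by exact_mod_cast h
      omega
    exact (le_iSup₂_of_le (f := fun (j : ℂ) (_ : j ≠ (w : ℂ)) => Module.End.eigenspace H j)
      (k : ℂ) hne le_rfl) (Module.End.mem_eigenspace_iff.2 hx)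
  exact this hv

lemma lead_indep {J : Type*} [Fintype J] (H : End ℂ V) (f g : J → V) (w : J → ℤ)
    (hg : LinearIndependent ℂ g) (hgw : ∀ j, H (g j) = (w j : ℂ) • g j)
    (hf : ∀ j, f j - g j ∈ F H (w j - 1)) : LinearIndependent ℂ f := by
  rw [Fintype.linearIndependent_iff]
  intro c hc
  by_contra! hne
  obtain ⟨p0, hp0⟩ := hne
  obtain ⟨p, hp, hmax⟩ := Finset.exists_max_image (Finset.univ.filter fun p => c p ≠ 0)
    w ⟨p0, by simp [hp0]⟩
  simp only [Finset.mem_filter, Finset.mem_univ, true_and] at hp hmax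
  have ht : ∑ j, (if w j = w p then c j else 0) • g j = 0 := by
    apply F_disj (H := H) (w := w p) (w' := w p - 1) _ _ (by omega)
    · rw [map_sum, Finset.smul_sum]
      apply Finset.sum_congr rfl
      intro j _
      split_ifs with h
      · rw [map_smul, hgw, h, smul_comm]
      · simp
    · have : ∑ j, (if w j = w p then c j else 0) • g j =
        - ∑ j, (c j • f j - (if w j = w p then c j else 0) • g j) := by
        rw [Finset.sum_sub_distrib, hc]; simp
      rw [this]
      refine Submodule.neg_mem _ (Submodule.sum_mem _ fun j _ => ?_)
      by_cases hj : c j = 0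
      · simp [hj]
      have hle := hmax j hj
      split_ifs with h
      · rw [← smul_sub, ← h]
        exact Submodule.smul_mem _ _ (hf j)
      · rw [zero_smul, sub_zero]
        apply Submodule.smul_mem
        have h1 : f j = (f j - g j) + g j := by abel
        rw [h1]
        exact Submodule.add_mem _ (F_mono (by omega) (hf j)) (F_mem (hgw j) (by omega))
  have := Fintype.linearIndependent_iff.1 hg _ ht p
  simp at this
  exact hp this

/-- endomorphisms of filtered degree at most `r` -/
def deg (H : End ℂ V) (r : ℤ) : Submodule ℂ (End ℂ V) where
  carrier := {A | ∀ w v, v ∈ F H w → A v ∈ F H (w + r)}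
  add_mem' := fun ha hb w v hv => Submodule.add_mem _ (ha w v hv) (hb w v hv)
  zero_mem' := fun w v _ => Submodule.zero_mem _
  smul_mem' := fun c _ ha w v hv => Submodule.smul_mem _ c (ha w v hv)

lemma deg_mono {r r' : ℤ} (h : r ≤ r') {A : End ℂ V} (hA : A ∈ deg H r) : A ∈ deg H r' :=
  fun w v hv => F_mono (by omega) (hA w v hv)

lemma deg_mul {r r' t : ℤ} {A B : End ℂ V} (hA : A ∈ deg H r) (hB : B ∈ deg H r')
    (h : r + r' ≤ t) : A * B ∈ deg H t :=
  fun w v hv => F_mono (by omega) (hA _ _ (hB w v hv))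

/-- homogeneous endomorphisms -/
def Hom (H : End ℂ V) (r : ℤ) (A : End ℂ V) : Prop :=
  ∀ v, H (A v) = A (H v) + (r : ℂ) • A v

lemma Hom.eig {r : ℤ} {A : End ℂ V} (hA : Hom H r A) {k : ℤ} {v : V} (h : H v = (k : ℂ) • v) :
    H (A v) = ((k + r : ℤ) : ℂ) • A v := by
  rw [hA, h, map_smul]; push_cast; module

lemma Hom.deg {r : ℤ} {A : End ℂ V} (hA : Hom H r A) : A ∈ deg H r := by
  intro w v hv
  induction hv using Submodule.span_induction with
  | mem x h =>
    obtain ⟨k, hk, hx⟩ := h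
    exact F_mem (hA.eig hx) (by omega)
  | zero => simp
  | add x y _ _ hx hy => rw [map_add]; exact Submodule.add_mem _ hx hy
  | smul a x _ hx => rw [map_smul]; exact Submodule.smul_mem _ _ hx

lemma Hom.mul {r r' t : ℤ} {A B : End ℂ V} (hA : Hom H r A) (hB : Hom H r' B) (h : r + r' = t) :
    Hom H t (A * B) := by
  intro v
  subst h
  rw [Module.End.mul_apply, hA, hB, map_add, map_smul, Module.End.mul_apply]
  push_cast
  module

lemma Hom.add {r : ℤ} {A B : End ℂ V} (hA : Hom H r A) (hB : Hom H r B) : Hom H r (A + B) := by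
  intro v
  simp only [LinearMap.add_apply, map_add, hA v, hB v]
  module

lemma Hom.zero {r : ℤ} : Hom H r 0 := by intro v; simp

lemma Hom.one : Hom H 0 1 := by intro v; simp

lemma SL.homX (s : SL X H Y) (k : ℕ) : Hom H (2 * k) (X ^ k) := by
  intro v; rw [s.hx_pow]; push_cast; rfl

lemma SL.homX1 (s : SL X H Y) : Hom H 2 X := by simpa using s.homX 1

lemma SL.homY (s : SL X H Y) : Hom H (-2) Y := by
  intro v; rw [s.hy]; push_cast; module

lemma deg_scalar (c : ℂ) : c • (1 : End ℂ V) ∈ deg H 0 :=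
  Submodule.smul_mem _ _ Hom.one.deg

end

end EvenOrbit

namespace EvenOrbit

open Module

universe u

section

variable {V : Type u} [AddCommGroup V] [Module ℂ V]
variable {X H Y : End ℂ V}

lemma aeval_semiconj {A B E : End ℂ V} (h : A * E = E * B) (p : Polynomial ℂ) :
    Polynomial.aeval A p * E = E * Polynomial.aeval B p := by
  induction p using Polynomial.induction_on' with
  | add p q hp hq => rw [map_add, map_add, add_mul, mul_add, hp, hq]
  | monomial k c =>
    have hk : A ^ k * E = E * B ^ k := by
      induction k with
      | zero => simp
      | succ k ih => rw [pow_succ, mul_assoc, h, ← mul_assoc, ih, mul_assoc, ← pow_succ]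
    simp only [Polynomial.aeval_monomial]
    rw [mul_assoc, hk, ← mul_assoc, ← mul_assoc, Algebra.commutes]

lemma SL.xy_pow (s : SL X H Y) (k : ℕ) (v : V) :
    X ((Y ^ (k + 1)) v) = (Y ^ (k + 1)) (X v) + ((k : ℂ) + 1) • (Y ^ k) (H v)
      - (((k : ℂ) + 1) * k) • (Y ^ k) v := by
  induction k with
  | zero => simp [s.xy]
  | succ k ih =>
    rw [pow_succ', Module.End.mul_apply, s.xy, ih, s.hy_pow]
    simp only [map_add, map_sub, map_smul, pow_succ', Module.End.mul_apply]
    push_cast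
    module

lemma SL.exp_aux (s : SL X H Y) (c : ℂ) (a : ℕ → ℂ) (ha : ∀ k : ℕ, ((k : ℂ) + 1) * a (k + 1) = c * a k)
    (J : ℕ) (v : V) :
    X (∑ k ∈ Finset.range (J + 1), a k • (Y ^ k) v)
      - (∑ k ∈ Finset.range (J + 1), a k • (Y ^ k) (X v + c • H v))
      + c ^ 2 • Y (∑ k ∈ Finset.range (J + 1), a k • (Y ^ k) v) =
    -(c * a J) • (Y ^ J) (H v) + (c * a J * J) • (Y ^ J) v + (c ^ 2 * a J) • (Y ^ (J + 1)) v := by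
  induction J with
  | zero =>
    simp only [zero_add, Finset.sum_range_one, pow_zero, Module.End.one_apply, map_smul, pow_one,
      Nat.cast_zero]
    module
  | succ J ih =>
    rw [Finset.sum_range_succ, Finset.sum_range_succ _ (J + 1), map_add X, map_add Y, smul_add]
    rw [show ∀ p q r t x y : V, p + q - (r + t) + (x + y) = (p - r + x) + (q - t + y) by
      intros; abel, ih]
    simp only [map_smul, s.xy_pow, map_add]
    rw [← Module.End.mul_apply Y, ← pow_succ']
    have h1 := ha J
    have h2 : c ^ 2 * a J = c * (((J : ℂ) + 1) * a (J + 1)) := by rw [h1]; ring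
    rw [h2, ← h1]
    push_cast
    module

lemma SL.exists_E [FiniteDimensional ℂ V] (s : SL X H Y) (c : ℂ) (hc : c ^ 2 = -1) :
    ∃ E : End ℂ V, (X - Y) * E = E * (X + c • H) ∧ ∀ v, Y v = 0 → E v = v := by
  obtain ⟨N, hN⟩ := s.nilY
  set a : ℕ → ℂ := fun k => c ^ k / (k.factorial : ℂ) with ha
  have ha' : ∀ k : ℕ, ((k : ℂ) + 1) * a (k + 1) = c * a k := by
    intro k
    have h1 : (k.factorial : ℂ) ≠ 0 := by exact_mod_cast k.factorial_ne_zero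
    have h2 : (k : ℂ) + 1 ≠ 0 := by exact_mod_cast k.succ_ne_zero
    simp only [ha, Nat.factorial_succ]
    push_cast
    field_simp
    ring
  refine ⟨∑ k ∈ Finset.range (N + 1), a k • Y ^ k, ?_, ?_⟩
  · ext v
    have h := s.exp_aux c a ha' N v
    rw [hc, pow_succ, hN] at h
    simp only [zero_mul, LinearMap.zero_apply, smul_zero, add_zero] at h
    simp only [Module.End.mul_apply, LinearMap.sub_apply, LinearMap.add_apply, LinearMap.smul_apply,
      LinearMap.sum_apply]
    rw [← sub_eq_zero, ← h]
    module
  · intro v hv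
    simp only [LinearMap.sum_apply, LinearMap.smul_apply]
    rw [Finset.sum_range_succ']
    have : ∑ k ∈ Finset.range N, a (k + 1) • (Y ^ (k + 1)) v = 0 := by
      apply Finset.sum_eq_zero
      intro k _
      rw [pow_succ, Module.End.mul_apply, hv, map_zero, smul_zero]
    rw [this]
    simp [ha]

/-- ordering of the eigenvalues `0, 2i, -2i, 4i, -4i, …` -/
noncomputable def rt (a : ℕ) : ℂ :=
  if Even a then -((a : ℂ) * Complex.I) else ((a : ℂ) + 1) * Complex.I

/-- partial products -/
noncomputable def pol (s l : ℕ) : Polynomial ℂ :=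
  ∏ a ∈ Finset.range l, (Polynomial.X - Polynomial.C (rt (s + a)))

lemma pol_add (l b : ℕ) : pol 0 (l + b) = pol l b * pol 0 l := by
  rw [pol, Finset.prod_range_add, mul_comm]
  simp [pol]

lemma pol_odd (d : ℕ) : pol 0 (2 * d + 1) = ∏ j ∈ Finset.range (2 * d + 1),
    (Polynomial.X - Polynomial.C ((2 * (j : ℂ) - (2 * d : ℕ)) * Complex.I)) := by
  induction d with
  | zero => simp [pol, rt]
  | succ d ih =>
    have h1 : pol 0 (2 * (d + 1) + 1) = pol 0 (2 * d + 1) *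
        (Polynomial.X - Polynomial.C (rt (2 * d + 1))) *
        (Polynomial.X - Polynomial.C (rt (2 * d + 2))) := by
      rw [show 2 * (d + 1) + 1 = 2 * d + 1 + 1 + 1 by ring, pol, Finset.prod_range_succ,
        Finset.prod_range_succ]
      simp [pol]
    rw [h1, ih, show 2 * (d + 1) + 1 = 2 * d + 1 + 1 + 1 by ring,
      Finset.prod_range_succ' _ (2 * d + 1 + 1)]
    have e1 : rt (2 * d + 1) = (2 * ((2 * d + 1 : ℕ) : ℂ) - (2 * d : ℕ)) * Complex.I := by
      rw [rt, if_neg (by simp)]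
      push_cast; ring
    have e2 : rt (2 * d + 2) = (2 * ((0 : ℕ) : ℂ) - (2 * (d + 1) : ℕ)) * Complex.I := by
      rw [rt, if_pos (by simp [parity_simps])]
      push_cast; ring
    have e3 : ∀ j : ℕ, (2 * ((j + 1 : ℕ) : ℂ) - (2 * (d + 1) : ℕ)) * Complex.I =
        (2 * (j : ℂ) - (2 * d : ℕ)) * Complex.I := by
      intro j; push_cast; ring
    simp only [e3, e1, e2]
    rw [Finset.prod_range_succ _ (2 * d + 1)]

lemma SL.pol_kill [FiniteDimensional ℂ V] (s : SL X H Y) {m : ℕ} {u : V} (hu : Low H Y m u)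
    (hm : Even m) : Polynomial.aeval (X - Y) (pol 0 (m + 1)) u = 0 := by
  obtain ⟨E, hE, hEu⟩ := s.exists_E Complex.I (by simp)
  obtain ⟨d, hd⟩ := hm
  have hd' : m = 2 * d := by omega
  have key : ∀ l : ℕ, Polynomial.aeval (X + Complex.I • H) (∏ j ∈ Finset.range l,
    (Polynomial.X - Polynomial.C ((2 * (j : ℂ) - (m : ℕ)) * Complex.I))) u = (X ^ l) u := by
    intro l
    induction l with
    | zero => simp
    | succ l ih =>
      rw [Finset.prod_range_succ, mul_comm, map_mul, Module.End.mul_apply, ih]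
      simp only [map_sub, Polynomial.aeval_X, Polynomial.aeval_C, LinearMap.sub_apply,
        LinearMap.add_apply, LinearMap.smul_apply, s.low_h hu, Module.algebraMap_end_apply,
        pow_succ', Module.End.mul_apply]
      module
  have h1 := LinearMap.congr_fun (aeval_semiconj hE (pol 0 (m + 1))) u
  rw [Module.End.mul_apply, Module.End.mul_apply, hEu u hu.1] at h1
  rw [h1, hd', pol_odd, ← hd', key, s.low_top hu, map_zero]

lemma SL.pol_kill' [FiniteDimensional ℂ V] (s : SL X H Y) {m : ℕ} {u : V} (hu : Low H Y m u)
    (hm : Even m) {l : ℕ} (hl : m < l) : Polynomial.aeval (X - Y) (pol 0 l) u = 0 := by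
  obtain ⟨k, rfl⟩ := Nat.exists_eq_add_of_lt hl
  rw [show m + k + 1 = m + 1 + k by omega, pol_add, map_mul, Module.End.mul_apply,
    s.pol_kill hu hm, map_zero]

lemma aeval_pol_succ (A : End ℂ V) (t l : ℕ) : Polynomial.aeval A (pol t (l + 1)) =
    (A - rt (t + l) • 1) * Polynomial.aeval A (pol t l) := by
  rw [pol, Finset.prod_range_succ, mul_comm, map_mul, ← pol]
  simp [Algebra.algebraMap_eq_smul_one]

lemma SL.lead_pol (s : SL X H Y) {A : End ℂ V} (hA : A - X ∈ deg H 1) (t l : ℕ) :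
    Polynomial.aeval A (pol t l) - X ^ l ∈ deg H (2 * l - 1) := by
  induction l with
  | zero => simp [pol]
  | succ l ih =>
    rw [aeval_pol_succ]
    set Q := Polynomial.aeval A (pol t l)
    set c := rt (t + l)
    have : (A - c • 1) * Q - X ^ (l + 1) = X * (Q - X ^ l) +
        (A - X - c • 1) * ((Q - X ^ l) + X ^ l) := by
      rw [pow_succ']; noncomm_ring
    rw [this]
    have h1 : A - X - c • 1 ∈ deg H 1 := Submodule.sub_mem _ hA (deg_mono (by omega) (deg_scalar c))
    have h2 : (Q - X ^ l) + X ^ l ∈ deg H (2 * l) :=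
      Submodule.add_mem _ (deg_mono (by omega) ih) (s.homX l).deg
    refine Submodule.add_mem _ (deg_mul s.homX1.deg ih ?_) (deg_mul h1 h2 ?_) <;> push_cast <;> omega

/-- the first variation -/
def var (X D : End ℂ V) : ℕ → End ℂ V
  | 0 => 0
  | l + 1 => X * var X D l + D * X ^ l

lemma var_eq (X D : End ℂ V) (l : ℕ) :
    var X D l = ∑ a ∈ Finset.range l, X ^ a * D * X ^ (l - 1 - a) := by
  induction l with
  | zero => simp [var]
  | succ l ih =>
    rw [var, ih, Finset.sum_range_succ', Finset.mul_sum]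
    congr 1
    · apply Finset.sum_congr rfl
      intro a _
      rw [pow_succ', show l + 1 - 1 - (a + 1) = l - 1 - a by omega]
      noncomm_ring

lemma SL.var_hom (s : SL X H Y) {D : End ℂ V} {k : ℤ} (hD : Hom H (-k) D) (l : ℕ) :
    Hom H (2 * ((l : ℤ) - 1) - k) (var X D l) := by
  induction l with
  | zero => exact Hom.zero
  | succ l ih =>
    rw [var]
    refine Hom.add (s.homX1.mul ih ?_) (hD.mul (s.homX l) ?_) <;> push_cast <;> ring

lemma SL.var_pol (s : SL X H Y) {Z D E : End ℂ V} {k : ℤ} (hk : 0 ≤ k) (hZ : Z - X ∈ deg H 1)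
    (hD : Hom H (-k) D) (hE : E ∈ deg H (-k - 1)) (l : ℕ) :
    Polynomial.aeval (Z + (D + E)) (pol 0 l) - Polynomial.aeval Z (pol 0 l) - var X D l ∈
      deg H (2 * ((l : ℤ) - 1) - k - 1) := by
  have hDE : D + E ∈ deg H (-k) := Submodule.add_mem _ hD.deg (deg_mono (by omega) hE)
  induction l with
  | zero => simp [pol, var]
  | succ l ih =>
    have hA : Z + (D + E) - X ∈ deg H 1 := by
      rw [show Z + (D + E) - X = (Z - X) + (D + E) by abel]
      exact Submodule.add_mem _ hZ (deg_mono (by omega) hDE)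
    have hQ := s.lead_pol hA 0 l
    rw [aeval_pol_succ, aeval_pol_succ, var]
    set Q := Polynomial.aeval (Z + (D + E)) (pol 0 l)
    set P := Polynomial.aeval Z (pol 0 l)
    set S := var X D l with hS
    set c := rt (0 + l)
    have hSd : S ∈ deg H (2 * ((l : ℤ) - 1) - k) := (s.var_hom hD l).deg
    have hZc : Z - X - c • 1 ∈ deg H 1 := Submodule.sub_mem _ hZ (deg_mono (by omega) (deg_scalar c))
    have hZ2 : Z - c • 1 ∈ deg H 2 := by
      rw [show Z - c • 1 = (Z - X - c • 1) + X by abel]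
      exact Submodule.add_mem _ (deg_mono (by omega) hZc) s.homX1.deg
    have : (Z + (D + E) - c • 1) * Q - (Z - c • 1) * P - (X * S + D * X ^ l) =
        (Z - c • 1) * (Q - P - S) + (Z - X - c • 1) * S + (D + E) * (Q - X ^ l) + E * X ^ l := by
      noncomm_ring
    rw [this]
    refine Submodule.add_mem _ (Submodule.add_mem _ (Submodule.add_mem _ (deg_mul hZ2 ih ?_)
      (deg_mul hZc hSd ?_)) (deg_mul hDE hQ ?_)) (deg_mul hE (s.homX l).deg ?_) <;>
      push_cast <;> omega

end

end EvenOrbit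

namespace EvenOrbit

open Module

universe u

section

variable {V : Type u} [AddCommGroup V] [Module ℂ V]
variable {X H Y : End ℂ V}

lemma low_weight {m : ℕ} {u : V} (hu : Low H Y m u) : H u = ((-(m : ℤ) : ℤ) : ℂ) • u := by
  rw [hu.2]; push_cast; rfl

lemma SL.low_h' (s : SL X H Y) {m : ℕ} {u : V} (hu : Low H Y m u) (b : ℕ) :
    H ((X ^ b) u) = ((2 * (b : ℤ) - m : ℤ) : ℂ) • (X ^ b) u := by
  rw [s.low_h hu]; push_cast; rfl

lemma SL.Z_deg (s : SL X H Y) : (X - Y) - X ∈ deg H 1 := by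
  rw [show X - Y - X = -Y by abel]
  exact Submodule.neg_mem _ (deg_mono (by omega) s.homY.deg)

/-- eigenvalues of `X^a Y^a` -/
lemma SL.xaya [FiniteDimensional ℂ V] (s : SL X H Y) {m : ℕ} {u : V} (hu : Low H Y m u) (a b : ℕ) (hb : b ≤ m) :
    ∃ γ : ℝ, 0 ≤ γ ∧ (a ≤ b → 0 < γ) ∧ (X ^ a) ((Y ^ a) ((X ^ b) u)) = (γ : ℂ) • (X ^ b) u := by
  by_cases hab : a ≤ b
  · obtain ⟨γ, hγ, h⟩ := s.ypow hu a (b - a) (by omega)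
    rw [Nat.sub_add_cancel hab] at h
    refine ⟨γ, hγ.le, fun _ => hγ, ?_⟩
    rw [h, map_smul, ← Module.End.mul_apply, ← pow_add, Nat.add_sub_cancel' hab]
  · refine ⟨0, le_rfl, fun h => absurd h hab, ?_⟩
    rw [s.ypow_zero hu hb (by omega)]; simp

lemma SL.from_top (s : SL X H Y) {m : ℕ} {u : V} (hu : Low H Y m u) (a : ℕ) (ha : a ≤ m) :
    ∃ c : ℝ, 0 < c ∧ (X ^ (m - a)) u = (c : ℂ) • (Y ^ a) ((X ^ m) u) := by
  obtain ⟨γ, hγ, h⟩ := s.ypow hu a (m - a) (by omega)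
  rw [Nat.sub_add_cancel ha] at h
  refine ⟨γ⁻¹, inv_pos.2 hγ, ?_⟩
  rw [h, smul_smul]
  push_cast
  rw [inv_mul_cancel₀ (by exact_mod_cast hγ.ne'), one_smul]

lemma comm_pow {D : End ℂ V} (h : ∀ v, D (Y v) = Y (D v)) (a : ℕ) (v : V) :
    D ((Y ^ a) v) = (Y ^ a) (D v) := by
  induction a with
  | zero => simp
  | succ a ih => rw [pow_succ', Module.End.mul_apply, h, ih, Module.End.mul_apply]

lemma SL.step [FiniteDimensional ℂ V] (s : SL X H Y)
    (hEven : ∀ m u, u ≠ 0 → Low H Y m u → Even m)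
    {D E : End ℂ V} {k : ℤ} (hk : 0 ≤ k) (hD : Hom H (-k) D) (hE : E ∈ deg H (-k - 1))
    (hDY : ∀ v, D (Y v) = Y (D v))
    (hrank : ∀ p : Polynomial ℂ,
      finrank ℂ (LinearMap.range (Polynomial.aeval (X - Y + (D + E)) p)) ≤
      finrank ℂ (LinearMap.range (Polynomial.aeval (X - Y) p))) : D = 0 := by
  obtain ⟨ι, hι, m, u, e, hu, he⟩ := s.basis
  classical
  have hm : ∀ i, Even (m i) := by
    intro i
    apply hEven (m i) (u i) _ (hu i)
    have := e.ne_zero ⟨i, 0⟩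
    rw [he] at this
    simpa using this
  -- it suffices to kill the highest weight vectors
  suffices htop : ∀ i, D ((X ^ (m i)) (u i)) = 0 by
    apply e.ext
    rintro ⟨i, b⟩
    rw [he]
    obtain ⟨c, _, h⟩ := s.from_top (hu i) (m i - b) (by omega)
    rw [show m i - (m i - (b : ℕ)) = b by omega] at h
    simp only
    rw [h, map_smul, comm_pow hDY, htop]
    simp
  intro i₀
  by_contra hz
  set z := D ((X ^ (m i₀)) (u i₀)) with hzdef
  set l := m i₀ + 1 with hl
  have hex : ∀ (a : ℕ) (p : Σ i, Fin (m i + 1)), ∃ γ : ℝ, 0 ≤ γ ∧ (a ≤ (p.2 : ℕ) → 0 < γ) ∧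
      (X ^ a) ((Y ^ a) (e p)) = (γ : ℂ) • e p := by
    intro a p
    rw [he]
    exact s.xaya (hu p.1) a p.2 (by omega)
  choose γ hγ0 hγpos hγ using hex
  have hcoord : ∀ a p v, e.repr ((X ^ a) ((Y ^ a) v)) p = γ a p * e.repr v p := by
    intro a p v
    have : (e.coord p) ∘ₗ (X ^ a * Y ^ a) = (γ a p : ℂ) • e.coord p := by
      apply e.ext
      intro q
      simp only [LinearMap.comp_apply, Module.End.mul_apply, hγ, map_smul, LinearMap.smul_apply,
        Basis.coord_apply, Basis.repr_self]
      by_cases hqp : q = p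
      · subst hqp; simp
      · simp [Finsupp.single_apply, hqp]
    have := LinearMap.congr_fun this v
    simpa using this
  -- coordinates of `z`
  have hzlow : ∀ p : (Σ i, Fin (m i + 1)), l ≤ (p.2 : ℕ) → e.repr z p = 0 := by
    intro p hp
    have h1 := hcoord l p z
    have h2 : (Y ^ l) z = 0 := by
      rw [hzdef, ← comm_pow hDY, s.ypow_zero (hu i₀) le_rfl (by omega), map_zero]
    rw [h2] at h1
    simp only [map_zero, Finsupp.coe_zero, Pi.zero_apply] at h1
    have h3 : (γ l p : ℂ) ≠ 0 := by exact_mod_cast (hγpos l p hp).ne'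
    exact (mul_eq_zero.1 h1.symm).resolve_left h3
  obtain ⟨p₀, hp₀⟩ : ∃ p, e.repr z p ≠ 0 := by
    by_contra! h
    apply hz
    apply e.repr.injective
    ext p
    simp [h]
  have hp₀l : (p₀.2 : ℕ) < l := by
    by_contra h
    exact hp₀ (hzlow p₀ (by omega))
  -- the leading term
  set S := var X D l (u i₀) with hS
  have hSp : e.repr S p₀ ≠ 0 := by
    have hc : ∀ a : ℕ, ∃ c : ℝ, 0 < c ∧ (a < l →
        (X ^ (l - 1 - a)) (u i₀) = (c : ℂ) • (Y ^ a) ((X ^ (m i₀)) (u i₀))) := by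
      intro a
      by_cases ha : a < l
      · obtain ⟨c, hc, h⟩ := s.from_top (hu i₀) a (by omega)
        exact ⟨c, hc, fun _ => by simpa [hl] using h⟩
      · exact ⟨1, one_pos, fun h => absurd h ha⟩
    choose c hc0 hc using hc
    have hSsum : S = ∑ a ∈ Finset.range l, (c a : ℂ) • (X ^ a) ((Y ^ a) z) := by
      rw [hS, var_eq, LinearMap.sum_apply]
      apply Finset.sum_congr rfl
      intro a ha
      rw [Module.End.mul_apply, Module.End.mul_apply, hc a (Finset.mem_range.1 ha), map_smul,
        comm_pow hDY, map_smul]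
    have : e.repr S p₀ = ((∑ a ∈ Finset.range l, c a * γ a p₀ : ℝ) : ℂ) * e.repr z p₀ := by
      rw [hSsum]
      simp only [map_sum, map_smul, Finsupp.finsetSum_apply, Finsupp.smul_apply, hcoord, smul_eq_mul]
      push_cast
      rw [Finset.sum_mul]
      apply Finset.sum_congr rfl
      intros; ring
    rw [this]
    apply mul_ne_zero _ hp₀
    have hpos : 0 < ∑ a ∈ Finset.range l, c a * γ a p₀ := by
      apply Finset.sum_pos'
      · intro a _
        exact mul_nonneg (hc0 a).le (hγ0 a p₀)
      · exact ⟨0, by simp [hl], mul_pos (hc0 0) (hγpos 0 p₀ (by omega))⟩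
    exact_mod_cast hpos.ne'
  let J := {p : (Σ i, Fin (m i + 1)) // (p.2 : ℕ) + l ≤ m p.1}
  set P := Polynomial.aeval (X - Y) (pol 0 l) with hP
  set Q := Polynomial.aeval (X - Y + (D + E)) (pol 0 l) with hQ
  have hDE : D + E ∈ deg H 0 := Submodule.add_mem _ (deg_mono (by omega) hD.deg)
    (deg_mono (by omega) hE)
  have hW : X - Y + (D + E) - X ∈ deg H 1 := by
    rw [show X - Y + (D + E) - X = (X - Y - X) + (D + E) by abel]
    exact Submodule.add_mem _ s.Z_deg (deg_mono (by omega) hDE)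
  -- upper bound
  have hup : finrank ℂ (LinearMap.range P) ≤ Fintype.card J := by
    let gb : (Σ i, Fin (m i + 1)) → V :=
      fun p => Polynomial.aeval (X - Y) (pol l (p.2 : ℕ)) (u p.1)
    have hgb : LinearIndependent ℂ gb := by
      apply lead_indep H gb e (fun p => 2 * ((p.2 : ℕ) : ℤ) - m p.1) e.linearIndependent
      · intro p
        rw [he]; exact s.low_h' (hu p.1) _
      · intro p
        have h1 := s.lead_pol s.Z_deg l (p.2 : ℕ) _ _ (F_mem (low_weight (hu p.1)) le_rfl)
        rw [he]
        simp only [gb]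
        rw [LinearMap.sub_apply] at h1
        convert h1 using 2
        ring
    have hspan : Submodule.span ℂ (Set.range gb) = ⊤ :=
      hgb.span_eq_top_of_card_eq_finrank' (finrank_eq_card_basis e).symm
    have hle : LinearMap.range P ≤ Submodule.span ℂ (Set.range fun p : J => P (gb p.1)) := by
      rw [LinearMap.range_eq_map, ← hspan, Submodule.map_span, Submodule.span_le]
      rintro _ ⟨_, ⟨p, rfl⟩, rfl⟩
      by_cases hp : (p.2 : ℕ) + l ≤ m p.1
      · exact Submodule.subset_span ⟨⟨p, hp⟩, rfl⟩
      · have : P (gb p) = 0 := by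
          simp only [gb, hP]
          rw [← Module.End.mul_apply, ← map_mul, mul_comm, ← pol_add]
          exact s.pol_kill' (hu p.1) (hm p.1) (by omega)
        rw [this]
        exact Submodule.zero_mem _
    exact (Submodule.finrank_mono hle).trans (finrank_range_le_card _)
  -- lower bound
  have hlow : Fintype.card (Option J) ≤ finrank ℂ (LinearMap.range Q) := by
    let f : Option J → V := fun o => o.elim (Q (u i₀)) fun p => Q (e p.1)
    let g : Option J → V := fun o => o.elim S fun p => e ⟨p.1.1, ⟨p.1.2 + l, by have := p.2; omega⟩⟩
    let w : Option J → ℤ := fun o => o.elim ((m i₀ : ℤ) - k)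
      fun p => 2 * ((p.1.2 : ℕ) + l : ℤ) - m p.1.1
    have hg : LinearIndependent ℂ g := by
      rw [linearIndependent_option]
      constructor
      · refine e.linearIndependent.comp
          (fun p : J => (⟨p.1.1, ⟨p.1.2 + l, by have := p.2; omega⟩⟩ : Σ i, Fin (m i + 1))) ?_
        rintro ⟨⟨i, b⟩, hb⟩ ⟨⟨j, b'⟩, hb'⟩ h
        simp only [Sigma.mk.injEq] at h
        obtain ⟨rfl, h⟩ := h
        simp only [heq_eq_eq, Fin.mk.injEq, Nat.add_right_cancel_iff] at h
        have := Fin.ext h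
        subst this
        rfl
      · intro hmem
        have : Submodule.span ℂ (Set.range (g ∘ Option.some)) ≤ LinearMap.ker (e.coord p₀) := by
          rw [Submodule.span_le]
          rintro _ ⟨p, rfl⟩
          have hne : (⟨p.1.1, ⟨p.1.2 + l, by have := p.2; omega⟩⟩ : Σ i, Fin (m i + 1)) ≠ p₀ := by
            intro h
            rw [← h] at hp₀l
            simp at hp₀l
          simp [g, Finsupp.single_apply, hne]
        have h1 := this hmem
        simp only [LinearMap.mem_ker, Basis.coord_apply] at h1
        exact hSp h1
    have hf : LinearIndependent ℂ f := by
      apply lead_indep H f g w hg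
      · rintro (_ | p)
        · simp only [g, w, Option.elim]
          have := (s.var_hom hD l).eig (low_weight (hu i₀))
          rw [hS, this]
          congr 2
          rw [hl]; push_cast; ring
        · simp only [g, w, Option.elim]
          rw [he, s.low_h' (hu _)]
          push_cast
          rfl
      · rintro (_ | p)
        · simp only [f, g, w, Option.elim]
          have h1 := s.var_pol hk s.Z_deg hD hE l _ _ (F_mem (low_weight (hu i₀)) le_rfl)
          rw [LinearMap.sub_apply, LinearMap.sub_apply, s.pol_kill' (hu i₀) (hm i₀) (by omega),
            sub_zero] at h1
          convert h1 using 2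
          rw [hl]; push_cast; ring
        · simp only [f, g, w, Option.elim]
          have h1 := s.lead_pol hW 0 l _ _ (F_mem (s.low_h' (hu p.1.1) (p.1.2 : ℕ)) le_rfl)
          rw [LinearMap.sub_apply, ← Module.End.mul_apply (X ^ l), ← pow_add] at h1
          rw [he, he]
          simp only
          rw [add_comm (p.1.2 : ℕ) l]
          convert h1 using 2
          ring
    rw [← finrank_span_eq_card hf]
    apply Submodule.finrank_mono
    rw [Submodule.span_le]
    rintro _ ⟨(_ | p), rfl⟩
    · exact ⟨_, rfl⟩
    · exact ⟨_, rfl⟩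
  have := hrank (pol 0 l)
  rw [← hP, ← hQ] at this
  rw [Fintype.card_option] at hlow
  omega

lemma SL.main [FiniteDimensional ℂ V] (s : SL X H Y)
    (hEven : ∀ m u, u ≠ 0 → Low H Y m u → Even m)
    {D : End ℂ V} (hDY : ∀ v, D (Y v) = Y (D v))
    (hrank : ∀ p : Polynomial ℂ,
      finrank ℂ (LinearMap.range (Polynomial.aeval (X - Y + D) p)) ≤
      finrank ℂ (LinearMap.range (Polynomial.aeval (X - Y) p))) : D = 0 := by
  have sad : SL (LinearMap.mulLeft ℂ X - LinearMap.mulRight ℂ X)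
      (LinearMap.mulLeft ℂ H - LinearMap.mulRight ℂ H)
      (LinearMap.mulLeft ℂ Y - LinearMap.mulRight ℂ Y) := by
    constructor
    · intro A; ext v
      simp only [LinearMap.sub_apply, LinearMap.mulLeft_apply, LinearMap.mulRight_apply,
        Module.End.mul_apply, LinearMap.add_apply, LinearMap.smul_apply, map_sub, map_add, map_smul, s.hx]
      module
    · intro A; ext v
      simp only [LinearMap.sub_apply, LinearMap.mulLeft_apply, LinearMap.mulRight_apply,
        Module.End.mul_apply, LinearMap.add_apply, LinearMap.smul_apply, map_sub, map_add, map_smul, s.hy]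
      module
    · intro A; ext v
      simp only [LinearMap.sub_apply, LinearMap.mulLeft_apply, LinearMap.mulRight_apply,
        Module.End.mul_apply, LinearMap.add_apply, LinearMap.smul_apply, map_sub, map_add, map_smul, s.xy]
      module
  obtain ⟨N, hN⟩ := sad.decomp
  obtain ⟨f, hf, hs⟩ := hN D (by ext v; simp [hDY])
  have hfY : ∀ j v, f j (Y v) = Y (f j v) := by
    intro j v
    have := LinearMap.congr_fun (hf j).1 v
    simp [sub_eq_zero] at this
    exact this.symm
  have hfH : ∀ j : ℕ, Hom H (-(j : ℤ)) (f j) := by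
    intro j v
    have := LinearMap.congr_fun (hf j).2 v
    simp only [LinearMap.sub_apply, LinearMap.mulLeft_apply, LinearMap.mulRight_apply,
        Module.End.mul_apply, LinearMap.smul_apply] at this
    rw [sub_eq_iff_eq_add] at this
    rw [this]; push_cast; module
  have key : ∀ j, j < N → f j = 0 := by
    intro j
    induction j using Nat.strong_induction_on with
    | _ j ih =>
      intro hj
      have hE : (∑ i ∈ (Finset.range N).erase j, f i) ∈ deg H (-(j : ℤ) - 1) := by
        refine Submodule.sum_mem _ fun i hi => ?_
        rw [Finset.mem_erase, Finset.mem_range] at hi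
        rcases lt_or_gt_of_ne hi.1 with h | h
        · rw [ih i h hi.2]; exact Submodule.zero_mem _
        · exact deg_mono (by omega) (hfH i).deg
      refine s.step hEven (by omega) (hfH j) hE (hfY j) ?_
      rw [Finset.add_sum_erase _ _ (Finset.mem_range.2 hj), ← hs]
      exact hrank
  rw [hs]
  exact Finset.sum_eq_zero fun j hj => key j (Finset.mem_range.1 hj)

end

end EvenOrbit

open EvenOrbit

theorem even_orbit_meets_slice_in_single_point
    {n : ℕ} (X H Y : Matrix (Fin n) (Fin n) ℝ)
    (hX0 : X ≠ 0)
    (hHX : H * X - X * H = (2 : ℝ) • X)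
    (hHY : H * Y - Y * H = (-2 : ℝ) • Y)
    (hXY : X * Y - Y * X = H)
    (hEven : ∀ μ ∈ spectrum ℂ (H.map (algebraMap ℝ ℂ)), ∃ m : ℤ, μ = 2 * m)
    (g : GL (Fin n) ℝ)
    (hg : ((g : Matrix (Fin n) (Fin n) ℝ) * (X - Y) * (↑g⁻¹ : Matrix (Fin n) (Fin n) ℝ) - X) * Y
        = Y * ((g : Matrix (Fin n) (Fin n) ℝ) * (X - Y) * (↑g⁻¹ : Matrix (Fin n) (Fin n) ℝ) - X)) :
    (g : Matrix (Fin n) (Fin n) ℝ) * (X - Y) * (↑g⁻¹ : Matrix (Fin n) (Fin n) ℝ) = X - Y := by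
  let φ : Matrix (Fin n) (Fin n) ℝ →+* Module.End ℂ (Fin n → ℂ) :=
    ((Matrix.toLinAlgEquiv' : Matrix (Fin n) (Fin n) ℂ ≃ₐ[ℂ] _) : _ →+* _).comp
      ((algebraMap ℝ ℂ).mapMatrix)
  have hinj : Function.Injective φ := by
    intro A B h
    have h1 := (Matrix.toLinAlgEquiv' : Matrix (Fin n) (Fin n) ℂ ≃ₐ[ℂ] _).injective h
    exact Matrix.map_injective (algebraMap ℝ ℂ).injective h1
  have h2 : ∀ A : Matrix (Fin n) (Fin n) ℝ, (2 : ℝ) • A = A + A := fun A => two_smul ℝ A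
  have s : SL (φ X) (φ H) (φ Y) := by
    constructor
    · intro v
      have := LinearMap.congr_fun (congrArg φ hHX) v
      rw [h2, map_add, map_sub, map_mul, map_mul] at this
      simp only [LinearMap.sub_apply, LinearMap.add_apply, Module.End.mul_apply] at this
      rw [sub_eq_iff_eq_add'.1 this, two_smul]
    · intro v
      have := LinearMap.congr_fun (congrArg φ hHY) v
      rw [neg_smul, h2, map_neg, map_add, map_sub, map_mul, map_mul] at this
      simp only [LinearMap.sub_apply, LinearMap.add_apply, LinearMap.neg_apply,
        Module.End.mul_apply] at this
      rw [sub_eq_iff_eq_add'.1 this, two_smul]; abel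
    · intro v
      have := LinearMap.congr_fun (congrArg φ hXY) v
      rw [map_sub, map_mul, map_mul] at this
      simp only [LinearMap.sub_apply, Module.End.mul_apply] at this
      rw [sub_eq_iff_eq_add'.1 this]
  have hE : ∀ m u, u ≠ 0 → Low (φ H) (φ Y) m u → Even m := by
    intro m u hu0 hu
    have hev : Module.End.HasEigenvalue (φ H) (-(m : ℂ)) :=
      Module.End.hasEigenvalue_of_hasEigenvector
        ⟨Module.End.mem_eigenspace_iff.2 hu.2, hu0⟩
    have hsp := hev.mem_spectrum
    have : spectrum ℂ (φ H) = spectrum ℂ (H.map (algebraMap ℝ ℂ)) :=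
      AlgEquiv.spectrum_eq (Matrix.toLinAlgEquiv' : Matrix (Fin n) (Fin n) ℂ ≃ₐ[ℂ] _)
        (H.map (algebraMap ℝ ℂ))
    rw [this] at hsp
    obtain ⟨k, hk⟩ := hEven _ hsp
    have hk' : -(m : ℤ) = 2 * k := by exact_mod_cast hk
    rw [Nat.even_iff]; omega
  set W := (g : Matrix (Fin n) (Fin n) ℝ) * (X - Y) * (↑g⁻¹ : Matrix (Fin n) (Fin n) ℝ) with hW
  have hcomm : (W - (X - Y)) * Y = Y * (W - (X - Y)) := by
    have e1 : W - (X - Y) = (W - X) + Y := by abel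
    rw [e1, add_mul, mul_add, hg]
  have hZD : φ X - φ Y + φ (W - (X - Y)) = φ W := by
    rw [← map_sub, ← map_add]; congr 1; abel
  have hD := s.main hE (D := φ (W - (X - Y)))
    (fun v => by
      have := LinearMap.congr_fun (congrArg φ hcomm) v
      simpa only [map_mul, Module.End.mul_apply] using this)
    (by
      intro p
      rw [hZD]
      have hgg : (g : Matrix (Fin n) (Fin n) ℝ) * (↑g⁻¹ : Matrix (Fin n) (Fin n) ℝ) = 1 := by
        simp
      have hgg' : (↑g⁻¹ : Matrix (Fin n) (Fin n) ℝ) * (g : Matrix (Fin n) (Fin n) ℝ) = 1 := by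
        simp
      have h1 : φ W * φ g = φ g * (φ X - φ Y) := by
        rw [← map_sub, ← map_mul, ← map_mul, hW, mul_assoc, hgg', mul_one]
      have h3 := aeval_semiconj h1 p
      have h4 : Polynomial.aeval (φ W) p =
          φ g * (Polynomial.aeval (φ X - φ Y) p * φ (↑g⁻¹ : Matrix (Fin n) (Fin n) ℝ)) := by
        rw [← mul_assoc, ← h3, mul_assoc, ← map_mul, hgg, map_one, mul_one]
      have h5 : LinearMap.range (Polynomial.aeval (φ W) p) ≤
          (LinearMap.range (Polynomial.aeval (φ X - φ Y) p)).map (φ g) := by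
        rw [h4]
        rintro _ ⟨v, rfl⟩
        exact ⟨_, ⟨_, rfl⟩, rfl⟩
      exact (Submodule.finrank_mono h5).trans (Submodule.finrank_map_le _ _))
  have : W - (X - Y) = 0 := hinj (by rw [hD, map_zero])
  exact sub_eq_zero.1 this
end

section
/- Let (X, H, Y) and (X', H', Y') be two sl₂-triples of n×n real matrices such that X − Y = X' − Y'. Then there exists g ∈ GL(n,ℝ) with g X g⁻¹ = X'. -/
namespace RaoSl2

open Module

structure Trip {V : Type} [AddCommGroup V] [Module ℂ V] (X H Y : End ℂ V) : Prop where
  hx : ∀ w, H (X w) = X (H w) + (2 : ℂ) • X w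
  hy : ∀ w, H (Y w) = Y (H w) - (2 : ℂ) • Y w
  xy : ∀ w, X (Y w) = Y (X w) + H w

/-- No infinite sequences of eigenvectors with distinct eigenvalues. -/
lemma exists_zero {W : Type} [AddCommGroup W] [Module ℂ W] [FiniteDimensional ℂ W]
    (H : End ℂ W) (lam : ℂ) (u : ℕ → W) (hu : ∀ j : ℕ, H (u j) = (lam - 2 * j) • u j) :
    ∃ j, u j = 0 := by
  by_contra! hne
  have hfin := H.finite_hasEigenvalue
  have hinj : Function.Injective (fun j : ℕ => lam - 2 * (j : ℂ)) := by
    intro a b hab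
    have : (a : ℂ) = b := by
      have : lam - 2 * (a : ℂ) = lam - 2 * b := hab
      linear_combination (-1 / 2 : ℂ) * this
    exact_mod_cast this
  refine Set.infinite_range_of_injective hinj (hfin.subset ?_)
  rintro _ ⟨j, rfl⟩
  exact End.hasEigenvalue_of_hasEigenvector (End.hasEigenvector_iff.2
    ⟨End.mem_eigenspace_iff.2 (hu j), hne j⟩)

/-- Ladder argument: the top weight is a natural number. -/
lemma ladder {W : Type} [AddCommGroup W] [Module ℂ W] [FiniteDimensional ℂ W]
    (H F : End ℂ W) (lam : ℂ) (u : ℕ → W) (hu : ∀ j : ℕ, H (u j) = (lam - 2 * j) • u j)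
    (h0 : u 0 ≠ 0)
    (hF : ∀ j : ℕ, F (u (j + 1)) = (((j : ℂ) + 1) * (lam - j)) • u j) :
    ∃ n : ℕ, lam = n ∧ u (n + 1) = 0 ∧ u n ≠ 0 := by
  classical
  have hex := exists_zero H lam u hu
  obtain ⟨m, hm⟩ : ∃ m, Nat.find hex = m + 1 := by
    refine Nat.exists_eq_succ_of_ne_zero fun h => h0 ?_
    have := Nat.find_spec hex
    rwa [h] at this
  have h1 : u (m + 1) = 0 := hm ▸ Nat.find_spec hex
  have h2 : u m ≠ 0 := Nat.find_min hex (by omega)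
  refine ⟨m, ?_, h1, h2⟩
  have := hF m
  rw [h1, map_zero, eq_comm, smul_eq_zero] at this
  have h3 := this.resolve_right h2
  have h4 : ((m : ℂ) + 1) ≠ 0 := by exact_mod_cast Nat.succ_ne_zero m
  have := (mul_eq_zero.1 h3).resolve_left h4
  linear_combination this


noncomputable def mX (n : ℕ) : End ℂ (Fin (n + 1) → ℂ) :=
  LinearMap.pi (Fin.lastCases 0 (fun j : Fin n => LinearMap.proj j.succ))
noncomputable def mY (n : ℕ) : End ℂ (Fin (n + 1) → ℂ) :=
  LinearMap.pi (Fin.cases 0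
    (fun j : Fin n => (((j : ℕ) + 1 : ℂ) * (n - (j : ℕ))) • LinearMap.proj j.castSucc))
noncomputable def mH (n : ℕ) : End ℂ (Fin (n + 1) → ℂ) :=
  LinearMap.pi (fun j => ((n : ℂ) - 2 * (j : ℕ)) • LinearMap.proj j)

lemma mX_last (n : ℕ) (a) : mX n a (Fin.last n) = 0 := by simp [mX]
lemma mX_castSucc (n : ℕ) (a) (j : Fin n) : mX n a j.castSucc = a j.succ := by simp [mX]
lemma mY_zero (n : ℕ) (a) : mY n a 0 = 0 := by simp [mY]
lemma mY_succ (n : ℕ) (a) (j : Fin n) :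
    mY n a j.succ = (((j : ℕ) + 1 : ℂ) * (n - (j : ℕ))) * a j.castSucc := by simp [mY]
lemma mH_apply (n : ℕ) (a) (j) : mH n a j = ((n : ℂ) - 2 * (j : ℕ)) * a j := by simp [mH]

section
variable {V : Type} [AddCommGroup V] [Module ℂ V] {X H Y : End ℂ V}

lemma Trip.H_powY (t : Trip X H Y) (j : ℕ) (w : V) :
    H ((Y ^ j) w) = (Y ^ j) (H w) - (2 * (j : ℂ)) • (Y ^ j) w := by
  induction j with
  | zero => simp
  | succ j ih =>
    rw [pow_succ', Module.End.mul_apply, Module.End.mul_apply, t.hy, ih]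
    simp only [map_sub, map_smul]
    push_cast
    module

lemma Trip.H_powX (t : Trip X H Y) (j : ℕ) (w : V) :
    H ((X ^ j) w) = (X ^ j) (H w) + (2 * (j : ℂ)) • (X ^ j) w := by
  induction j with
  | zero => simp
  | succ j ih =>
    rw [pow_succ', Module.End.mul_apply, Module.End.mul_apply, t.hx, ih]
    simp only [map_add, map_smul]
    push_cast
    module

/-- `X Y^{j+1} = Y^{j+1} X + (j+1) Y^j (H - j)`. -/
lemma Trip.X_powY (t : Trip X H Y) (j : ℕ) (w : V) :
    X ((Y ^ (j + 1)) w) = (Y ^ (j + 1)) (X w)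
      + ((j : ℂ) + 1) • ((Y ^ j) (H w) - (j : ℂ) • (Y ^ j) w) := by
  induction j with
  | zero => simp [t.xy]
  | succ j ih =>
    rw [pow_succ', Module.End.mul_apply, t.xy, ih, t.H_powY]
    have hs : ∀ (k : ℕ) (z : V), Y ((Y ^ k) z) = (Y ^ (k + 1)) z := fun k z => by
      rw [pow_succ' Y k, Module.End.mul_apply]
    simp only [map_add, map_smul, map_sub, Module.End.mul_apply, hs]
    push_cast
    module

/-- `X^{j+1} Y = Y X^{j+1} + (j+1) X^j (H + j)`. -/
lemma Trip.powX_Y (t : Trip X H Y) (j : ℕ) (w : V) :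
    (X ^ (j + 1)) (Y w) = Y ((X ^ (j + 1)) w)
      + ((j : ℂ) + 1) • ((X ^ j) (H w) + (j : ℂ) • (X ^ j) w) := by
  induction j with
  | zero => simp [t.xy]
  | succ j ih =>
    rw [pow_succ', Module.End.mul_apply, ih]
    have hs : ∀ (k : ℕ) (z : V), X ((X ^ k) z) = (X ^ (k + 1)) z := fun k z => by
      rw [pow_succ' X k, Module.End.mul_apply]
    simp only [map_add, map_smul, t.xy, t.H_powX, Module.End.mul_apply, hs]
    push_cast
    module

end

lemma split {V : Type} [AddCommGroup V] [Module ℂ V] [FiniteDimensional ℂ V] {X H Y : End ℂ V}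
    (t : Trip X H Y) (lam : ℂ) (hl : H.HasEigenvalue lam) (hl2 : ¬ H.HasEigenvalue (lam + 2)) :
    ∃ (n : ℕ) (C : Submodule ℂ V) (e : V ≃ₗ[ℂ] (Fin (n + 1) → ℂ) × C) (x h y : End ℂ C),
      lam = n ∧ Trip x h y ∧
      (∀ w, e (X w) = (mX n (e w).1, x (e w).2)) ∧
      (∀ w, e (H w) = (mH n (e w).1, h (e w).2)) ∧
      (∀ w, e (Y w) = (mY n (e w).1, y (e w).2)) := by
  have kill : ∀ w, H w = (lam + 2) • w → w = 0 := by
    intro w hw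
    by_contra h0
    exact hl2 (End.hasEigenvalue_of_hasEigenvector (End.hasEigenvector_iff.2
      ⟨End.mem_eigenspace_iff.2 hw, h0⟩))
  obtain ⟨v, hv⟩ := hl.exists_hasEigenvector
  have hv0 : v ≠ 0 := hv.2
  have hHv : H v = lam • v := hv.apply_eq_smul
  have hXv : X v = 0 := kill _ (by rw [t.hx, hHv, map_smul]; module)
  have hHY : ∀ j : ℕ, H ((Y ^ j) v) = (lam - 2 * j) • (Y ^ j) v := by
    intro j; rw [t.H_powY, hHv, map_smul]; module
  have hXY : ∀ j : ℕ, X ((Y ^ (j + 1)) v) = (((j : ℂ) + 1) * (lam - j)) • (Y ^ j) v := by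
    intro j; rw [t.X_powY, hXv, hHv, map_smul, map_zero]; module
  obtain ⟨n, rfl, hYn1, hYn⟩ := ladder H X lam (fun j => (Y ^ j) v) hHY (by simpa using hv0) hXY
  -- v is not in the range of H - n
  have hvr : v ∉ LinearMap.range (H - (n : ℂ) • (1 : End ℂ V)) := by
    rintro ⟨w, hw⟩
    have hHw : H w = (n : ℂ) • w + v := by
      rw [← hw]; simp
    have hXw : X w = 0 := kill _ (by rw [t.hx, hHw, map_add, map_smul, hXv]; module)
    have hYv : ∀ j : ℕ, (Y ^ (n + 1 + j)) v = 0 := by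
      intro j; rw [add_comm, pow_add, Module.End.mul_apply, hYn1, map_zero]
    obtain ⟨j, hj⟩ := exists_zero H ((n : ℂ) - 2 * (n + 1)) (fun j => (Y ^ (n + 1 + j)) w) (by
      intro j
      rw [t.H_powY, hHw, map_add, map_smul, hYv]
      push_cast
      module)
    have hne : ∀ j : ℕ, (Y ^ (n + 1 + j)) w ≠ 0 := by
      intro j
      induction j with
      | zero =>
        intro h
        have h1 := t.X_powY n w
        rw [hXw, hHw, map_add, map_smul, map_zero] at h1
        rw [add_zero] at h
        rw [h, map_zero] at h1
        have h2 : ((n : ℂ) + 1) • (Y ^ n) v = 0 := by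
          rw [h1]; module
        rw [smul_eq_zero] at h2
        exact hYn (h2.resolve_left (by exact_mod_cast Nat.succ_ne_zero n))
      | succ j ih =>
        intro h
        have h1 := t.X_powY (n + 1 + j) w
        rw [hXw, hHw, map_add, map_smul, map_zero, hYv] at h1
        rw [← add_assoc] at h
        rw [h, map_zero] at h1
        have h2 : (((n + 1 + j + 1 : ℕ) : ℂ) * ((j + 1 : ℕ) : ℂ)) • (Y ^ (n + 1 + j)) w = 0 := by
          have h3 := congrArg (fun z => -z) h1
          simp only [neg_zero] at h3
          rw [h3]; push_cast; module
        rw [smul_eq_zero] at h2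
        refine ih (h2.resolve_left ?_)
        exact mul_ne_zero (Nat.cast_ne_zero.2 (by omega)) (Nat.cast_ne_zero.2 (by omega))
    exact hne j hj
  obtain ⟨φ, hφv, hφr⟩ : ∃ φ : V →ₗ[ℂ] ℂ, φ v = 1 ∧ ∀ w, φ (H w) = n * φ w := by
    obtain ⟨f, hf, hfr⟩ := Submodule.exists_le_ker_of_notMem hvr
    refine ⟨(f v)⁻¹ • f, by simp [hf], fun w => ?_⟩
    have : f ((H - (n : ℂ) • (1 : End ℂ V)) w) = 0 := hfr ⟨w, rfl⟩
    simp only [LinearMap.sub_apply, LinearMap.smul_apply, Module.End.one_apply, map_sub, map_smul,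
      smul_eq_mul] at this ⊢
    linear_combination (f v)⁻¹ * this
  have hφY : ∀ w, φ (Y w) = 0 := by
    have hinj : Function.Injective (H - ((n : ℂ) + 2) • (1 : End ℂ V)) := by
      rw [← LinearMap.ker_eq_bot, LinearMap.ker_eq_bot']
      intro w hw
      exact kill w (by simpa [sub_eq_zero] using hw)
    have hsurj := LinearMap.injective_iff_surjective.1 hinj
    intro w
    obtain ⟨z, rfl⟩ := hsurj w
    have h1 := hφr (Y z)
    rw [t.hy, map_sub, map_smul] at h1
    simp only [LinearMap.sub_apply, LinearMap.smul_apply, Module.End.one_apply, map_sub, map_smul]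
    simp only [smul_eq_mul] at *
    linear_combination h1
  have hφXH : ∀ (j : ℕ) w, φ ((X ^ j) (H w)) = (n - 2 * j) * φ ((X ^ j) w) := by
    intro j w
    have h1 := hφr ((X ^ j) w)
    rw [t.H_powX, map_add, map_smul, smul_eq_mul] at h1
    linear_combination h1
  have hφXY : ∀ (j : ℕ) w, φ ((X ^ (j + 1)) (Y w)) = (((j : ℂ) + 1) * (n - j)) * φ ((X ^ j) w) := by
    intro j w
    rw [t.powX_Y, map_add, hφY, map_smul, map_add, hφXH, map_smul]
    simp only [smul_eq_mul]; ring
  have hφX : ∀ w, φ ((X ^ (n + 1)) w) = 0 := by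
    obtain ⟨m, hm, hm1, -⟩ := ladder (W := Module.Dual ℂ V) (Module.Dual.transpose (R := ℂ) H)
      (Module.Dual.transpose (R := ℂ) Y) n
      (fun j => φ ∘ₗ (X ^ j)) (by
        intro j; ext w; exact hφXH j w)
      (by
        intro h
        have : φ v = 0 := by simpa using LinearMap.congr_fun h v
        rw [hφv] at this
        exact one_ne_zero this)
      (by intro j; ext w; exact hφXY j w)
    have : n = m := by exact_mod_cast hm
    subst this
    intro w
    simpa using LinearMap.congr_fun hm1 w
  -- the scalars
  obtain ⟨d, hd0, hd⟩ : ∃ d : ℕ → ℂ, d 0 = 1 ∧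
      ∀ j : ℕ, d (j + 1) = (((j : ℂ) + 1) * (n - j)) * d j :=
    ⟨fun j => Nat.rec 1 (fun j z => (((j : ℂ) + 1) * (n - j)) * z) j, rfl, fun _ => rfl⟩
  have hcne : ∀ j : ℕ, j < n → (((j : ℂ) + 1) * (n - j)) ≠ 0 := by
    intro j hj
    refine mul_ne_zero (by exact_mod_cast Nat.succ_ne_zero j) (sub_ne_zero.2 ?_)
    exact_mod_cast hj.ne'
  have hdne : ∀ j : ℕ, j ≤ n → d j ≠ 0 := by
    intro j
    induction j with
    | zero => intro _; rw [hd0]; exact one_ne_zero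
    | succ j ih => intro h; rw [hd]; exact mul_ne_zero (hcne j (by omega)) (ih (by omega))
  have hdiag : ∀ j : ℕ, φ ((X ^ j) ((Y ^ j) v)) = d j := by
    intro j
    induction j with
    | zero => simp [hφv, hd0]
    | succ j ih => rw [pow_succ' Y, Module.End.mul_apply, hφXY, ih, hd]
  have hoff : ∀ i j : ℕ, i ≠ j → φ ((X ^ i) ((Y ^ j) v)) = 0 := by
    intro i j hij
    have h1 := hφXH i ((Y ^ j) v)
    rw [hHY, map_smul, map_smul, smul_eq_mul] at h1
    have h2 : ((i : ℂ) - j) * φ ((X ^ i) ((Y ^ j) v)) = 0 := by linear_combination h1 / 2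
    refine (mul_eq_zero.1 h2).resolve_left (sub_ne_zero.2 ?_)
    exact_mod_cast hij
  let T : V →ₗ[ℂ] (Fin (n + 1) → ℂ) := LinearMap.pi (fun j => φ ∘ₗ (X ^ (j : ℕ)))
  have hT : ∀ w j, T w j = φ ((X ^ (j : ℕ)) w) := fun w j => rfl
  let S : (Fin (n + 1) → ℂ) →ₗ[ℂ] V :=
    ∑ j : Fin (n + 1), (LinearMap.proj j : (Fin (n + 1) → ℂ) →ₗ[ℂ] ℂ).smulRight
      ((d j)⁻¹ • (Y ^ (j : ℕ)) v)
  have hS : ∀ a, S a = ∑ j : Fin (n + 1), a j • (d j)⁻¹ • (Y ^ (j : ℕ)) v := by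
    intro a; simp [S]
  have hTS : ∀ a, T (S a) = a := by
    intro a
    funext i
    rw [hT, hS, map_sum, map_sum, Finset.sum_eq_single i]
    · simp only [map_smul, smul_eq_mul, hdiag]
      rw [inv_mul_cancel₀ (hdne _ (by omega)), mul_one]
    · intro j _ hj
      simp only [map_smul, smul_eq_mul]
      rw [hoff _ _ (fun h => hj (Fin.ext h.symm))]; simp
    · simp
  have hTX : ∀ w, T (X w) = mX n (T w) := by
    intro w; funext j
    refine Fin.lastCases ?_ (fun j => ?_) j
    · rw [mX_last, hT, ← Module.End.mul_apply, ← pow_succ]; exact hφX w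
    · rw [mX_castSucc, hT, hT, ← Module.End.mul_apply, ← pow_succ]; rfl
  have hTH : ∀ w, T (H w) = mH n (T w) := by
    intro w; funext j
    rw [mH_apply, hT, hT, hφXH]
  have hTY : ∀ w, T (Y w) = mY n (T w) := by
    intro w; funext j
    refine Fin.cases ?_ (fun j => ?_) j
    · rw [mY_zero, hT]; simpa using hφY w
    · rw [mY_succ, hT, hT, Fin.val_succ, hφXY]; rfl
  have hSX : ∀ a, X (S a) = S (mX n a) := by
    intro a
    rw [hS, hS, Fin.sum_univ_succ, Fin.sum_univ_castSucc, mX_last, map_add, map_sum]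
    simp only [map_smul, Fin.val_zero, pow_zero, Module.End.one_apply, hXv, smul_zero, zero_add,
      zero_smul, add_zero, mX_castSucc, Fin.val_succ, hXY, Fin.val_castSucc]
    refine Finset.sum_congr rfl fun j _ => ?_
    have h1 := hcne j j.2
    congr 1
    rw [hd, smul_smul, mul_inv_rev, mul_assoc, inv_mul_cancel₀ h1, mul_one]
  have hSH : ∀ a, H (S a) = S (mH n a) := by
    intro a
    rw [hS, hS, map_sum]
    refine Finset.sum_congr rfl fun j _ => ?_
    rw [map_smul, map_smul, hHY, mH_apply]
    module
  have hSY : ∀ a, Y (S a) = S (mY n a) := by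
    intro a
    rw [hS, hS, Fin.sum_univ_castSucc, Fin.sum_univ_succ, mY_zero, map_add, map_sum]
    simp only [map_smul, zero_smul, zero_add, mY_succ, Fin.val_succ, Fin.val_castSucc,
      Fin.val_last, ← Module.End.mul_apply, ← pow_succ']
    rw [hYn1, smul_zero, smul_zero, add_zero]
    refine Finset.sum_congr rfl fun j _ => ?_
    have h1 := hcne j j.2
    rw [hd, smul_smul, smul_smul]
    congr 1
    have h3 := right_ne_zero_of_mul h1
    have h4 := left_ne_zero_of_mul h1
    field_simp
  let C := LinearMap.ker T
  have hCX : ∀ w ∈ C, X w ∈ C := by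
    intro w hw
    rw [LinearMap.mem_ker] at hw ⊢; rw [hTX, hw, map_zero]
  have hCH : ∀ w ∈ C, H w ∈ C := by
    intro w hw
    rw [LinearMap.mem_ker] at hw ⊢; rw [hTH, hw, map_zero]
  have hCY : ∀ w ∈ C, Y w ∈ C := by
    intro w hw
    rw [LinearMap.mem_ker] at hw ⊢; rw [hTY, hw, map_zero]
  let p : V →ₗ[ℂ] C := LinearMap.codRestrict C (LinearMap.id - S ∘ₗ T) (by
    intro w; rw [LinearMap.mem_ker]; simp [hTS])
  have hp : ∀ w, (p w : V) = w - S (T w) := fun w => rfl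
  let e : V ≃ₗ[ℂ] (Fin (n + 1) → ℂ) × C :=
    LinearEquiv.ofLinearMap (T.prod p) (S.coprod C.subtype)
      (by
        apply LinearMap.ext
        rintro ⟨a, c⟩
        have hc : T c = 0 := c.2
        refine Prod.ext ?_ (Subtype.ext ?_)
        · simp [hTS, hc]
        · simp [hp, hTS, hc])
      (by
        ext w; simp [hp])
  have he1 : ∀ w, (e w).1 = T w := fun w => rfl
  have he2 : ∀ w, (e w).2 = p w := fun w => rfl
  refine ⟨n, C, e, X.restrict hCX, H.restrict hCH, Y.restrict hCY, rfl, ⟨?_, ?_, ?_⟩, ?_, ?_, ?_⟩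
  · intro w; apply Subtype.ext; simpa using t.hx w
  · intro w; apply Subtype.ext; simpa using t.hy w
  · intro w; apply Subtype.ext; simpa using t.xy w
  · intro w
    refine Prod.ext (hTX w) (Subtype.ext ?_)
    simp [he2, hp, hTX, hSX]
  · intro w
    refine Prod.ext (hTH w) (Subtype.ext ?_)
    simp [he2, hp, hTH, hSH]
  · intro w
    refine Prod.ext (hTY w) (Subtype.ext ?_)
    simp [he2, hp, hTY, hSY]

theorem iso_of_charpoly (d : ℕ) : ∀ (V V' : Type) [AddCommGroup V] [Module ℂ V]
    [FiniteDimensional ℂ V] [AddCommGroup V'] [Module ℂ V'] [FiniteDimensional ℂ V']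
    (X H Y : End ℂ V) (X' H' Y' : End ℂ V'), Trip X H Y → Trip X' H' Y' →
    finrank ℂ V = d → H.charpoly = H'.charpoly →
    ∃ g : V ≃ₗ[ℂ] V', (∀ w, g (X w) = X' (g w)) ∧ (∀ w, g (H w) = H' (g w)) ∧
      (∀ w, g (Y w) = Y' (g w)) := by
  induction d using Nat.strong_induction_on with
  | _ d ih =>
  intro V V' _ _ _ _ _ _ X H Y X' H' Y' t t' hd hch
  have hfr : finrank ℂ V = finrank ℂ V' := by
    rw [← H.charpoly_natDegree, ← H'.charpoly_natDegree, hch]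
  rcases Nat.eq_zero_or_pos d with h0 | hpos
  · have hV : Subsingleton V := finrank_zero_iff.1 (hd.trans h0)
    have hV' : Subsingleton V' := finrank_zero_iff.1 (hfr.symm.trans (hd.trans h0))
    exact ⟨LinearEquiv.ofFinrankEq _ _ hfr, fun _ => Subsingleton.elim _ _,
      fun _ => Subsingleton.elim _ _, fun _ => Subsingleton.elim _ _⟩
  have : Nontrivial V := finrank_pos_iff.1 (hd ▸ hpos)
  obtain ⟨lam, hl, hmax⟩ := Set.exists_max_image {μ | H.HasEigenvalue μ} Complex.re
    H.finite_hasEigenvalue (End.exists_eigenvalue H)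
  have hl2 : ¬ H.HasEigenvalue (lam + 2) := by
    intro h
    have := hmax _ h
    simp at this
    linarith
  have hEV : ∀ μ, H.HasEigenvalue μ ↔ H'.HasEigenvalue μ := by
    intro μ
    rw [End.hasEigenvalue_iff_isRoot_charpoly, End.hasEigenvalue_iff_isRoot_charpoly, hch]
  obtain ⟨n, C, e, x, h, y, hn, tC, eX, eH, eY⟩ := split t lam hl hl2
  obtain ⟨n', C', e', x', h', y', hn', tC', eX', eH', eY'⟩ :=
    split t' lam ((hEV _).1 hl) (fun h => hl2 ((hEV _).2 h))
  have hnn : n = n' := by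
    have : (n : ℂ) = n' := hn ▸ hn'
    exact_mod_cast this
  subst hnn
  have c1 : H.charpoly = (mH n).charpoly * h.charpoly := by
    rw [← LinearMap.charpoly_prodMap, ← e.charpoly_conj H]
    congr 1
    apply LinearMap.ext
    intro z
    simp [LinearEquiv.conj_apply, eH]
  have c2 : H'.charpoly = (mH n).charpoly * h'.charpoly := by
    rw [← LinearMap.charpoly_prodMap, ← e'.charpoly_conj H']
    congr 1
    apply LinearMap.ext
    intro z
    simp [LinearEquiv.conj_apply, eH']
  have hCC : h.charpoly = h'.charpoly :=
    mul_left_cancel₀ (mH n).charpoly_monic.ne_zero (c1.symm.trans (hch.trans c2))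
  have hdim : finrank ℂ C < d := by
    have := e.finrank_eq
    rw [finrank_prod, finrank_fin_fun] at this
    omega
  obtain ⟨θ, hθx, hθh, hθy⟩ := ih _ hdim C C' x h y x' h' y' tC tC' rfl hCC
  refine ⟨e.trans (((LinearEquiv.refl ℂ _).prodCongr θ).trans e'.symm), ?_, ?_, ?_⟩
  · intro w
    apply e'.injective
    simp [eX, eX', hθx]
  · intro w
    apply e'.injective
    simp [eH, eH', hθh]
  · intro w
    apply e'.injective
    simp [eY, eY', hθy]

/-- Descent from complex to real conjugacy. -/
lemma descent {n : ℕ} (X X' : Matrix (Fin n) (Fin n) ℝ) (G : Matrix (Fin n) (Fin n) ℂ)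
    (hG : G.det ≠ 0)
    (h : G * X.map Complex.ofReal = X'.map Complex.ofReal * G) :
    ∃ g : GL (Fin n) ℝ,
      (g : Matrix (Fin n) (Fin n) ℝ) * X * (↑g⁻¹ : Matrix (Fin n) (Fin n) ℝ) = X' := by
  set A : Matrix (Fin n) (Fin n) ℝ := G.map Complex.re with hA
  set B : Matrix (Fin n) (Fin n) ℝ := G.map Complex.im with hB
  have hAX : A * X = X' * A := by
    ext i j
    have := congrArg Complex.re (congrFun (congrFun h i) j)
    simpa [Matrix.mul_apply, hA] using this
  have hBX : B * X = X' * B := by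
    ext i j
    have := congrArg Complex.im (congrFun (congrFun h i) j)
    simpa [Matrix.mul_apply, hB] using this
  let P : Matrix (Fin n) (Fin n) (Polynomial ℝ) :=
    A.map Polynomial.C + (Polynomial.X : Polynomial ℝ) • B.map Polynomial.C
  have hP : P.det ≠ 0 := by
    intro h0
    apply hG
    have h1 := congrArg (Polynomial.eval₂RingHom Complex.ofRealHom Complex.I) h0
    rw [RingHom.map_det, map_zero] at h1
    rw [← h1]
    congr 1
    ext i j
    simp [P, hA, hB]
  obtain ⟨s, hs⟩ : ∃ s : ℝ, P.det.eval s ≠ 0 := by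
    by_contra! hc
    exact hP (Polynomial.funext fun s => by simpa using hc s)
  have hdet : (A + s • B).det ≠ 0 := by
    intro h0
    apply hs
    have h1 : P.det.eval s = (Polynomial.evalRingHom s) P.det := rfl
    rw [h1, RingHom.map_det, ← h0]
    congr 1
    ext i j
    simp [P]
    ring
  refine ⟨Matrix.GeneralLinearGroup.mkOfDetNeZero _ hdet, ?_⟩
  set g := Matrix.GeneralLinearGroup.mkOfDetNeZero _ hdet with hg
  have hgv : (g : Matrix (Fin n) (Fin n) ℝ) = A + s • B := rfl
  have : (g : Matrix (Fin n) (Fin n) ℝ) * X = X' * g := by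
    rw [hgv, add_mul, mul_add, hAX, Matrix.smul_mul, hBX, Matrix.mul_smul]
  rw [this, mul_assoc, Units.mul_inv, mul_one]

/-- The Cayley-transformed triple. -/
lemma cayley {n : ℕ} (X H Y : Matrix (Fin n) (Fin n) ℂ)
    (hHX : H * X - X * H = (2 : ℂ) • X)
    (hHY : H * Y - Y * H = (-2 : ℂ) • Y)
    (hXY : X * Y - Y * X = H) :
    Trip (Matrix.toLin' ((1 / 2 : ℂ) • (X + Y + Complex.I • H)))
      (Matrix.toLin' (Complex.I • (X - Y)))
      (Matrix.toLin' ((1 / 2 : ℂ) • (X + Y - Complex.I • H))) := by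
  have e1 : H * X = X * H + (2 : ℂ) • X := by rw [← hHX]; abel
  have e2 : H * Y = Y * H + (-2 : ℂ) • Y := by rw [← hHY]; abel
  have e3 : X * Y = Y * X + H := by rw [← hXY]; abel
  have f1 : ∀ A B : Matrix (Fin n) (Fin n) ℂ, ∀ c : ℂ, A * B = B * A + c • B →
      ∀ w, Matrix.toLin' A (Matrix.toLin' B w)
        = Matrix.toLin' B (Matrix.toLin' A w) + c • Matrix.toLin' B w := by
    intro A B c h w
    rw [← Matrix.toLin'_mul_apply, h, map_add, map_smul, LinearMap.add_apply,
      Matrix.toLin'_mul_apply, LinearMap.smul_apply]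
  have f2 : ∀ A B D : Matrix (Fin n) (Fin n) ℂ, A * B = B * A + D →
      ∀ w, Matrix.toLin' A (Matrix.toLin' B w)
        = Matrix.toLin' B (Matrix.toLin' A w) + Matrix.toLin' D w := by
    intro A B D h w
    rw [← Matrix.toLin'_mul_apply, h, map_add, LinearMap.add_apply, Matrix.toLin'_mul_apply]
  refine ⟨f1 _ _ _ ?_, fun w => ?_, f2 _ _ _ ?_⟩
  · simp only [add_mul, mul_add, sub_mul, mul_sub, Matrix.smul_mul, Matrix.mul_smul, e1, e2, e3]
    match_scalars <;> first | (ring_nf; done) | (ring_nf; simp only [Complex.I_sq]; ring)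
  · refine (f1 _ _ (-2) ?_ w).trans (by rw [neg_smul, ← sub_eq_add_neg])
    simp only [add_mul, mul_add, sub_mul, mul_sub, Matrix.smul_mul, Matrix.mul_smul, e1, e2, e3]
    match_scalars <;> first | (ring_nf; done) | (ring_nf; simp only [Complex.I_sq]; ring)
  · simp only [add_mul, mul_add, sub_mul, mul_sub, Matrix.smul_mul, Matrix.mul_smul, e1, e2, e3]
    match_scalars <;> first | (ring_nf; done) | (ring_nf; simp only [Complex.I_sq]; ring)

end RaoSl2

open RaoSl2 in
theorem conjugate_of_eq_sub_of_sl2Triples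
    {n : ℕ} (X H Y X' H' Y' : Matrix (Fin n) (Fin n) ℝ)
    (hX0 : X ≠ 0)
    (hHX : H * X - X * H = (2 : ℝ) • X)
    (hHY : H * Y - Y * H = (-2 : ℝ) • Y)
    (hXY : X * Y - Y * X = H)
    (hX0' : X' ≠ 0)
    (hHX' : H' * X' - X' * H' = (2 : ℝ) • X')
    (hHY' : H' * Y' - Y' * H' = (-2 : ℝ) • Y')
    (hXY' : X' * Y' - Y' * X' = H')
    (hZ : X - Y = X' - Y') :
    ∃ g : GL (Fin n) ℝ,
      (g : Matrix (Fin n) (Fin n) ℝ) * X * (↑g⁻¹ : Matrix (Fin n) (Fin n) ℝ) = X' := by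
  let F : Matrix (Fin n) (Fin n) ℝ →+* Matrix (Fin n) (Fin n) ℂ := Complex.ofRealHom.mapMatrix
  have hFs : ∀ (r : ℝ) M, F (r • M) = (r : ℂ) • F M := by
    intro r M; ext i j; simp [F]
  have tr : ∀ X H Y : Matrix (Fin n) (Fin n) ℝ, H * X - X * H = (2 : ℝ) • X →
      H * Y - Y * H = (-2 : ℝ) • Y → X * Y - Y * X = H →
      Trip (Matrix.toLin' ((1 / 2 : ℂ) • (F X + F Y + Complex.I • F H)))
      (Matrix.toLin' (Complex.I • (F X - F Y)))
      (Matrix.toLin' ((1 / 2 : ℂ) • (F X + F Y - Complex.I • F H))) := by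
    intro X H Y h1 h2 h3
    apply cayley
    · rw [← map_mul, ← map_mul, ← map_sub, h1, hFs]; norm_num
    · rw [← map_mul, ← map_mul, ← map_sub, h2, hFs]; norm_num
    · rw [← map_mul, ← map_mul, ← map_sub, h3]
  have hFZ : F X - F Y = F X' - F Y' := by rw [← map_sub, hZ, map_sub]
  obtain ⟨g, gX, gH, gY⟩ := iso_of_charpoly _ _ _ _ _ _ _ _ _ (tr X H Y hHX hHY hXY)
    (tr X' H' Y' hHX' hHY' hXY') rfl (by rw [hFZ])
  let G : Matrix (Fin n) (Fin n) ℂ := LinearMap.toMatrix' g.toLinearMap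
  have hGg : Matrix.toLin' G = g.toLinearMap := Matrix.toLin'_toMatrix' _
  have conv : ∀ M M' : Matrix (Fin n) (Fin n) ℂ,
      (∀ w, g (Matrix.toLin' M w) = Matrix.toLin' M' (g w)) → G * M = M' * G := by
    intro M M' h
    apply Matrix.toLin'.injective
    rw [Matrix.toLin'_mul, Matrix.toLin'_mul, hGg]
    exact LinearMap.ext h
  have GX := conv _ _ gX
  have GH := conv _ _ gH
  have GY := conv _ _ gY
  refine descent X X' G ?_ ?_
  · have : IsUnit (LinearMap.det g.toLinearMap) := LinearEquiv.isUnit_det' g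
    rw [← hGg, LinearMap.det_toLin'] at this
    exact this.ne_zero
  · have key : ∀ X Y H : Matrix (Fin n) (Fin n) ℂ, X =
        (1 / 2 : ℂ) • ((1 / 2 : ℂ) • (X + Y + Complex.I • H) + (1 / 2 : ℂ) • (X + Y - Complex.I • H))
        - (Complex.I / 2) • (Complex.I • (X - Y)) := by
      intro X Y H
      match_scalars <;> first | (ring_nf; done) | (ring_nf; simp only [Complex.I_sq]; ring)
    change G * F X = F X' * G
    rw [key (F X) (F Y) (F H), key (F X') (F Y') (F H'), mul_sub, sub_mul, Matrix.mul_smul,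
      Matrix.mul_smul, Matrix.smul_mul, Matrix.smul_mul, mul_add, add_mul, GX, GY, GH]
end
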